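/- Let n ≥ 1 and let q > 1 satisfy (n−2)q < n−1. Then there is no positive bounded classical solution u of the half-space problem: ∂ₜu = Δu in ℝⁿ₊×ℝ together with the nonlinear boundary condition −∂u/∂x₁ = u^q on ∂ℝⁿ₊×ℝ. -/

import Mathlib

open scoped BigOperators
open Set

/-- The Laplacian of `f : ℝⁿ → ℝ` at `x`, as the sum of the second partial
derivatives in the coordinate directions. -/
noncomputable def lap {n : ℕ} (f : EuclideanSpace ℝ (Fin n) → ℝ)
    (x : EuclideanSpace ℝ (Fin n)) : ℝ :=
  ∑ i : Fin n,
    fderiv ℝ (fun y => fderiv ℝ f y (EuclideanSpace.single i 1)) x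
      (EuclideanSpace.single i 1)

/-- The open half-space `ℝⁿ₊ = {x : x₁ > 0}`. -/
def openHalf (n : ℕ) (hn : 0 < n) : Set (EuclideanSpace ℝ (Fin n)) :=
  {x | 0 < x ⟨0, hn⟩}

/-- The closed half-space `{x : x₁ ≥ 0}` (the closure of `ℝⁿ₊`). -/
def closedHalf (n : ℕ) (hn : 0 < n) : Set (EuclideanSpace ℝ (Fin n)) :=
  {x | 0 ≤ x ⟨0, hn⟩}

/-- `u` is a positive classical solution of the half-space problem
`∂ₜu = Δu` in `ℝⁿ₊ × ℝ`, `-∂u/∂x₁ = u^q` on `∂ℝⁿ₊ × ℝ`: it is continuous together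
with its spatial gradient up to the boundary, `C²` in `x` and `C¹` in `t` in the
open half-space, satisfies the heat equation inside and the nonlinear boundary
condition on the boundary, and is everywhere positive. -/
def IsHalfSpaceSol (n : ℕ) (hn : 0 < n) (q : ℝ)
    (u : EuclideanSpace ℝ (Fin n) × ℝ → ℝ) : Prop :=
  ContinuousOn u (closedHalf n hn ×ˢ (univ : Set ℝ)) ∧
  (∀ t, ContDiffOn ℝ 1 (fun x => u (x, t)) (closedHalf n hn)) ∧
  (∀ t, ContinuousOn
    (fun x => fderivWithin ℝ (fun y => u (y, t)) (closedHalf n hn) x)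
    (closedHalf n hn)) ∧
  (∀ t, ContDiffOn ℝ 2 (fun x => u (x, t)) (openHalf n hn)) ∧
  (∀ x ∈ openHalf n hn, ContDiff ℝ 1 fun s => u (x, s)) ∧
  (∀ x ∈ openHalf n hn, ∀ t : ℝ,
    deriv (fun s => u (x, s)) t = lap (fun y => u (y, t)) x) ∧
  (∀ x : EuclideanSpace ℝ (Fin n), x ⟨0, hn⟩ = 0 → ∀ t : ℝ,
    -(fderivWithin ℝ (fun y => u (y, t)) (closedHalf n hn) x
        (EuclideanSpace.single ⟨0, hn⟩ 1)) = u (x, t) ^ q) ∧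
  (∀ x ∈ closedHalf n hn, ∀ t : ℝ, 0 < u (x, t))

open Filter Topology MeasureTheory

/-- Euclidean space `ℝⁿ`. -/
abbrev Eu (n : ℕ) := EuclideanSpace ℝ (Fin n)

/-- The `i`-th coordinate vector. -/
noncomputable abbrev ev {n : ℕ} (i : Fin n) : Eu n := EuclideanSpace.single i (1 : ℝ)

/-- `f` solves the heat equation pointwise at `(x, t)`. -/
def IsCaloricAt {n : ℕ} (f : Eu n × ℝ → ℝ) (x : Eu n) (t : ℝ) : Prop :=
  ContDiffAt ℝ 2 (fun y => f (y, t)) x ∧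
    HasDerivAt (fun s => f (x, s)) (lap (fun y => f (y, t)) x) t

lemma second_deriv_nonpos_of_isLocalMax {g g' : ℝ → ℝ} {c : ℝ}
    (hg : ∀ᶠ τ in 𝓝 0, HasDerivAt g (g' τ) τ) (hg' : HasDerivAt g' c 0)
    (hmax : IsLocalMax g 0) : c ≤ 0 := by
  by_contra! hc
  have e1 : deriv g =ᶠ[𝓝 0] g' := hg.mono fun τ h => h.deriv
  have h0 : deriv g 0 = 0 := hmax.deriv_eq_zero
  have h2 : deriv (deriv g) 0 = c := by rw [e1.deriv_eq, hg'.deriv]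
  have hmin : IsLocalMin g 0 :=
    isLocalMin_of_deriv_deriv_pos (by rw [h2]; exact hc) h0 hg.self_of_nhds.continuousAt
  have hconst : g =ᶠ[𝓝 0] fun _ => g 0 := by
    filter_upwards [hmin, hmax] with τ h1 h3 using le_antisymm h3 h1
  have h4 : deriv g =ᶠ[𝓝 0] fun _ => 0 := by
    have := hconst.deriv
    simpa using this
  have h5 := h4.deriv_eq
  rw [h2] at h5
  simp at h5
  linarith

lemma hasDerivAt_line {n : ℕ} {f : Eu n → ℝ} {x e : Eu n} {τ : ℝ}
    (h : DifferentiableAt ℝ f (x + τ • e)) :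
    HasDerivAt (fun τ : ℝ => f (x + τ • e)) (fderiv ℝ f (x + τ • e) e) τ := by
  have h1 : HasDerivAt (fun τ : ℝ => x + τ • e) e τ := by
    simpa using ((hasDerivAt_id τ).smul_const e).const_add x
  exact h.hasFDerivAt.comp_hasDerivAt τ h1

lemma hasDerivAt_line_zero {n : ℕ} {f : Eu n → ℝ} {x e : Eu n}
    (h : DifferentiableAt ℝ f x) :
    HasDerivAt (fun τ : ℝ => f (x + τ • e)) (fderiv ℝ f x e) 0 := by
  have := hasDerivAt_line (f := f) (x := x) (e := e) (τ := 0) (by simpa using h)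
  simpa using this

lemma tendsto_line {n : ℕ} (x e : Eu n) : Tendsto (fun τ : ℝ => x + τ • e) (𝓝 0) (𝓝 x) := by
  have : Continuous (fun τ : ℝ => x + τ • e) := by fun_prop
  simpa using this.tendsto 0

lemma ContDiffAt.eventually_hasDerivAt_line {n : ℕ} {f : Eu n → ℝ} {x : Eu n}
    (h : ContDiffAt ℝ 2 f x) (e : Eu n) :
    ∀ᶠ τ in 𝓝 (0 : ℝ), HasDerivAt (fun τ : ℝ => f (x + τ • e)) (fderiv ℝ f (x + τ • e) e) τ := by
  have h1 : ∀ᶠ y in 𝓝 x, DifferentiableAt ℝ f y := by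
    filter_upwards [h.eventually (by simp)] with y hy using hy.differentiableAt (by simp)
  filter_upwards [(tendsto_line x e).eventually h1] with τ hτ using hasDerivAt_line hτ

lemma ContDiffAt.fderiv_apply_const {n : ℕ} {f : Eu n → ℝ} {x : Eu n}
    (h : ContDiffAt ℝ 2 f x) (e : Eu n) :
    ContDiffAt ℝ 1 (fun y => fderiv ℝ f y e) x :=
  (h.fderiv_right (m := 1) (by norm_num)).clm_apply contDiffAt_const

lemma ContDiffAt.hasDerivAt_fderiv_line {n : ℕ} {f : Eu n → ℝ} {x : Eu n}
    (h : ContDiffAt ℝ 2 f x) (e : Eu n) :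
    HasDerivAt (fun τ : ℝ => fderiv ℝ f (x + τ • e) e)
      (fderiv ℝ (fun y => fderiv ℝ f y e) x e) 0 :=
  hasDerivAt_line_zero (f := fun y => fderiv ℝ f y e)
    ((h.fderiv_apply_const e).differentiableAt (by simp))

lemma deriv_nonpos_of_le_right {g : ℝ → ℝ} {d : ℝ}
    (h : HasDerivWithinAt g d (Set.Ici 0) 0) (hm : ∀ᶠ τ in 𝓝[>] (0 : ℝ), g τ ≤ g 0) : d ≤ 0 := by
  have h1 := (hasDerivWithinAt_iff_tendsto_slope' (s := Set.Ioi (0 : ℝ)) (by simp)).1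
    (h.mono Set.Ioi_subset_Ici_self)
  refine le_of_tendsto h1 ?_
  filter_upwards [hm, self_mem_nhdsWithin] with τ h2 h3
  rw [slope_def_field]
  exact div_nonpos_of_nonpos_of_nonneg (by linarith) (by simpa using (le_of_lt h3))

lemma lap_sub {n : ℕ} {f g : Eu n → ℝ} {x : Eu n} (hf : ContDiffAt ℝ 2 f x)
    (hg : ContDiffAt ℝ 2 g x) : lap (fun y => f y - g y) x = lap f x - lap g x := by
  unfold lap
  rw [← Finset.sum_sub_distrib]
  refine Finset.sum_congr rfl fun i _ => ?_
  have h1 : (fun y => fderiv ℝ (fun y => f y - g y) y (ev i)) =ᶠ[𝓝 x]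
      fun y => fderiv ℝ f y (ev i) - fderiv ℝ g y (ev i) := by
    filter_upwards [hf.eventually (by simp), hg.eventually (by simp)] with y h1 h2
    rw [fderiv_fun_sub (h1.differentiableAt (by simp)) (h2.differentiableAt (by simp))]
    rfl
  rw [h1.fderiv_eq, fderiv_fun_sub ((hf.fderiv_apply_const _).differentiableAt (by simp))
    ((hg.fderiv_apply_const _).differentiableAt (by simp))]
  rfl

lemma lap_neg {n : ℕ} {f : Eu n → ℝ} {x : Eu n} :
    lap (fun y => - f y) x = - lap f x := by
  unfold lap
  rw [← Finset.sum_neg_distrib]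
  refine Finset.sum_congr rfl fun i _ => ?_
  have h1 : (fun y => fderiv ℝ (fun y => - f y) y (EuclideanSpace.single i 1)) =
      fun y => - fderiv ℝ f y (EuclideanSpace.single i 1) := by
    funext y
    rw [fderiv_fun_neg]
    rfl
  rw [h1, fderiv_fun_neg]
  rfl

lemma lap_add_right {n : ℕ} {f : Eu n → ℝ} {x a : Eu n} :
    lap (fun y => f (y + a)) x = lap f (x + a) := by
  unfold lap
  refine Finset.sum_congr rfl fun i _ => ?_
  have h1 : (fun y => fderiv ℝ (fun y => f (y + a)) y (EuclideanSpace.single i 1)) =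
      fun y => fderiv ℝ f (y + a) (EuclideanSpace.single i 1) := by
    funext y
    rw [fderiv_comp_add_right]
  rw [h1, fderiv_comp_add_right (f := fun y => fderiv ℝ f y (EuclideanSpace.single i 1))]

lemma IsCaloricAt.neg {n : ℕ} {f : Eu n × ℝ → ℝ} {x : Eu n} {t : ℝ} (h : IsCaloricAt f x t) :
    IsCaloricAt (fun p => - f p) x t :=
  ⟨h.1.neg, by rw [lap_neg]; exact h.2.neg⟩

lemma IsCaloricAt.translate_sub {n : ℕ} {f : Eu n × ℝ → ℝ} {x a : Eu n} {t : ℝ}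
    (h : IsCaloricAt f x t) (h' : IsCaloricAt f (x + a) t) :
    IsCaloricAt (fun p => f (p.1 + a, p.2) - f p) x t := by
  have h1 : ContDiffAt ℝ 2 (fun y => f (y + a, t)) x :=
    ContDiffAt.comp (g := fun y => f (y, t)) (f := fun y => y + a) x h'.1
      (contDiffAt_id.add contDiffAt_const)
  refine ⟨h1.sub h.1, ?_⟩
  rw [lap_sub (f := fun y => f (y + a, t)) (g := fun y => f (y, t)) h1 h.1,
    lap_add_right (f := fun y => f (y, t))]
  exact h'.2.sub h.2

lemma norm_add_smul_ev_sub_sq {n : ℕ} (x x0 : Eu n) (j : Fin n) (τ : ℝ) :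
    ‖x + τ • ev j - x0‖ ^ 2 = ‖x - x0‖ ^ 2 + 2 * τ * (x j - x0 j) + τ ^ 2 := by
  rw [show x + τ • ev j - x0 = (x - x0) + τ • ev j by abel, norm_add_sq_real]
  simp [inner_smul_right, norm_smul, EuclideanSpace.inner_single_right]
  ring

lemma hasDerivAt_two_mul_add_sq (b τ : ℝ) :
    HasDerivAt (fun τ : ℝ => 2 * τ * b + τ ^ 2) (2 * b + 2 * τ) τ := by
  have h1 := ((hasDerivAt_id τ).const_mul 2).mul_const b
  have h2 := hasDerivAt_pow 2 τ
  refine (h1.add h2).congr_deriv ?_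
  simp

lemma hasDerivAt_sub_mul_sub (σ ρ τ : ℝ) :
    HasDerivAt (fun τ : ℝ => (σ - τ) * (2 * ρ - (σ - τ))) (-2 * ρ + 2 * σ - 2 * τ) τ := by
  have h1 := (hasDerivAt_id τ).const_sub σ
  refine (h1.mul (h1.const_sub (2 * ρ))).congr_deriv ?_
  simp
  ring

set_option maxHeartbeats 1000000 in
/-- One-sided difference estimate in a coordinate direction, by comparing the doubled function
`f (x + s eᵢ, t) - f (x, t)` with a quadratic barrier. -/
lemma sub_le_of_barrier {n : ℕ} (i : Fin n) {f : Eu n × ℝ → ℝ} {S : Set (Eu n)}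
    (hS : IsClosed S) (hf : ContinuousOn f (S ×ˢ univ)) {x0 : Eu n} (hx0 : x0 ∈ S)
    {t0 ρ A N : ℝ} (hρ : 0 < ρ) (hA : 0 < A)
    (hS' : ∀ x ∈ S, ‖x - x0‖ ≤ ρ → ∀ s ∈ Icc 0 (ρ / 2), x + s • ev i ∈ S)
    (hosc : ∀ x ∈ S, ‖x - x0‖ ≤ ρ → ∀ s ∈ Icc 0 (ρ / 2), ∀ t ∈ Icc (t0 - ρ ^ 2) t0,
      f (x + s • ev i, t) - f (x, t) ≤ A * ρ ^ 2 / 2)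
    (hcal_int : ∀ x ∈ S, ‖x - x0‖ < ρ → ∀ s ∈ Ioo 0 (ρ / 2), ∀ t, IsCaloricAt f (x + s • ev i) t)
    (hbd : ∀ x ∈ S, ‖x - x0‖ < ρ → ∀ t, (IsCaloricAt f x t ∧ x ∈ interior S) ∨
      (x i ≤ x0 i ∧ ∃ d ≤ N, HasDerivWithinAt (fun τ : ℝ => f (x + τ • ev i, t)) d (Ici 0) 0))
    (hN : N < A * ρ) {s : ℝ} (hs : s ∈ Icc 0 (ρ / 2)) :
    f (x0 + s • ev i, t0) - f (x0, t0) ≤ A * n * (s * (2 * ρ - s)) := by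
  have hn1 : (1 : ℝ) ≤ n := by
    have : 0 < n := i.pos
    exact_mod_cast this
  set K : Set (Eu n × ℝ × ℝ) :=
    (S ∩ Metric.closedBall x0 ρ) ×ˢ (Icc 0 (ρ / 2) ×ˢ Icc (t0 - ρ ^ 2) t0) with hK
  have hmemK : ∀ y σ t, (y, σ, t) ∈ K ↔
      (y ∈ S ∧ ‖y - x0‖ ≤ ρ) ∧ σ ∈ Icc 0 (ρ / 2) ∧ t ∈ Icc (t0 - ρ ^ 2) t0 := by
    intro y σ t
    rw [hK, mem_prod, mem_prod, mem_inter_iff, Metric.mem_closedBall, dist_eq_norm]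
  have hKc : IsCompact K :=
    ((isCompact_closedBall x0 ρ).inter_left hS).prod (isCompact_Icc.prod isCompact_Icc)
  set F : Eu n × ℝ × ℝ → ℝ := fun p => f (p.1 + p.2.1 • ev i, p.2.2) - f (p.1, p.2.2) -
    A * (‖p.1 - x0‖ ^ 2 + (t0 - p.2.2) + n * (p.2.1 * (2 * ρ - p.2.1))) with hF
  have hFc : ContinuousOn F K := by
    refine ContinuousOn.sub (ContinuousOn.sub ?_ ?_) (by fun_prop)
    · refine hf.comp (by fun_prop) ?_
      rintro ⟨y, σ, t⟩ hp
      rw [hmemK] at hp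
      exact ⟨hS' y hp.1.1 hp.1.2 σ hp.2.1, mem_univ _⟩
    · refine hf.comp (by fun_prop) ?_
      rintro ⟨y, σ, t⟩ hp
      rw [hmemK] at hp
      exact ⟨hp.1.1, mem_univ _⟩
  have hp0 : (x0, s, t0) ∈ K := by
    rw [hmemK]
    exact ⟨⟨hx0, by simpa using hρ.le⟩, hs, by constructor <;> nlinarith⟩
  obtain ⟨⟨x, σ, t⟩, hpK, hmax⟩ := hKc.exists_isMaxOn ⟨_, hp0⟩ hFc
  by_contra! hcon
  have hpos : 0 < F (x, σ, t) := by
    have h1 : F (x0, s, t0) ≤ F (x, σ, t) := hmax hp0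
    have h2 : 0 < F (x0, s, t0) := by
      simp only [hF, sub_self, norm_zero]
      nlinarith
    linarith
  have hM : ∀ y σ' t', (y, σ', t') ∈ K → F (y, σ', t') ≤ F (x, σ, t) := fun y σ' t' h => hmax h
  rw [hmemK] at hpK
  obtain ⟨⟨hxS, hxρ⟩, ⟨hσ0, hσρ⟩, ⟨ht1, ht2⟩⟩ := hpK
  have hosc1 := hosc x hxS hxρ σ ⟨hσ0, hσρ⟩ t ⟨ht1, ht2⟩
  have hB0 : 0 ≤ (n : ℝ) * (σ * (2 * ρ - σ)) :=
    mul_nonneg (by linarith) (mul_nonneg hσ0 (by linarith))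
  have hFval : F (x, σ, t) = f (x + σ • ev i, t) - f (x, t) -
    A * (‖x - x0‖ ^ 2 + (t0 - t) + n * (σ * (2 * ρ - σ))) := rfl
  have hlt : ‖x - x0‖ ^ 2 + (t0 - t) + n * (σ * (2 * ρ - σ)) < ρ ^ 2 / 2 := by
    by_contra! h
    have := mul_le_mul_of_nonneg_left h hA.le
    linarith
  have hρ2 : 0 < ρ ^ 2 := by positivity
  have hsq : 0 ≤ ‖x - x0‖ ^ 2 := by positivity
  have hσpos : 0 < σ := by
    rcases hσ0.eq_or_lt with h | h
    · exfalso
      subst h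
      simp only [zero_smul, add_zero, sub_self] at hFval
      have : 0 ≤ A * (‖x - x0‖ ^ 2 + (t0 - t) + n * (0 * (2 * ρ - 0))) :=
        mul_nonneg hA.le (by nlinarith)
      linarith
    · exact h
  have hσlt : σ < ρ / 2 := by
    rcases hσρ.eq_or_lt with h | h
    · exfalso
      have h1 : 1 * (σ * (2 * ρ - σ)) ≤ n * (σ * (2 * ρ - σ)) :=
        mul_le_mul_of_nonneg_right hn1 (mul_nonneg hσ0 (by linarith))
      rw [h] at h1 hlt
      nlinarith
    · exact h
  have hxlt : ‖x - x0‖ < ρ := by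
    have h1 : ‖x - x0‖ ^ 2 < ρ ^ 2 := by nlinarith
    exact lt_of_pow_lt_pow_left₀ 2 hρ.le h1
  have htlt : t0 - ρ ^ 2 < t := by nlinarith
  rcases hbd x hxS hxlt t with ⟨hz2, hxint⟩ | ⟨hxi, d, hdN, hd⟩
  · have hz1 := hcal_int x hxS hxlt σ ⟨hσpos, hσlt⟩ t
    have hnear : ∀ j : Fin n, ∀ᶠ τ in 𝓝 (0 : ℝ),
        x + τ • ev j ∈ S ∧ ‖x + τ • ev j - x0‖ ≤ ρ := by
      intro j
      have h1 : ∀ᶠ y in 𝓝 x, y ∈ S := mem_interior_iff_mem_nhds.1 hxint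
      have h2 : ∀ᶠ y in 𝓝 x, ‖y - x0‖ < ρ := by
        have : Continuous fun y : Eu n => ‖y - x0‖ := by fun_prop
        exact this.continuousAt.eventually_lt continuousAt_const hxlt
      filter_upwards [(tendsto_line x (ev j)).eventually (h1.and h2)] with τ hτ
      exact ⟨hτ.1, hτ.2.le⟩
    have hnearσ : ∀ᶠ τ in 𝓝 (0 : ℝ), σ + τ ∈ Icc 0 (ρ / 2) ∧ σ - τ ∈ Icc 0 (ρ / 2) := by
      have h1 : ∀ᶠ r in 𝓝 σ, r ∈ Icc 0 (ρ / 2) := Icc_mem_nhds hσpos hσlt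
      have h2 : Tendsto (fun τ : ℝ => σ + τ) (𝓝 0) (𝓝 σ) := by
        have : Continuous fun τ : ℝ => σ + τ := by fun_prop
        simpa using this.tendsto 0
      have h3 : Tendsto (fun τ : ℝ => σ - τ) (𝓝 0) (𝓝 σ) := by
        have : Continuous fun τ : ℝ => σ - τ := by fun_prop
        simpa using this.tendsto 0
      exact (h2.eventually h1).and (h3.eventually h1)
    set D1 : Fin n → ℝ := fun j => fderiv ℝ (fun y => fderiv ℝ (fun y => f (y, t)) y (ev j))
      (x + σ • ev i) (ev j) with hD1
    set D2 : Fin n → ℝ := fun j => fderiv ℝ (fun y => fderiv ℝ (fun y => f (y, t)) y (ev j))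
      x (ev j) with hD2
    have hboth : ∀ j, D1 j - D2 j ≤ 2 * A := by
      intro j
      have hg := (hz1.1.eventually_hasDerivAt_line (ev j)).and
        (hz2.1.eventually_hasDerivAt_line (ev j))
      have key := second_deriv_nonpos_of_isLocalMax
        (g := fun τ => f (x + σ • ev i + τ • ev j, t) - f (x + τ • ev j, t) -
          A * (2 * τ * (x j - x0 j) + τ ^ 2))
        (g' := fun τ => fderiv ℝ (fun y => f (y, t)) (x + σ • ev i + τ • ev j) (ev j) -
          fderiv ℝ (fun y => f (y, t)) (x + τ • ev j) (ev j) - A * (2 * (x j - x0 j) + 2 * τ))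
        (c := D1 j - D2 j - A * 2) ?_ ?_ ?_
      · linarith
      · filter_upwards [hg] with τ hτ
        refine (hτ.1.sub hτ.2).sub (HasDerivAt.const_mul A ?_)
        exact hasDerivAt_two_mul_add_sq _ _
      · refine ((hz1.1.hasDerivAt_fderiv_line (ev j)).sub
          (hz2.1.hasDerivAt_fderiv_line (ev j))).sub (HasDerivAt.const_mul A ?_)
        simpa using ((hasDerivAt_id (0 : ℝ)).const_mul 2).const_add (2 * (x j - x0 j))
      · filter_upwards [hnear j] with τ hτ
        have := hM (x + τ • ev j) σ t ((hmemK _ _ _).2 ⟨hτ, ⟨hσ0, hσρ⟩, ⟨ht1, ht2⟩⟩)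
        simp only [hF, norm_add_smul_ev_sub_sq] at this
        rw [show x + τ • ev j + σ • ev i = x + σ • ev i + τ • ev j by abel] at this
        simp only [zero_smul, add_zero]
        linarith
    have hone : D1 i + 2 * A * n ≤ 0 := by
      have hg := (hz1.1.eventually_hasDerivAt_line (ev i))
      have key := second_deriv_nonpos_of_isLocalMax
        (g := fun τ => f (x + σ • ev i + τ • ev i, t) -
          A * n * ((σ + τ) * (2 * ρ - (σ + τ))))
        (g' := fun τ => fderiv ℝ (fun y => f (y, t)) (x + σ • ev i + τ • ev i) (ev i) -
          A * n * (2 * ρ - 2 * σ - 2 * τ))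
        (c := D1 i - A * n * (-2)) ?_ ?_ ?_
      · linarith
      · filter_upwards [hg] with τ hτ
        refine hτ.sub (HasDerivAt.const_mul (A * n) ?_)
        have h1 := (hasDerivAt_id τ).const_add σ
        have := h1.mul (h1.const_sub (2 * ρ))
        refine this.congr_deriv ?_
        simp
        ring
      · refine (hz1.1.hasDerivAt_fderiv_line (ev i)).sub (HasDerivAt.const_mul (A * n) ?_)
        simpa using ((hasDerivAt_id (0 : ℝ)).const_mul 2).const_sub (2 * ρ - 2 * σ)
      · filter_upwards [hnearσ] with τ hτ
        have := hM x (σ + τ) t ((hmemK _ _ _).2 ⟨⟨hxS, hxρ⟩, hτ.1, ⟨ht1, ht2⟩⟩)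
        simp only [hF] at this
        rw [show x + (σ + τ) • ev i = x + σ • ev i + τ • ev i by rw [add_smul]; abel] at this
        simp only [zero_smul, add_zero]
        linarith
    have htwo : - D2 i - 2 * A + 2 * A * n ≤ 0 := by
      have hg := (hz2.1.eventually_hasDerivAt_line (ev i))
      have key := second_deriv_nonpos_of_isLocalMax
        (g := fun τ => - f (x + τ • ev i, t) - A * (2 * τ * (x i - x0 i) + τ ^ 2) -
          A * n * ((σ - τ) * (2 * ρ - (σ - τ))))
        (g' := fun τ => - fderiv ℝ (fun y => f (y, t)) (x + τ • ev i) (ev i) -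
          A * (2 * (x i - x0 i) + 2 * τ) - A * n * (-2 * ρ + 2 * σ - 2 * τ))
        (c := - D2 i - A * 2 - A * n * (-2)) ?_ ?_ ?_
      · linarith
      · filter_upwards [hg] with τ hτ
        refine (hτ.neg.sub (HasDerivAt.const_mul A ?_)).sub (HasDerivAt.const_mul (A * n) ?_)
        · exact hasDerivAt_two_mul_add_sq _ _
        · exact hasDerivAt_sub_mul_sub _ _ _
      · refine ((hz2.1.hasDerivAt_fderiv_line (ev i)).neg.sub (HasDerivAt.const_mul A ?_)).sub
          (HasDerivAt.const_mul (A * n) ?_)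
        · simpa using ((hasDerivAt_id (0 : ℝ)).const_mul 2).const_add (2 * (x i - x0 i))
        · simpa using ((hasDerivAt_id (0 : ℝ)).const_mul 2).const_sub (-2 * ρ + 2 * σ)
      · filter_upwards [hnearσ, hnear i] with τ hτ hτ'
        have := hM (x + τ • ev i) (σ - τ) t ((hmemK _ _ _).2 ⟨hτ', hτ.2, ⟨ht1, ht2⟩⟩)
        simp only [hF, norm_add_smul_ev_sub_sq] at this
        rw [show x + τ • ev i + (σ - τ) • ev i = x + σ • ev i by rw [sub_smul]; abel] at this
        simp only [zero_smul, add_zero]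
        linarith
    have hlap1 : lap (fun y => f (y, t)) (x + σ • ev i) = ∑ j, D1 j := rfl
    have hlap2 : lap (fun y => f (y, t)) x = ∑ j, D2 j := rfl
    have hsum : ∑ j, D1 j - ∑ j, D2 j ≤ - (2 * A * n) := by
      rw [← Finset.sum_sub_distrib, ← Finset.add_sum_erase _ _ (Finset.mem_univ i)]
      have h1 : ∑ j ∈ Finset.univ.erase i, (D1 j - D2 j) ≤
          ∑ j ∈ Finset.univ.erase i, (2 * A) := Finset.sum_le_sum fun j _ => hboth j
      rw [Finset.sum_const, Finset.card_erase_of_mem (Finset.mem_univ i), Finset.card_univ,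
        Fintype.card_fin, nsmul_eq_mul, Nat.cast_sub i.pos] at h1
      push_cast at h1
      nlinarith
    have htime : 0 ≤ ∑ j, D1 j - ∑ j, D2 j + A := by
      have h1 : HasDerivAt (fun τ : ℝ => t - τ) (-1) 0 := by
        simpa using (hasDerivAt_id (0 : ℝ)).const_sub t
      have h2 : HasDerivAt (fun τ : ℝ => f (x + σ • ev i, t - τ)) ((∑ j, D1 j) * (-1)) 0 :=
        HasDerivAt.comp (h₂ := fun τ => f (x + σ • ev i, τ)) 0 (by rw [sub_zero, ← hlap1]; exact hz1.2) h1
      have h3 : HasDerivAt (fun τ : ℝ => f (x, t - τ)) ((∑ j, D2 j) * (-1)) 0 :=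
        HasDerivAt.comp (h₂ := fun τ => f (x, τ)) 0 (by rw [sub_zero, ← hlap2]; exact hz2.2) h1
      have h4 := deriv_nonpos_of_le_right (((h2.sub h3).sub
        ((hasDerivAt_id (0 : ℝ)).const_mul A)).hasDerivWithinAt) ?_
      · linarith
      · have h5 : ∀ᶠ τ in 𝓝[>] (0 : ℝ), τ < t - (t0 - ρ ^ 2) :=
          mem_nhdsWithin_of_mem_nhds (Iio_mem_nhds (by linarith))
        filter_upwards [h5, self_mem_nhdsWithin] with τ hτ hτ0
        have hτ0' : 0 < τ := hτ0
        have := hM x σ (t - τ) ((hmemK _ _ _).2 ⟨⟨hxS, hxρ⟩, ⟨hσ0, hσρ⟩,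
          ⟨by linarith, by linarith⟩⟩)
        simp only [hF] at this
        simp only [Pi.sub_apply, id, sub_zero, mul_zero]
        linarith
    nlinarith
  · have h1 : HasDerivWithinAt (fun τ : ℝ => - f (x + τ • ev i, t) -
        A * (2 * τ * (x i - x0 i) + τ ^ 2) - A * n * ((σ - τ) * (2 * ρ - (σ - τ))))
        (- d - A * (2 * (x i - x0 i)) - A * n * (-2 * ρ + 2 * σ)) (Ici 0) 0 := by
      refine (hd.neg.sub (HasDerivWithinAt.const_mul A ?_)).sub
        (HasDerivWithinAt.const_mul (A * n) ?_)
      · simpa using (hasDerivAt_two_mul_add_sq (x i - x0 i) 0).hasDerivWithinAt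
      · simpa using (hasDerivAt_sub_mul_sub σ ρ 0).hasDerivWithinAt
    have h2 := deriv_nonpos_of_le_right h1 ?_
    · have h3 : 0 ≤ A * (x0 i - x i) := mul_nonneg hA.le (by linarith)
      have h4 : A * ρ * 1 ≤ A * ρ * n := mul_le_mul_of_nonneg_left hn1 (by positivity)
      have h5 : 0 ≤ A * n * (ρ / 2 - σ) := mul_nonneg (by positivity) (by linarith)
      linarith
    · have h5 : ∀ᶠ τ in 𝓝[>] (0 : ℝ), τ < σ := mem_nhdsWithin_of_mem_nhds (Iio_mem_nhds hσpos)
      have h6 : ∀ᶠ τ in 𝓝[>] (0 : ℝ), ‖x + τ • ev i - x0‖ < ρ := by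
        have hc : Continuous fun y : Eu n => ‖y - x0‖ := by fun_prop
        have h7 : ∀ᶠ y in 𝓝 x, ‖y - x0‖ < ρ :=
          hc.continuousAt.eventually_lt continuousAt_const hxlt
        exact mem_nhdsWithin_of_mem_nhds ((tendsto_line x (ev i)).eventually h7)
      filter_upwards [h5, h6, self_mem_nhdsWithin] with τ hτ hτ6 hτ0
      have hτ0' : 0 < τ := hτ0
      have hS1 := hS' x hxS hxρ τ ⟨hτ0'.le, by linarith⟩
      have := hM (x + τ • ev i) (σ - τ) t ((hmemK _ _ _).2 ⟨⟨hS1, hτ6.le⟩,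
        ⟨by linarith, by linarith⟩, ⟨ht1, ht2⟩⟩)
      simp only [hF, norm_add_smul_ev_sub_sq] at this
      rw [show x + τ • ev i + (σ - τ) • ev i = x + σ • ev i by rw [sub_smul]; abel] at this
      simp only [zero_smul, add_zero]
      linarith

lemma abs_sub_le_of_interior {n : ℕ} (i : Fin n) {f : Eu n × ℝ → ℝ} {x0 : Eu n} {t0 ρ m : ℝ}
    (hρ : 0 < ρ) (hm : 0 < m)
    (hf : ContinuousOn f (Metric.closedBall x0 (2 * ρ) ×ˢ univ))
    (hcal : ∀ x ∈ Metric.ball x0 (2 * ρ), ∀ t, IsCaloricAt f x t)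
    (hosc : ∀ y ∈ Metric.closedBall x0 (2 * ρ), ∀ z ∈ Metric.closedBall x0 (2 * ρ),
      ∀ t ∈ Icc (t0 - ρ ^ 2) t0, |f (y, t) - f (z, t)| ≤ m)
    {s : ℝ} (hs : s ∈ Icc 0 (ρ / 2)) :
    |f (x0 + s • ev i, t0) - f (x0, t0)| ≤ 4 * n * m / ρ * s := by
  have hball : ∀ x : Eu n, ∀ r : ℝ, ‖x - x0‖ ≤ r → ∀ s ∈ Icc 0 (ρ / 2),
      ‖x + s • ev i - x0‖ ≤ r + s := by
    intro x r hx s hs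
    rw [show x + s • ev i - x0 = (x - x0) + s • ev i by abel]
    refine (norm_add_le _ _).trans (add_le_add hx ?_)
    simp [norm_smul, abs_of_nonneg hs.1]
  have main : ∀ g : Eu n × ℝ → ℝ, ContinuousOn g (Metric.closedBall x0 (2 * ρ) ×ˢ univ) →
      (∀ x ∈ Metric.ball x0 (2 * ρ), ∀ t, IsCaloricAt g x t) →
      (∀ y ∈ Metric.closedBall x0 (2 * ρ), ∀ z ∈ Metric.closedBall x0 (2 * ρ),
        ∀ t ∈ Icc (t0 - ρ ^ 2) t0, |g (y, t) - g (z, t)| ≤ m) →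
      g (x0 + s • ev i, t0) - g (x0, t0) ≤ 4 * n * m / ρ * s := by
    intro g hg hgc hgo
    have hA : 0 < 2 * m / ρ ^ 2 := by positivity
    have key := sub_le_of_barrier i (S := Metric.closedBall x0 (2 * ρ)) (N := 0)
      (A := 2 * m / ρ ^ 2) (t0 := t0) Metric.isClosed_closedBall hg
      (Metric.mem_closedBall_self (by positivity)) hρ hA ?_ ?_ ?_ ?_ (by positivity) hs
    · refine key.trans ?_
      have h1 : s * (2 * ρ - s) ≤ s * (2 * ρ) :=
        mul_le_mul_of_nonneg_left (by linarith [hs.1]) hs.1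
      refine (mul_le_mul_of_nonneg_left h1 (by positivity)).trans (le_of_eq ?_)
      field_simp
      ring
    · intro x _ hx s hs
      rw [Metric.mem_closedBall, dist_eq_norm]
      refine (hball x ρ hx s hs).trans ?_
      linarith [hs.2]
    · intro x hxS hx s hs t ht
      have h1 := hgo (x + s • ev i) ?_ x hxS t ht
      · refine (le_abs_self _).trans (h1.trans (le_of_eq ?_))
        field_simp
      · rw [Metric.mem_closedBall, dist_eq_norm]
        refine (hball x ρ hx s hs).trans ?_
        linarith [hs.2]
    · intro x _ hx s hs t
      refine hgc _ ?_ t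
      rw [Metric.mem_ball, dist_eq_norm]
      have := hball x ρ hx.le s ⟨hs.1.le, hs.2.le⟩
      linarith [hs.2]
    · intro x _ hx t
      have h1 : x ∈ Metric.ball x0 (2 * ρ) := by
        rw [Metric.mem_ball, dist_eq_norm]
        linarith
      exact Or.inl ⟨hgc x h1 t, interior_mono Metric.ball_subset_closedBall
        (by rw [Metric.isOpen_ball.interior_eq]; exact h1)⟩
  rw [abs_le]
  constructor
  · have := main (fun p => - f p) hf.neg (fun x hx t => (hcal x hx t).neg) (by
      intro y hy z hz t ht
      rw [← abs_neg]
      convert hosc y hy z hz t ht using 2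
      ring)
    linarith
  · exact main f hf hcal hosc

lemma abs_second_diff_le {n : ℕ} (i : Fin n) {f : Eu n × ℝ → ℝ} {x0 : Eu n} {t0 ρ m : ℝ}
    (hρ : 0 < ρ) (hm : 0 < m)
    (hcal : ∀ x ∈ Metric.closedBall x0 (4 * ρ), ∀ t, IsCaloricAt f x t)
    (hf : ContinuousOn f (Metric.closedBall x0 (4 * ρ) ×ˢ univ))
    (hosc : ∀ y ∈ Metric.closedBall x0 (4 * ρ), ∀ z ∈ Metric.closedBall x0 (4 * ρ),
      ∀ t ∈ Icc (t0 - 2 * ρ ^ 2) t0, |f (y, t) - f (z, t)| ≤ m)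
    {s h : ℝ} (hs : s ∈ Icc 0 (ρ / 2)) (hh : h ∈ Icc 0 (ρ / 4)) :
    |f (x0 + s • ev i + h • ev i, t0) - f (x0 + s • ev i, t0) -
      (f (x0 + h • ev i, t0) - f (x0, t0))| ≤ 32 * n ^ 2 * m / ρ ^ 2 * h * s := by
  rcases hh.1.eq_or_lt with h0 | h0
  · subst h0
    simp
  have hsh : ∀ x ∈ Metric.closedBall x0 (2 * ρ), x + h • ev i ∈ Metric.closedBall x0 (4 * ρ) := by
    intro x hx
    rw [Metric.mem_closedBall, dist_eq_norm] at hx ⊢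
    rw [show x + h • ev i - x0 = (x - x0) + h • ev i by abel]
    refine (norm_add_le _ _).trans ?_
    have : ‖h • (ev i : Eu n)‖ = h := by simp [norm_smul, abs_of_pos h0]
    rw [this]
    linarith [hh.2]
  have hsub : Metric.closedBall x0 (2 * ρ) ⊆ Metric.closedBall x0 (4 * ρ) :=
    Metric.closedBall_subset_closedBall (by linarith)
  have hfirst : ∀ x ∈ Metric.closedBall x0 (2 * ρ), ∀ t ∈ Icc (t0 - ρ ^ 2) t0,
      |f (x + h • ev i, t) - f (x, t)| ≤ 4 * n * m / ρ * h := by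
    intro x hx t ht
    have hsub' : Metric.closedBall x (2 * ρ) ⊆ Metric.closedBall x0 (4 * ρ) := by
      refine Metric.closedBall_subset_closedBall' ?_
      rw [Metric.mem_closedBall] at hx
      linarith
    refine abs_sub_le_of_interior i hρ hm (hf.mono (prod_mono hsub' subset_rfl))
      (fun y hy t => hcal y (hsub' (Metric.ball_subset_closedBall hy)) t) ?_
      ⟨hh.1, by linarith [hh.2]⟩
    intro y hy z hz τ hτ
    exact hosc y (hsub' hy) z (hsub' hz) τ ⟨by linarith [hτ.1, ht.1], by linarith [hτ.2, ht.2]⟩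
  have hn1 : (1 : ℝ) ≤ n := by
    have : 0 < n := i.pos
    exact_mod_cast this
  have hm' : 0 < 2 * (4 * n * m / ρ * h) := by positivity
  have key := abs_sub_le_of_interior i (f := fun p => f (p.1 + h • ev i, p.2) - f p)
    (t0 := t0) (x0 := x0) hρ hm' ?_ ?_ ?_ hs
  · simp only at key
    refine key.trans (le_of_eq ?_)
    field_simp
    ring
  · refine ContinuousOn.sub ?_ (hf.mono (prod_mono hsub subset_rfl))
    refine hf.comp (by fun_prop) ?_
    rintro ⟨y, t⟩ hp
    exact ⟨hsh y hp.1, mem_univ _⟩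
  · intro x hx t
    have hx' := Metric.ball_subset_closedBall hx
    exact (hcal x (hsub hx') t).translate_sub (hcal _ (hsh x hx') t)
  · intro y hy z hz t ht
    have h1 := hfirst y hy t ht
    have h2 := hfirst z hz t ht
    simp only
    rw [abs_le] at h1 h2 ⊢
    constructor <;> linarith [h1.1, h1.2, h2.1, h2.2]

lemma abs_deriv_le_of_right {g : ℝ → ℝ} {d C : ℝ} (h : HasDerivWithinAt g d (Ici 0) 0)
    (hm : ∀ᶠ τ in 𝓝[>] (0 : ℝ), |g τ - g 0| ≤ C * τ) : |d| ≤ C := by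
  have h1 : HasDerivWithinAt (fun τ : ℝ => C * τ) C (Ici 0) 0 := by
    simpa using ((hasDerivAt_id (0 : ℝ)).const_mul C).hasDerivWithinAt
  have a := deriv_nonpos_of_le_right (h.sub h1) (by
    filter_upwards [hm] with τ hτ
    have := (abs_le.1 hτ).2
    simp only [Pi.sub_apply]
    linarith)
  have b := deriv_nonpos_of_le_right (h.neg.sub h1) (by
    filter_upwards [hm] with τ hτ
    have := (abs_le.1 hτ).1
    simp only [Pi.sub_apply, Pi.neg_apply]
    linarith)
  rw [abs_le]
  constructor <;> linarith

lemma abs_fderiv_line_sub_le {n : ℕ} (i : Fin n) {f : Eu n × ℝ → ℝ} {x0 : Eu n} {t0 ρ m : ℝ}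
    (hρ : 0 < ρ) (hm : 0 < m)
    (hcal : ∀ x ∈ Metric.closedBall x0 (4 * ρ), ∀ t, IsCaloricAt f x t)
    (hf : ContinuousOn f (Metric.closedBall x0 (4 * ρ) ×ˢ univ))
    (hosc : ∀ y ∈ Metric.closedBall x0 (4 * ρ), ∀ z ∈ Metric.closedBall x0 (4 * ρ),
      ∀ t ∈ Icc (t0 - 2 * ρ ^ 2) t0, |f (y, t) - f (z, t)| ≤ m)
    {s : ℝ} (hs : s ∈ Icc 0 (ρ / 2)) :
    |fderiv ℝ (fun y => f (y, t0)) (x0 + s • ev i) (ev i) -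
      fderiv ℝ (fun y => f (y, t0)) x0 (ev i)| ≤ 32 * n ^ 2 * m / ρ ^ 2 * s := by
  have hmem : x0 + s • ev i ∈ Metric.closedBall x0 (4 * ρ) := by
    rw [Metric.mem_closedBall, dist_eq_norm, add_sub_cancel_left, norm_smul]
    simp only [PiLp.norm_single, norm_one, mul_one, Real.norm_eq_abs,
      abs_of_nonneg hs.1]
    linarith [hs.2]
  have h1 := hasDerivAt_line_zero (e := ev i)
    ((hcal _ hmem t0).1.differentiableAt (by simp))
  have h2 := hasDerivAt_line_zero (e := ev i)
    ((hcal x0 (Metric.mem_closedBall_self (by positivity)) t0).1.differentiableAt (by simp))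
  refine abs_deriv_le_of_right (h1.sub h2).hasDerivWithinAt ?_
  have h5 : ∀ᶠ τ in 𝓝[>] (0 : ℝ), τ ≤ ρ / 4 :=
    mem_nhdsWithin_of_mem_nhds (Iic_mem_nhds (by positivity))
  filter_upwards [h5, self_mem_nhdsWithin] with τ hτ hτ0
  have := abs_second_diff_le i hρ hm hcal hf hosc hs ⟨le_of_lt hτ0, hτ⟩
  simp only [Pi.sub_apply, zero_smul, add_zero]
  convert this using 1
  · congr 1
    ring
  · ring

lemma abs_second_deriv_le {n : ℕ} (i : Fin n) {f : Eu n × ℝ → ℝ} {x0 : Eu n} {t0 ρ m : ℝ}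
    (hρ : 0 < ρ) (hm : 0 < m)
    (hcal : ∀ x ∈ Metric.closedBall x0 (4 * ρ), ∀ t, IsCaloricAt f x t)
    (hf : ContinuousOn f (Metric.closedBall x0 (4 * ρ) ×ˢ univ))
    (hosc : ∀ y ∈ Metric.closedBall x0 (4 * ρ), ∀ z ∈ Metric.closedBall x0 (4 * ρ),
      ∀ t ∈ Icc (t0 - 2 * ρ ^ 2) t0, |f (y, t) - f (z, t)| ≤ m) :
    |fderiv ℝ (fun y => fderiv ℝ (fun y => f (y, t0)) y (ev i)) x0 (ev i)| ≤
      32 * n ^ 2 * m / ρ ^ 2 := by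
  have h1 := (hcal x0 (Metric.mem_closedBall_self (by positivity)) t0).1.hasDerivAt_fderiv_line
    (ev i)
  refine abs_deriv_le_of_right h1.hasDerivWithinAt ?_
  have h5 : ∀ᶠ τ in 𝓝[>] (0 : ℝ), τ ≤ ρ / 2 :=
    mem_nhdsWithin_of_mem_nhds (Iic_mem_nhds (by positivity))
  filter_upwards [h5, self_mem_nhdsWithin] with τ hτ hτ0
  have := abs_fderiv_line_sub_le i hρ hm hcal hf hosc ⟨le_of_lt hτ0, hτ⟩
  simpa using this

lemma abs_lap_le {n : ℕ} {f : Eu n × ℝ → ℝ} {x0 : Eu n} {t0 ρ m : ℝ}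
    (hρ : 0 < ρ) (hm : 0 < m)
    (hcal : ∀ x ∈ Metric.closedBall x0 (4 * ρ), ∀ t, IsCaloricAt f x t)
    (hf : ContinuousOn f (Metric.closedBall x0 (4 * ρ) ×ˢ univ))
    (hosc : ∀ y ∈ Metric.closedBall x0 (4 * ρ), ∀ z ∈ Metric.closedBall x0 (4 * ρ),
      ∀ t ∈ Icc (t0 - 2 * ρ ^ 2) t0, |f (y, t) - f (z, t)| ≤ m) :
    |lap (fun y => f (y, t0)) x0| ≤ 32 * n ^ 3 * m / ρ ^ 2 := by
  unfold lap
  refine (Finset.abs_sum_le_sum_abs _ _).trans ((Finset.sum_le_sum fun i _ =>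
    abs_second_deriv_le i hρ hm hcal hf hosc).trans (le_of_eq ?_))
  rw [Finset.sum_const, Finset.card_univ, Fintype.card_fin, nsmul_eq_mul]
  ring

/-- First-order Taylor bound in a coordinate direction. -/
lemma abs_taylor_line_le {n : ℕ} (i : Fin n) {f : Eu n × ℝ → ℝ} {x0 : Eu n} {t0 ρ m : ℝ}
    (hρ : 0 < ρ) (hm : 0 < m)
    (hcal : ∀ x ∈ Metric.closedBall x0 (4 * ρ), ∀ t, IsCaloricAt f x t)
    (hf : ContinuousOn f (Metric.closedBall x0 (4 * ρ) ×ˢ univ))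
    (hosc : ∀ y ∈ Metric.closedBall x0 (4 * ρ), ∀ z ∈ Metric.closedBall x0 (4 * ρ),
      ∀ t ∈ Icc (t0 - 2 * ρ ^ 2) t0, |f (y, t) - f (z, t)| ≤ m)
    {s : ℝ} (hs : s ∈ Icc 0 (ρ / 2)) :
    |f (x0 + s • ev i, t0) - f (x0, t0) - s * fderiv ℝ (fun y => f (y, t0)) x0 (ev i)| ≤
      32 * n ^ 2 * m / ρ ^ 2 * s * s := by
  have hmem : ∀ τ ∈ Icc 0 s, x0 + τ • ev i ∈ Metric.closedBall x0 (4 * ρ) := by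
    intro τ hτ
    rw [Metric.mem_closedBall, dist_eq_norm, add_sub_cancel_left, norm_smul]
    simp only [PiLp.norm_single, norm_one, mul_one, Real.norm_eq_abs,
      abs_of_nonneg hτ.1]
    linarith [hs.2, hτ.2]
  have key := Convex.norm_image_sub_le_of_norm_hasDerivWithin_le
    (f := fun τ : ℝ => f (x0 + τ • ev i, t0) - τ * fderiv ℝ (fun y => f (y, t0)) x0 (ev i))
    (f' := fun τ : ℝ => fderiv ℝ (fun y => f (y, t0)) (x0 + τ • ev i) (ev i) -
      fderiv ℝ (fun y => f (y, t0)) x0 (ev i))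
    (s := Icc 0 s) (C := 32 * n ^ 2 * m / ρ ^ 2 * s) (x := 0) (y := s) ?_ ?_ (convex_Icc 0 s)
    ⟨le_rfl, hs.1⟩ ⟨hs.1, le_rfl⟩
  · simp only [zero_smul, add_zero, zero_mul, sub_zero, Real.norm_eq_abs, abs_of_nonneg hs.1]
      at key
    convert key using 2
    ring
  · intro τ hτ
    refine ((hasDerivAt_line ((hcal _ (hmem τ hτ) t0).1.differentiableAt (by simp))).sub ?_
      ).hasDerivWithinAt
    simpa using (hasDerivAt_id τ).mul_const (fderiv ℝ (fun y => f (y, t0)) x0 (ev i))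
  · intro τ hτ
    refine (abs_fderiv_line_sub_le i hρ hm hcal hf hosc ⟨hτ.1, hτ.2.trans hs.2⟩).trans ?_
    exact mul_le_mul_of_nonneg_left hτ.2 (by positivity)

/-- A bounded positive solution of the half-space problem, with the normal direction `i₀` and
the boundary condition expressed through one-sided derivatives. -/
structure HalfSol {n : ℕ} (i₀ : Fin n) (q M : ℝ) (u : Eu n × ℝ → ℝ) : Prop where
  cont : ContinuousOn u ({x | 0 ≤ x i₀} ×ˢ univ)
  caloric : ∀ x : Eu n, 0 < x i₀ → ∀ t, IsCaloricAt u x t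
  bdry : ∀ x : Eu n, x i₀ = 0 → ∀ t,
    HasDerivWithinAt (fun τ : ℝ => u (x + τ • ev i₀, t)) (-(u (x, t) ^ q)) (Ici 0) 0
  bdry_tendsto : ∀ x : Eu n, x i₀ = 0 → ∀ t,
    Tendsto (fun τ : ℝ => fderiv ℝ (fun y => u (y, t)) (x + τ • ev i₀) (ev i₀)) (𝓝[>] 0)
      (𝓝 (-(u (x, t) ^ q)))
  pos : ∀ x : Eu n, 0 ≤ x i₀ → ∀ t, 0 < u (x, t)
  le : ∀ x : Eu n, 0 ≤ x i₀ → ∀ t, u (x, t) ≤ M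

lemma isOpen_coord_pos {n : ℕ} (i₀ : Fin n) : IsOpen {x : Eu n | 0 < x i₀} :=
  isOpen_lt continuous_const (by fun_prop)

lemma isClosed_coord_nonneg {n : ℕ} (i₀ : Fin n) : IsClosed {x : Eu n | 0 ≤ x i₀} :=
  isClosed_le continuous_const (by fun_prop)

lemma coord_add_smul_ev {n : ℕ} (i : Fin n) (x : Eu n) (s : ℝ) : (x + s • ev i) i = x i + s := by
  simp

lemma IsHalfSpaceSol.halfSol {n : ℕ} {hn : 0 < n} {q M : ℝ} {u : Eu n × ℝ → ℝ}
    (h : IsHalfSpaceSol n hn q u) (hM : ∀ x ∈ closedHalf n hn, ∀ t, u (x, t) ≤ M) :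
    HalfSol (⟨0, hn⟩ : Fin n) q M u := by
  obtain ⟨h1, h2, h3, h4, h5, h6, h7, h8⟩ := h
  have hmaps : ∀ x : Eu n, x ⟨0, hn⟩ = 0 → MapsTo (fun τ : ℝ => x + τ • ev (⟨0, hn⟩ : Fin n)) (Ici 0)
      (closedHalf n hn) := by
    intro x hx τ hτ
    show 0 ≤ (x + τ • ev (⟨0, hn⟩ : Fin n)) ⟨0, hn⟩
    rw [coord_add_smul_ev, hx, zero_add]
    exact hτ
  have hmem : ∀ x : Eu n, x ⟨0, hn⟩ = 0 → x ∈ closedHalf n hn := fun x hx => hx.ge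
  refine ⟨h1, fun x hx t => ⟨(h4 t).contDiffAt ((isOpen_coord_pos _).mem_nhds hx), ?_⟩,
    fun x hx t => ?_, fun x hx t => ?_, h8, hM⟩
  · rw [← h6 x hx t]
    exact (((h5 x hx).differentiable (by simp)) t).hasDerivAt
  · have a : HasFDerivWithinAt (fun y => u (y, t))
        (fderivWithin ℝ (fun y => u (y, t)) (closedHalf n hn) x) (closedHalf n hn)
        ((fun τ : ℝ => x + τ • ev (⟨0, hn⟩ : Fin n)) 0) := by
      simpa using (((h2 t).differentiableOn (by simp)) x (hmem x hx)).hasFDerivWithinAt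
    have b : HasDerivAt (fun τ : ℝ => x + τ • ev (⟨0, hn⟩ : Fin n)) (ev (⟨0, hn⟩ : Fin n)) 0 := by
      simpa using ((hasDerivAt_id (0 : ℝ)).smul_const (ev (⟨0, hn⟩ : Fin n))).const_add x
    have c := a.comp_hasDerivWithinAt (0 : ℝ) b.hasDerivWithinAt (hmaps x hx)
    rw [← h7 x hx t, neg_neg]
    exact c
  · have a := (h3 t) x (hmem x hx)
    have b : Tendsto (fun τ : ℝ => x + τ • ev (⟨0, hn⟩ : Fin n)) (𝓝[>] 0)
        (𝓝[closedHalf n hn] x) := by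
      refine tendsto_nhdsWithin_iff.2 ⟨(tendsto_line x _).mono_left nhdsWithin_le_nhds, ?_⟩
      filter_upwards [self_mem_nhdsWithin] with τ hτ using hmaps x hx (mem_Ici.2 (le_of_lt hτ))
    have c := (a.tendsto.comp b)
    have d := ((ContinuousLinearMap.apply ℝ ℝ (ev (⟨0, hn⟩ : Fin n))).continuous.tendsto _).comp c
    rw [← h7 x hx t, neg_neg]
    refine d.congr' ?_
    filter_upwards [self_mem_nhdsWithin] with τ hτ
    simp only [Function.comp_apply, ContinuousLinearMap.apply_apply]
    rw [fderivWithin_of_mem_nhds]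
    have : 0 < (x + τ • ev (⟨0, hn⟩ : Fin n)) ⟨0, hn⟩ := by
      rw [coord_add_smul_ev, hx, zero_add]; exact hτ
    exact mem_of_superset ((isOpen_coord_pos _).mem_nhds this) fun y (hy : 0 < y _) => hy.le

namespace HalfSol

variable {n : ℕ} {i₀ : Fin n} {q M : ℝ} {u : Eu n × ℝ → ℝ}

lemma M_pos (h : HalfSol i₀ q M u) : 0 < M :=
  (h.pos 0 (by simp) 0).trans_le (h.le 0 (by simp) 0)

lemma abs_sub_le_M (h : HalfSol i₀ q M u) {x y : Eu n} (hx : 0 ≤ x i₀) (hy : 0 ≤ y i₀) (t s : ℝ) :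
    |u (x, t) - u (y, s)| ≤ M := by
  rw [abs_le]
  constructor <;> linarith [h.pos x hx t, h.pos y hy s, h.le x hx t, h.le y hy s]

lemma normal_lipschitz (h : HalfSol i₀ q M u) (hq : 0 ≤ q) : ∃ L > 0, ∀ x : Eu n, 0 ≤ x i₀ → ∀ t, ∀ s : ℝ, 0 ≤ s →
    |u (x + s • ev i₀, t) - u (x, t)| ≤ L * s := by
  have hM := h.M_pos
  have hMq : 0 < M ^ q := Real.rpow_pos_of_pos hM q
  have hn : (1 : ℝ) ≤ n := by exact_mod_cast Fin.pos i₀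
  set A := 2 * M + M ^ q + 1 with hA
  have hApos : 0 < A := by positivity
  have hcoord : ∀ x : Eu n, 0 ≤ x i₀ → ∀ s : ℝ, 0 ≤ s → 0 ≤ (x + s • ev i₀) i₀ := by
    intro x hx s hs
    rw [coord_add_smul_ev]; linarith
  have hcoord' : ∀ x : Eu n, 0 ≤ x i₀ → ∀ s : ℝ, 0 < s → 0 < (x + s • ev i₀) i₀ := by
    intro x hx s hs
    rw [coord_add_smul_ev]; linarith
  have huq : ∀ x : Eu n, 0 ≤ x i₀ → ∀ t, 0 < u (x, t) ^ q := fun x hx t =>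
    Real.rpow_pos_of_pos (h.pos x hx t) q
  have hS' : ∀ x0 : Eu n, ∀ x ∈ {x : Eu n | 0 ≤ x i₀}, ‖x - x0‖ ≤ 1 → ∀ s ∈ Icc 0 ((1 : ℝ) / 2),
      x + s • ev i₀ ∈ {x : Eu n | 0 ≤ x i₀} := fun x0 x hx _ s hs => hcoord x hx s hs.1
  have hcal_int : ∀ x : Eu n, 0 < x i₀ → x ∈ interior {x : Eu n | 0 ≤ x i₀} := by
    intro x hx
    exact mem_interior.2 ⟨_, fun y (hy : 0 < y i₀) => hy.le, isOpen_coord_pos i₀, hx⟩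
  have hAM : M ≤ A * 1 ^ 2 / 2 := by rw [hA]; linarith
  have hAN : M ^ q < A * 1 := by rw [hA]; linarith
  refine ⟨2 * A * n, by positivity, fun x hx t s hs => ?_⟩
  rcases le_total s (1 / 2) with hs2 | hs2
  · have hfin : A * n * (s * (2 * 1 - s)) ≤ 2 * A * n * s := by
      have : 0 ≤ A * n * (s * s) := by positivity
      linarith
    rw [abs_le]
    constructor
    · have := sub_le_of_barrier i₀ (f := fun p => - u p) (isClosed_coord_nonneg i₀) h.cont.neg
        (x0 := x) hx (t0 := t) one_pos hApos (hS' x)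
        (fun y hy _ s hs t _ => ?_) (fun y hy _ s hs t => (h.caloric _ (hcoord' y hy s hs.1) t).neg)
        (fun y hy _ t => ?_) hAN ⟨hs, hs2⟩
      · linarith
      · have := (abs_le.1 (h.abs_sub_le_M (hcoord y hy s hs.1) hy t t)).1
        linarith
      · rcases (show 0 ≤ y i₀ from hy).eq_or_lt with h0 | h0
        · refine Or.inr ⟨by rw [← h0]; exact hx, u (y, t) ^ q, ?_, ?_⟩
          · exact Real.rpow_le_rpow (h.pos y hy t).le (h.le y hy t) hq
          have := (h.bdry y h0.symm t).neg
          rw [neg_neg] at this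
          exact this
        · exact Or.inl ⟨(h.caloric y h0 t).neg, hcal_int y h0⟩
    · have := sub_le_of_barrier i₀ (f := u) (isClosed_coord_nonneg i₀) h.cont
        (x0 := x) hx (t0 := t) one_pos hApos (hS' x)
        (fun y hy _ s hs t _ => ?_) (fun y hy _ s hs t => (h.caloric _ (hcoord' y hy s hs.1) t))
        (fun y hy _ t => ?_) hAN ⟨hs, hs2⟩
      · linarith
      · have := (abs_le.1 (h.abs_sub_le_M (hcoord y hy s hs.1) hy t t)).2
        linarith
      · rcases (show 0 ≤ y i₀ from hy).eq_or_lt with h0 | h0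
        · refine Or.inr ⟨by rw [← h0]; exact hx, -(u (y, t) ^ q), ?_, h.bdry y h0.symm t⟩
          linarith [huq y hy t]
        · exact Or.inl ⟨h.caloric y h0 t, hcal_int y h0⟩
  · refine (h.abs_sub_le_M (hcoord x hx s hs) hx t t).trans ?_
    have : A * 1 ≤ A * n := by gcongr
    have h2 : A * n * 1 ≤ A * n * (2 * s) := by gcongr; linarith
    linarith

lemma abs_fderiv_normal_le {L : ℝ} (h : HalfSol i₀ q M u)
    (hL : ∀ x : Eu n, 0 ≤ x i₀ → ∀ t, ∀ s : ℝ, 0 ≤ s → |u (x + s • ev i₀, t) - u (x, t)| ≤ L * s)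
    {x : Eu n} (hx : 0 < x i₀) (t : ℝ) :
    |fderiv ℝ (fun y => u (y, t)) x (ev i₀)| ≤ L := by
  have h1 := hasDerivAt_line_zero (e := ev i₀) ((h.caloric x hx t).1.differentiableAt (by simp))
  refine abs_deriv_le_of_right h1.hasDerivWithinAt ?_
  filter_upwards [self_mem_nhdsWithin] with τ hτ
  simpa using hL x hx.le t τ (le_of_lt hτ)

lemma sub_le_coord_of_mem_closedBall {x y : Eu n} {r : ℝ} (i₀ : Fin n)
    (hy : y ∈ Metric.closedBall x r) : x i₀ - r ≤ y i₀ := by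
  rw [Metric.mem_closedBall, dist_eq_norm] at hy
  have := (PiLp.norm_apply_le (y - x) i₀).trans hy
  rw [PiLp.sub_apply, Real.norm_eq_abs, abs_le] at this
  linarith [this.1]

lemma abs_fderiv_le (h : HalfSol i₀ q M u) (i : Fin n) {x : Eu n} (hx : 0 < x i₀) (t : ℝ) :
    |fderiv ℝ (fun y => u (y, t)) x (ev i)| ≤ 32 * n * M / x i₀ := by
  have h1 := hasDerivAt_line_zero (e := ev i) ((h.caloric x hx t).1.differentiableAt (by simp))
  have hb : ∀ y ∈ Metric.closedBall x (2 * (x i₀ / 8)), 0 < y i₀ := fun y hy => by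
    have := sub_le_coord_of_mem_closedBall i₀ hy
    linarith
  refine abs_deriv_le_of_right h1.hasDerivWithinAt ?_
  have h5 : ∀ᶠ τ in 𝓝[>] (0 : ℝ), τ ≤ (x i₀ / 8) / 2 :=
    mem_nhdsWithin_of_mem_nhds (Iic_mem_nhds (by positivity))
  filter_upwards [self_mem_nhdsWithin, h5] with τ hτ hτ'
  have := abs_sub_le_of_interior i (f := u) (x0 := x) (t0 := t) (ρ := x i₀ / 8) (m := M)
    (by positivity) h.M_pos
    (h.cont.mono (prod_mono (fun y hy => (hb y hy).le) (subset_univ _)))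
    (fun y hy s => h.caloric y (hb y (Metric.ball_subset_closedBall hy)) s)
    (fun y hy z hz s _ => h.abs_sub_le_M (hb y hy).le (hb z hz).le s s) ⟨le_of_lt hτ, hτ'⟩
  simp only [zero_smul, add_zero]
  refine this.trans (le_of_eq ?_)
  field_simp
  ring

lemma norm_fderiv_le (h : HalfSol i₀ q M u) {x : Eu n} (hx : 0 < x i₀) (t : ℝ) :
    ‖fderiv ℝ (fun y => u (y, t)) x‖ ≤ 32 * n ^ 2 * M / x i₀ := by
  have hM := h.M_pos
  refine ContinuousLinearMap.opNorm_le_bound _ (by positivity) fun v => ?_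
  have e : v = ∑ i, v i • ev i := by
    ext j
    simp [Pi.single_apply]
  conv_lhs => rw [e]
  rw [map_sum]
  refine (norm_sum_le _ _).trans ((Finset.sum_le_sum (g := fun _ => ‖v‖ * (32 * n * M / x i₀))
    fun i _ => ?_).trans (le_of_eq ?_))
  · rw [map_smul, norm_smul]
    exact mul_le_mul (PiLp.norm_apply_le v i) (h.abs_fderiv_le i hx t) (norm_nonneg _)
      (norm_nonneg _)
  · rw [Finset.sum_const, Finset.card_univ, Fintype.card_fin, nsmul_eq_mul]
    ring

lemma abs_lap_le_rpow (h : HalfSol i₀ q M u) (hq : 0 ≤ q) : ∃ C > 0, ∀ x : Eu n, 0 < x i₀ → ∀ t,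
    |lap (fun y => u (y, t)) x| ≤ C * (x i₀) ^ (-(3 / 2) : ℝ) := by
  obtain ⟨L, hL, hlip⟩ := h.normal_lipschitz hq
  have hM := h.M_pos
  have hn : (1 : ℝ) ≤ n := by exact_mod_cast Fin.pos i₀
  set C1 : ℝ := 32 * n ^ 2 * M with hC1
  set C2 : ℝ := 2 * L + 8 * C1 with hC2
  have hC2p : 0 < C2 := by positivity
  refine ⟨32 * n ^ 3 * C2 * 8 ^ (3 / 2 : ℝ), by positivity, fun x hx t => ?_⟩
  set ρ := x i₀ / 8 with hρ
  have hρp : 0 < ρ := by positivity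
  have hb : ∀ y ∈ Metric.closedBall x (4 * ρ), 4 * ρ ≤ y i₀ := fun y hy => by
    have := sub_le_coord_of_mem_closedBall i₀ hy
    linarith
  have hb' : ∀ y ∈ Metric.closedBall x (4 * ρ), 0 < y i₀ := fun y hy =>
    lt_of_lt_of_le (by positivity) (hb y hy)
  have hd : 0 < √ρ := Real.sqrt_pos.2 hρp
  have hdd : √ρ * √ρ = ρ := Real.mul_self_sqrt hρp.le
  have key := abs_lap_le (f := u) (x0 := x) (t0 := t) (ρ := ρ) (m := C2 * √ρ) hρp (by positivity)
    (fun y hy s => h.caloric y (hb' y hy) s)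
    (h.cont.mono (prod_mono (fun y hy => (hb' y hy).le) (subset_univ _)))
    (fun y hy z hz s _ => ?_)
  · refine key.trans (le_of_eq ?_)
    have e1 : x i₀ = 8 * ρ := by rw [hρ]; ring
    rw [e1, Real.mul_rpow (by norm_num) hρp.le, Real.rpow_neg (by norm_num : (0 : ℝ) ≤ 8),
      Real.sqrt_eq_rpow]
    have e2 : ρ ^ (1 / 2 : ℝ) / ρ ^ 2 = ρ ^ (-(3 / 2) : ℝ) := by
      rw [← Real.rpow_natCast, ← Real.rpow_sub hρp]
      norm_num
    rw [← e2]
    have : (0 : ℝ) < 8 ^ (3 / 2 : ℝ) := by positivity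
    field_simp
  · have a1 := hlip y (hb' y hy).le s (√ρ) hd.le
    have a2 := hlip z (hb' z hz).le s (√ρ) hd.le
    have a3 : |u (y + √ρ • ev i₀, s) - u (z + √ρ • ev i₀, s)| ≤ 8 * C1 * √ρ := by
      set S : Set (Eu n) := {w | √ρ ≤ w i₀} with hS
      have hSc : Convex ℝ S := by
        have : S = (PiLp.proj 2 (fun _ : Fin n => ℝ) i₀ : Eu n →L[ℝ] ℝ) ⁻¹' (Ici √ρ) := rfl
        rw [this]
        exact (convex_Ici _).linear_preimage _
      have b := hSc.norm_image_sub_le_of_norm_fderiv_le (𝕜 := ℝ) (f := fun y => u (y, s))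
        (C := C1 / √ρ) (x := z + √ρ • ev i₀) (y := y + √ρ • ev i₀)
        (fun w hw => (h.caloric w (hd.trans_le hw) s).1.differentiableAt (by simp))
        (fun w hw => (h.norm_fderiv_le (hd.trans_le hw) s).trans (by
          have : √ρ ≤ w i₀ := hw
          rw [← hC1]; gcongr)) (by
            show √ρ ≤ (z + √ρ • ev i₀) i₀
            rw [coord_add_smul_ev]; linarith [hb' z hz]) (by
            show √ρ ≤ (y + √ρ • ev i₀) i₀
            rw [coord_add_smul_ev]; linarith [hb' y hy])
      refine b.trans ?_
      have c1 : ‖y + √ρ • ev i₀ - (z + √ρ • ev i₀)‖ ≤ 8 * ρ := by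
        rw [add_sub_add_right_eq_sub, ← dist_eq_norm]
        have := dist_triangle_right y z x
        rw [Metric.mem_closedBall] at hy hz
        linarith
      calc C1 / √ρ * _ ≤ C1 / √ρ * (8 * ρ) := by gcongr
        _ = C1 / √ρ * (8 * (√ρ * √ρ)) := by rw [hdd]
        _ = 8 * C1 * √ρ := by field_simp
    rw [abs_le] at *
    rw [hC2]
    constructor <;> linarith [a1.1, a1.2, a2.1, a2.2, a3.1, a3.2]

lemma continuousOn_fderiv (h : HalfSol i₀ q M u) (i : Fin n) :
    ContinuousOn (fun p : Eu n × ℝ => fderiv ℝ (fun y => u (y, p.2)) p.1 (ev i))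
      ({x | 0 < x i₀} ×ˢ univ) := by
  rintro ⟨x0, t0⟩ ⟨hx0 : 0 < x0 i₀, -⟩
  refine ContinuousAt.continuousWithinAt ?_
  have hM := h.M_pos
  set ρ := x0 i₀ / 10 with hρ
  have hρp : 0 < ρ := by positivity
  set C := 32 * n ^ 2 * M / ρ ^ 2 with hC
  have hC0 : 0 ≤ C := by positivity
  have hU : {p : Eu n × ℝ | 5 * ρ < p.1 i₀} ∈ 𝓝 (x0, t0) := by
    refine (isOpen_lt continuous_const (by fun_prop)).mem_nhds ?_
    show 5 * ρ < x0 i₀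
    rw [hρ]; linarith
  have hcontAt : ∀ x : Eu n, ∀ t, 0 < x i₀ → ContinuousAt u (x, t) := fun x t hx =>
    h.cont.continuousAt (prod_mem_nhds
      (mem_of_superset ((isOpen_coord_pos i₀).mem_nhds hx) fun y (hy : 0 < y _) => hy.le) univ_mem)
  refine continuousAt_of_locally_uniform_approx_of_continuousAt fun U hU' => ?_
  obtain ⟨ε, hε, hεU⟩ := Metric.mem_uniformity_dist.1 hU'
  set s := min (ρ / 2) (ε / (2 * (C + 1))) with hs
  have hs0 : 0 < s := by positivity
  have hsε : C * s < ε := by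
    have h1 : s ≤ ε / (2 * (C + 1)) := min_le_right _ _
    rw [le_div_iff₀ (by positivity)] at h1
    nlinarith
  refine ⟨_, hU, fun p => (u (p.1 + s • ev i, p.2) - u p) / s, ?_, ?_⟩
  · refine ContinuousAt.div_const (ContinuousAt.sub ?_ (hcontAt x0 t0 hx0)) _
    refine ContinuousAt.comp (g := u) (f := fun p : Eu n × ℝ => (p.1 + s • ev i, p.2)) ?_
      (by fun_prop)
    refine hcontAt _ _ ?_
    have : x0 i₀ ≤ (x0 + s • ev i) i₀ := by
      simp only [PiLp.add_apply, PiLp.smul_apply, PiLp.single_apply, smul_eq_mul]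
      split_ifs <;> simp [hs0.le]
    exact hx0.trans_le this
  · rintro ⟨x, t⟩ (hx : 5 * ρ < x i₀)
    apply hεU
    have hb : ∀ y ∈ Metric.closedBall x (4 * ρ), 0 < y i₀ := fun y hy => by
      have := sub_le_coord_of_mem_closedBall i₀ hy
      linarith
    have key := abs_taylor_line_le i (f := u) (x0 := x) (t0 := t) (ρ := ρ) (m := M) hρp hM
      (fun y hy s => h.caloric y (hb y hy) s)
      (h.cont.mono (prod_mono (fun y hy => (hb y hy).le) (subset_univ _)))
      (fun y hy z hz s _ => h.abs_sub_le_M (hb y hy).le (hb z hz).le s s)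
      ⟨hs0.le, min_le_left _ _⟩
    rw [dist_comm, Real.dist_eq]
    show |(u (x + s • ev i, t) - u (x, t)) / s - fderiv ℝ (fun y => u (y, t)) x (ev i)| < ε
    have e : (u (x + s • ev i, t) - u (x, t)) / s - fderiv ℝ (fun y => u (y, t)) x (ev i) =
        (u (x + s • ev i, t) - u (x, t) - s * fderiv ℝ (fun y => u (y, t)) x (ev i)) / s := by
      field_simp
    rw [e, abs_div, abs_of_pos hs0, div_lt_iff₀ hs0]
    refine key.trans_lt ?_
    gcongr

end HalfSol

/-- A smooth cutoff: `0` on `(-∞, 1]` and `1` on `[2, ∞)`. -/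
noncomputable def cutFun (s : ℝ) : ℝ := Real.smoothTransition (s - 1)

/-- The derivative of `cutFun`. -/
noncomputable def cutDeriv (s : ℝ) : ℝ := deriv cutFun s

lemma contDiff_cutFun : ContDiff ℝ 2 cutFun :=
  Real.smoothTransition.contDiff.comp (contDiff_id.sub contDiff_const)

lemma continuous_cutFun : Continuous cutFun := contDiff_cutFun.continuous

lemma hasDerivAt_cutFun (s : ℝ) : HasDerivAt cutFun (cutDeriv s) s :=
  (contDiff_cutFun.differentiable (by simp) s).hasDerivAt

lemma continuous_cutDeriv : Continuous cutDeriv :=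
  contDiff_cutFun.continuous_deriv (by simp)

lemma cutFun_nonneg (s : ℝ) : 0 ≤ cutFun s := Real.smoothTransition.nonneg _

lemma cutFun_le_one (s : ℝ) : cutFun s ≤ 1 := Real.smoothTransition.le_one _

lemma cutFun_of_le {s : ℝ} (h : s ≤ 1) : cutFun s = 0 :=
  Real.smoothTransition.zero_of_nonpos (by linarith)

lemma cutFun_of_ge {s : ℝ} (h : 2 ≤ s) : cutFun s = 1 :=
  Real.smoothTransition.one_of_one_le (by linarith)

lemma cutDeriv_nonneg (s : ℝ) : 0 ≤ cutDeriv s := by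
  have : Monotone cutFun := fun a b h => Real.smoothTransition.monotone (by linarith)
  exact this.deriv_nonneg

lemma cutDeriv_of_le {s : ℝ} (h : s ≤ 1) : cutDeriv s = 0 := by
  have : EqOn cutDeriv (fun _ => 0) (closure (Iio 1)) := by
    refine EqOn.closure (fun s hs => ?_) continuous_cutDeriv continuous_const
    have : cutFun =ᶠ[𝓝 s] fun _ => 0 := by
      filter_upwards [Iio_mem_nhds hs] with r hr using cutFun_of_le (le_of_lt hr)
    simp [cutDeriv, this.deriv_eq]
  exact this (by rw [closure_Iio]; exact h)

lemma cutDeriv_of_ge {s : ℝ} (h : 2 ≤ s) : cutDeriv s = 0 := by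
  have : EqOn cutDeriv (fun _ => 0) (closure (Ioi 2)) := by
    refine EqOn.closure (fun s hs => ?_) continuous_cutDeriv continuous_const
    have : cutFun =ᶠ[𝓝 s] fun _ => 1 := by
      filter_upwards [Ioi_mem_nhds hs] with r hr using cutFun_of_ge (le_of_lt hr)
    simp [cutDeriv, this.deriv_eq]
  exact this (by rw [closure_Ioi]; exact h)

lemma exists_cutDeriv_le : ∃ C > 0, ∀ s, cutDeriv s ≤ C := by
  obtain ⟨C, hC⟩ := (isCompact_Icc (a := (1 : ℝ)) (b := 2)).exists_bound_of_continuousOn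
    continuous_cutDeriv.continuousOn
  refine ⟨max C 1, by positivity, fun s => ?_⟩
  by_cases hs : s ∈ Icc (1 : ℝ) 2
  · exact ((le_abs_self _).trans (hC s hs)).trans (le_max_left _ _)
  · have : cutDeriv s = 0 := by
      by_cases h1 : s ≤ 1
      · exact cutDeriv_of_le h1
      · exact cutDeriv_of_ge (by by_contra! h2; exact hs ⟨by linarith, h2.le⟩)
    rw [this]
    positivity

/-- Multiplying by a cutoff which vanishes near the boundary makes functions that are continuous
on the open half-space globally continuous. -/
lemma continuous_cut_mul {X : Type*} [TopologicalSpace X] {g f : X → ℝ} {c : ℝ → ℝ} {k : ℝ}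
    (hk : 0 < k) (hg : Continuous g) (hc : Continuous c) (hc0 : ∀ s ≤ 1, c s = 0)
    (hf : ContinuousOn f {p | 0 < g p}) : Continuous fun p => c (k * g p) * f p := by
  rw [continuous_iff_continuousAt]
  intro p
  by_cases hp : 0 < g p
  · have h1 : ContinuousAt f p := hf.continuousAt ((isOpen_lt continuous_const hg).mem_nhds hp)
    exact (by fun_prop : ContinuousAt (fun p => c (k * g p)) p).mul h1
  · have h1 : (fun p => c (k * g p) * f p) =ᶠ[𝓝 p] fun _ => 0 := by
      have h2 : ∀ᶠ r in 𝓝 p, k * g r < 1 := by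
        refine (isOpen_lt (by fun_prop) continuous_const).mem_nhds ?_
        have : k * g p ≤ 0 := mul_nonpos_of_nonneg_of_nonpos hk.le (not_lt.1 hp)
        show k * g p < 1
        linarith
      filter_upwards [h2] with r hr
      rw [hc0 _ hr.le, zero_mul]
    exact continuousAt_const.congr h1.symm

section Plane

variable {n : ℕ}

/-- Orthogonal projection to the hyperplane `x i₀ = 0`. -/
noncomputable def pl (i₀ : Fin n) (z : Eu n) : Eu n := z - z i₀ • ev i₀

lemma pl_apply_self (i₀ : Fin n) (z : Eu n) : pl i₀ z i₀ = 0 := by simp [pl]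

lemma pl_add (i₀ : Fin n) (z : Eu n) : pl i₀ z + z i₀ • ev i₀ = z := by simp [pl]

lemma continuous_pl (i₀ : Fin n) : Continuous (pl i₀) := by
  unfold pl
  fun_prop

lemma norm_pl_add_sq (i₀ : Fin n) (z : Eu n) (s : ℝ) :
    ‖pl i₀ z + s • ev i₀‖ ^ 2 = ‖pl i₀ z‖ ^ 2 + s ^ 2 := by
  rw [norm_add_sq_real, inner_smul_right, EuclideanSpace.inner_single_right, norm_smul]
  simp [pl_apply_self]

lemma norm_pl_le_add (i₀ : Fin n) (z : Eu n) (s : ℝ) : ‖pl i₀ z‖ ≤ ‖pl i₀ z + s • ev i₀‖ := by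
  have := norm_pl_add_sq i₀ z s
  refine abs_le_of_sq_le_sq' ?_ (norm_nonneg _) |>.2
  nlinarith

lemma norm_le_pl_add (i₀ : Fin n) (z : Eu n) : ‖z‖ ≤ ‖pl i₀ z‖ + |z i₀| := by
  conv_lhs => rw [← pl_add i₀ z]
  refine (norm_add_le _ _).trans ?_
  simp [norm_smul]

lemma pl_smul (i₀ : Fin n) (r : ℝ) (z : Eu n) : pl i₀ (r • z) = r • pl i₀ z := by
  simp [pl, smul_sub, smul_smul]

/-- The change of variables `x ↦ pl x + k x₁ e₁`. -/
lemma integral_stretch (i₀ : Fin n) {k : ℝ} (hk : 0 < k) (F : Eu n → ℝ) :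
    ∫ x, k * F (pl i₀ x + (k * x i₀) • ev i₀) = ∫ z, F z := by
  set f : Module.Dual ℝ (Eu n) :=
    (k - 1) • (PiLp.proj 2 (fun _ : Fin n => ℝ) i₀ : Eu n →L[ℝ] ℝ).toLinearMap with hf
  set S := LinearMap.transvection f (ev i₀) with hS
  have hSx : ∀ x, S x = pl i₀ x + (k * x i₀) • ev i₀ := by
    intro x
    rw [hS, LinearMap.transvection.apply, hf]
    ext j
    simp only [pl, PiLp.add_apply, PiLp.sub_apply, PiLp.smul_apply, PiLp.single_apply,
      smul_eq_mul, LinearMap.smul_apply, ContinuousLinearMap.coe_coe, PiLp.proj_apply]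
    split_ifs <;> ring
  have hdet : LinearMap.det S = k := by
    rw [hS, LinearMap.transvection.det, hf]
    simp
  have hdet0 : LinearMap.det S ≠ 0 := by rw [hdet]; exact hk.ne'
  have hmap := Measure.map_linearMap_addHaar_eq_smul_addHaar (volume : Measure (Eu n)) hdet0
  set e := (LinearEquiv.ofIsUnitDet (f := S) (v := (EuclideanSpace.basisFun (Fin n) ℝ).toBasis)
    (v' := (EuclideanSpace.basisFun (Fin n) ℝ).toBasis) (by
    rw [← LinearMap.det_toMatrix (EuclideanSpace.basisFun (Fin n) ℝ).toBasis] at hdet0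
    exact hdet0.isUnit)).toContinuousLinearEquiv with he
  have hme : MeasurableEmbedding S := e.toHomeomorph.measurableEmbedding
  have h1 := hme.integral_map (μ := volume) F
  rw [hmap, hdet, integral_smul_measure] at h1
  simp_rw [← hSx]
  rw [integral_const_mul, ← h1, abs_of_pos (by positivity), ENNReal.toReal_ofReal (by positivity),
    smul_eq_mul, ← mul_assoc, mul_inv_cancel₀ hk.ne', one_mul]

end Plane

section IntegralTools

variable {n : ℕ}

lemma integrable_of_continuous_of_zero {F : Eu n → ℝ} {R : ℝ} (hF : Continuous F)
    (hR : ∀ x, R ≤ ‖x‖ → F x = 0) : Integrable F := by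
  refine hF.integrable_of_hasCompactSupport
    (HasCompactSupport.intro (isCompact_closedBall (0 : Eu n) R) fun x hx => hR x ?_)
  rw [Metric.mem_closedBall, dist_zero_right, not_le] at hx
  exact hx.le

lemma setIntegral_closedBall_eq {F : Eu n → ℝ} {R : ℝ} (hR : ∀ x, R ≤ ‖x‖ → F x = 0) :
    ∫ x in Metric.closedBall (0 : Eu n) R, F x = ∫ x, F x := by
  refine setIntegral_eq_integral_of_forall_compl_eq_zero fun x hx => hR x ?_
  rw [Metric.mem_closedBall, dist_zero_right, not_le] at hx
  exact hx.le

lemma continuous_integral_param {F : Eu n × ℝ → ℝ} {R : ℝ} (hF : Continuous F)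
    (hR : ∀ x t, R ≤ ‖x‖ → F (x, t) = 0) : Continuous fun t => ∫ x, F (x, t) := by
  have := continuous_parametric_integral_of_continuous (μ := (volume : Measure (Eu n)))
    (f := fun t x => F (x, t)) (hF.comp continuous_swap)
    (isCompact_closedBall (0 : Eu n) R)
  refine this.congr fun t => setIntegral_closedBall_eq fun x hx => hR x t hx

lemma hasDerivAt_integral_param {F F' : Eu n × ℝ → ℝ} {R C : ℝ}
    (hF : ∀ t, Continuous fun x => F (x, t)) (hF' : ∀ t, Continuous fun x => F' (x, t))
    (hR : ∀ x t, R ≤ ‖x‖ → F (x, t) = 0) (hR' : ∀ x t, R ≤ ‖x‖ → F' (x, t) = 0)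
    (hC : ∀ x t, |F' (x, t)| ≤ C) (hd : ∀ x t, HasDerivAt (fun s => F (x, s)) (F' (x, t)) t)
    (t : ℝ) : HasDerivAt (fun s => ∫ x, F (x, s)) (∫ x, F' (x, t)) t := by
  refine (hasDerivAt_integral_of_dominated_loc_of_deriv_le (s := univ) (μ := volume)
    (F := fun s x => F (x, s)) (F' := fun s x => F' (x, s))
    (bound := (Metric.closedBall (0 : Eu n) R).indicator fun _ => C) univ_mem
    (Eventually.of_forall fun s => (hF s).aestronglyMeasurable)
    (integrable_of_continuous_of_zero (hF t) fun x => hR x t)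
    (hF' t).aestronglyMeasurable ?_ ?_ ?_).2
  · refine Eventually.of_forall fun x s _ => ?_
    by_cases hx : x ∈ Metric.closedBall (0 : Eu n) R
    · rw [indicator_of_mem hx]
      exact hC x s
    · rw [indicator_of_notMem hx]
      rw [Metric.mem_closedBall, dist_zero_right, not_le] at hx
      rw [hR' x s hx.le, norm_zero]
  · exact (integrable_indicator_iff measurableSet_closedBall).2
      (integrableOn_const (isCompact_closedBall _ _).measure_lt_top.ne)
  · exact Eventually.of_forall fun x s _ => hd x s

lemma integral_fderiv_eq_zero {F : Eu n → ℝ} {R : ℝ} (hF : ContDiff ℝ 1 F)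
    (hR : ∀ x, R ≤ ‖x‖ → F x = 0) (v : Eu n) : ∫ x, fderiv ℝ F x v = 0 := by
  have hcs : HasCompactSupport F :=
    HasCompactSupport.intro (isCompact_closedBall (0 : Eu n) R) fun x hx => hR x (by
      rw [Metric.mem_closedBall, dist_zero_right, not_le] at hx
      exact hx.le)
  have h1 : Integrable fun x => fderiv ℝ F x v := by
    refine Continuous.integrable_of_hasCompactSupport ?_ ?_
    · exact (hF.continuous_fderiv (by simp)).clm_apply continuous_const
    · exact (hcs.fderiv_apply (𝕜 := ℝ) v)
  have := integral_mul_fderiv_eq_neg_fderiv_mul_of_integrable (μ := (volume : Measure (Eu n)))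
    (f := F) (g := fun _ => (1 : ℝ)) (v := v) (by simpa using h1) (by simp)
    (by simpa using hF.continuous.integrable_of_hasCompactSupport hcs)
    (fun x _ => hF.differentiable (by simp) x) (by fun_prop)
  simpa using this.symm

variable (i₀ : Fin n)

/-- The integral over the boundary layer at scale `1 / k`. -/
noncomputable def layerInt (k : ℝ) (K : Eu n → ℝ) : ℝ :=
  ∫ x, k * cutDeriv (k * x i₀) * K x

/-- The integral over the boundary hyperplane. -/
noncomputable def bdryInt (g : Eu n → ℝ) : ℝ :=
  ∫ z, cutDeriv (z i₀) * g (pl i₀ z)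

variable {i₀}

lemma continuous_coord (i : Fin n) : Continuous fun x : Eu n => x i := by fun_prop

lemma continuous_cutFun_mul {k : ℝ} (hk : 0 < k) {f : Eu n → ℝ}
    (hf : ContinuousOn f {x | 0 < x i₀}) : Continuous fun x => cutFun (k * x i₀) * f x :=
  continuous_cut_mul hk (continuous_coord i₀) continuous_cutFun (fun _ => cutFun_of_le) hf

lemma continuous_cutFun_mul_prod {k : ℝ} (hk : 0 < k) {f : Eu n × ℝ → ℝ}
    (hf : ContinuousOn f ({x | 0 < x i₀} ×ˢ univ)) :
    Continuous fun p : Eu n × ℝ => cutFun (k * p.1 i₀) * f p :=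
  continuous_cut_mul hk ((continuous_coord i₀).comp continuous_fst) continuous_cutFun
    (fun _ => cutFun_of_le) (hf.mono fun p (hp : 0 < p.1 i₀) => ⟨hp, mem_univ _⟩)

lemma continuous_cutDeriv_mul {k : ℝ} (hk : 0 < k) {f : Eu n → ℝ}
    (hf : ContinuousOn f {x | 0 < x i₀}) : Continuous fun x => k * cutDeriv (k * x i₀) * f x := by
  have := continuous_cut_mul hk (continuous_coord i₀) continuous_cutDeriv
    (fun _ => cutDeriv_of_le) hf
  simpa [mul_assoc] using this.const_mul k

lemma continuous_cutDeriv_mul_prod {k : ℝ} (hk : 0 < k) {f : Eu n × ℝ → ℝ}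
    (hf : ContinuousOn f ({x | 0 < x i₀} ×ˢ univ)) :
    Continuous fun p : Eu n × ℝ => k * cutDeriv (k * p.1 i₀) * f p := by
  have := continuous_cut_mul hk ((continuous_coord i₀).comp continuous_fst) continuous_cutDeriv
    (fun _ => cutDeriv_of_le) (hf.mono fun p (hp : 0 < p.1 i₀) => ⟨hp, mem_univ _⟩)
  simpa [mul_assoc] using this.const_mul k

lemma contDiff_cutFun_mul {k : ℝ} (hk : 0 < k) {f : Eu n → ℝ}
    (hf : ContDiffOn ℝ 1 f {x | 0 < x i₀}) : ContDiff ℝ 1 fun x => cutFun (k * x i₀) * f x := by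
  rw [contDiff_iff_contDiffAt]
  intro x
  by_cases hx : 0 < x i₀
  · have h1 := hf.contDiffAt ((isOpen_coord_pos i₀).mem_nhds hx)
    have h2 : ContDiff ℝ 1 fun x : Eu n => cutFun (k * x i₀) :=
      (contDiff_cutFun.of_le (by norm_num)).comp (by fun_prop)
    exact h2.contDiffAt.mul h1
  · have h1 : (fun x => cutFun (k * x i₀) * f x) =ᶠ[𝓝 x] fun _ => 0 := by
      have h2 : ∀ᶠ y : Eu n in 𝓝 x, k * y i₀ < 1 := by
        refine (isOpen_lt (by fun_prop) continuous_const).mem_nhds ?_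
        have : k * x i₀ ≤ 0 := mul_nonpos_of_nonneg_of_nonpos hk.le (not_lt.1 hx)
        show k * x i₀ < 1
        linarith
      filter_upwards [h2] with y hy
      rw [cutFun_of_le hy.le, zero_mul]
    exact contDiffAt_const.congr_of_eventuallyEq h1

lemma fderiv_cutFun_mul {k : ℝ} (hk : 0 < k) {f : Eu n → ℝ}
    (hf : ContDiffOn ℝ 1 f {x | 0 < x i₀}) (x : Eu n) (i : Fin n) :
    fderiv ℝ (fun x => cutFun (k * x i₀) * f x) x (ev i) =
      cutFun (k * x i₀) * fderiv ℝ f x (ev i) +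
        if i = i₀ then k * cutDeriv (k * x i₀) * f x else 0 := by
  by_cases hx : 0 < x i₀
  · have h1 := (hf.contDiffAt ((isOpen_coord_pos i₀).mem_nhds hx)).differentiableAt (by simp)
    have h2 := hasDerivAt_line_zero (e := ev i) h1
    have h3 : HasDerivAt (fun τ : ℝ => cutFun (k * (x + τ • ev i) i₀))
        (if i = i₀ then k * cutDeriv (k * x i₀) else 0) 0 := by
      have h4 : HasDerivAt (fun τ : ℝ => k * (x + τ • ev i) i₀) (if i = i₀ then k else 0) 0 := by
        have : (fun τ : ℝ => k * (x + τ • ev i) i₀) =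
            fun τ => k * x i₀ + τ * (if i = i₀ then k else 0) := by
          funext τ
          simp only [PiLp.add_apply, PiLp.smul_apply, PiLp.single_apply, smul_eq_mul, eq_comm]
          split_ifs <;> ring
        rw [this]
        simpa using ((hasDerivAt_id (0 : ℝ)).mul_const (if i = i₀ then k else 0)).const_add
          (k * x i₀)
      have h5 := (hasDerivAt_cutFun (k * x i₀))
      have h6 : k * x i₀ = k * (x + (0 : ℝ) • ev i) i₀ := by simp
      rw [h6] at h5
      have h7 := h5.comp (0 : ℝ) h4
      rw [← h6] at h7
      refine h7.congr_deriv ?_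
      split_ifs <;> ring
    have h8 := h3.mul h2
    have h9 := hasDerivAt_line_zero (e := ev i)
      (((contDiff_cutFun_mul hk hf).differentiable (by simp)) x)
    rw [h9.unique h8]
    simp only [zero_smul, add_zero]
    split_ifs <;> ring
  · have h1 : (fun x => cutFun (k * x i₀) * f x) =ᶠ[𝓝 x] fun _ => 0 := by
      have h2 : ∀ᶠ y : Eu n in 𝓝 x, k * y i₀ < 1 := by
        refine (isOpen_lt (by fun_prop) continuous_const).mem_nhds ?_
        have : k * x i₀ ≤ 0 := mul_nonpos_of_nonneg_of_nonpos hk.le (not_lt.1 hx)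
        show k * x i₀ < 1
        linarith
      filter_upwards [h2] with y hy
      rw [cutFun_of_le hy.le, zero_mul]
    have h2 : k * x i₀ ≤ 1 := by
      have : k * x i₀ ≤ 0 := mul_nonpos_of_nonneg_of_nonpos hk.le (not_lt.1 hx)
      linarith
    rw [h1.fderiv_eq, cutFun_of_le h2, cutDeriv_of_le h2]
    simp

lemma continuousOn_fderiv_apply {f : Eu n → ℝ} (hf : ContDiffOn ℝ 1 f {x | 0 < x i₀}) (v : Eu n) :
    ContinuousOn (fun x => fderiv ℝ f x v) {x | 0 < x i₀} :=
  (hf.continuousOn_fderiv_of_isOpen (isOpen_coord_pos i₀) (by simp)).clm_apply continuousOn_const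

lemma fderiv_eq_zero_of_zero {f : Eu n → ℝ} {R : ℝ} (hR : ∀ x, R ≤ ‖x‖ → f x = 0) (v : Eu n) :
    ∀ x, R + 1 ≤ ‖x‖ → fderiv ℝ f x v = 0 := by
  intro x hx
  have : f =ᶠ[𝓝 x] fun _ => 0 := by
    have h2 : ∀ᶠ y : Eu n in 𝓝 x, R < ‖y‖ :=
      (isOpen_lt continuous_const continuous_norm).mem_nhds (show R < ‖x‖ by linarith)
    filter_upwards [h2] with y hy using hR y hy.le
  rw [this.fderiv_eq]
  simp

/-- The divergence theorem on the half-space, with the boundary replaced by a thin layer. -/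
lemma integral_cut_fderiv {k R : ℝ} (hk : 0 < k) {f : Eu n → ℝ}
    (hf : ContDiffOn ℝ 1 f {x | 0 < x i₀}) (hR : ∀ x, R ≤ ‖x‖ → f x = 0) (i : Fin n) :
    ∫ x, cutFun (k * x i₀) * fderiv ℝ f x (ev i) = -(if i = i₀ then layerInt i₀ k f else 0) := by
  have h1 := integral_fderiv_eq_zero (contDiff_cutFun_mul hk hf)
    (fun x hx => by rw [hR x hx, mul_zero]) (ev i)
  simp_rw [fderiv_cutFun_mul hk hf] at h1
  rw [integral_add (integrable_of_continuous_of_zero (R := R + 1)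
    (continuous_cutFun_mul hk (continuousOn_fderiv_apply hf _))
    (fun x hx => by rw [fderiv_eq_zero_of_zero hR _ x hx, mul_zero]))] at h1
  · rw [eq_neg_iff_add_eq_zero]
    split_ifs at h1 ⊢ with h
    · exact h1
    · simpa using h1
  · split_ifs
    · exact integrable_of_continuous_of_zero (continuous_cutDeriv_mul hk hf.continuousOn)
        (fun x hx => by rw [hR x hx, mul_zero])
    · exact integrable_zero _ _ _

lemma integral_cut_div {k R : ℝ} (hk : 0 < k) {f : Fin n → Eu n → ℝ}
    (hf : ∀ i, ContDiffOn ℝ 1 (f i) {x | 0 < x i₀}) (hR : ∀ i x, R ≤ ‖x‖ → f i x = 0) :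
    ∫ x, cutFun (k * x i₀) * ∑ i, fderiv ℝ (f i) x (ev i) = -layerInt i₀ k (f i₀) := by
  simp_rw [Finset.mul_sum]
  rw [integral_finsetSum]
  · simp_rw [integral_cut_fderiv hk (hf _) (hR _)]
    simp
  · intro i _
    exact integrable_of_continuous_of_zero (R := R + 1)
      (continuous_cutFun_mul hk (continuousOn_fderiv_apply (hf i) _))
      (fun x hx => by rw [fderiv_eq_zero_of_zero (hR i) _ x hx, mul_zero])

lemma layerInt_eq {k : ℝ} (hk : 0 < k) (K : Eu n → ℝ) :
    layerInt i₀ k K = ∫ z, cutDeriv (z i₀) * K (pl i₀ z + (z i₀ / k) • ev i₀) := by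
  rw [← integral_stretch i₀ hk, layerInt]
  refine integral_congr_ae (Eventually.of_forall fun x => ?_)
  have h1 : (pl i₀ x + (k * x i₀) • ev i₀) i₀ = k * x i₀ := by simp [pl_apply_self]
  have h2 : pl i₀ (pl i₀ x + (k * x i₀) • ev i₀) = pl i₀ x := by
    conv_lhs => rw [pl]
    rw [h1, add_sub_cancel_right]
  simp only [h1, h2]
  rw [mul_div_cancel_left₀ _ hk.ne', pl_add, mul_assoc]

lemma abs_cutDeriv_mul_le {Cs C R k : ℝ} (hCs : ∀ s, cutDeriv s ≤ Cs) (hC0 : 0 ≤ C) (hk : 0 < k)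
    {K : Eu n → ℝ} (hC : ∀ x, 0 < x i₀ → |K x| ≤ C) (hR : ∀ x, R ≤ ‖x‖ → K x = 0) (z : Eu n) :
    ‖cutDeriv (z i₀) * K (pl i₀ z + (z i₀ / k) • ev i₀)‖ ≤
      (Metric.closedBall (0 : Eu n) (R + 2)).indicator (fun _ => Cs * C) z := by
  have hCs0 : 0 ≤ Cs := (cutDeriv_nonneg 0).trans (hCs 0)
  by_cases h1 : z i₀ ≤ 1
  · rw [cutDeriv_of_le h1, zero_mul, norm_zero]
    exact indicator_nonneg (fun _ _ => by positivity) z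
  by_cases h2 : 2 ≤ z i₀
  · rw [cutDeriv_of_ge h2, zero_mul, norm_zero]
    exact indicator_nonneg (fun _ _ => by positivity) z
  push Not at h1 h2
  by_cases hz : z ∈ Metric.closedBall (0 : Eu n) (R + 2)
  · rw [indicator_of_mem hz, norm_mul, Real.norm_eq_abs, Real.norm_eq_abs,
      abs_of_nonneg (cutDeriv_nonneg _)]
    refine mul_le_mul (hCs _) (hC _ ?_) (abs_nonneg _) hCs0
    rw [coord_add_smul_ev, pl_apply_self, zero_add]
    exact div_pos (by linarith) hk
  · rw [indicator_of_notMem hz, hR, mul_zero, norm_zero]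
    rw [Metric.mem_closedBall, dist_zero_right, not_le] at hz
    have h3 := norm_le_pl_add i₀ z
    rw [abs_of_pos (by linarith)] at h3
    have := norm_pl_le_add i₀ z (z i₀ / k)
    linarith

lemma integrable_indicator_closedBall (R C : ℝ) :
    Integrable ((Metric.closedBall (0 : Eu n) R).indicator (fun _ => C)) :=
  (integrable_indicator_iff measurableSet_closedBall).2
    (integrableOn_const (isCompact_closedBall _ _).measure_lt_top.ne)

lemma exists_abs_layerInt_le (i₀ : Fin n) {C R : ℝ} (hC0 : 0 ≤ C) : ∃ D, ∀ k > 0, ∀ K : Eu n → ℝ,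
    (∀ x, 0 < x i₀ → |K x| ≤ C) → (∀ x, R ≤ ‖x‖ → K x = 0) → |layerInt i₀ k K| ≤ D := by
  obtain ⟨Cs, -, hCs⟩ := exists_cutDeriv_le
  refine ⟨∫ z, (Metric.closedBall (0 : Eu n) (R + 2)).indicator (fun _ => Cs * C) z,
    fun k hk K hC hR => ?_⟩
  rw [layerInt_eq hk]
  exact norm_integral_le_of_norm_le (integrable_indicator_closedBall _ _)
    (Eventually.of_forall (abs_cutDeriv_mul_le hCs hC0 hk hC hR))

lemma tendsto_layerInt {C R : ℝ} {K K₀ : Eu n → ℝ} (hK : ContinuousOn K {x | 0 < x i₀})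
    (hC : ∀ x, 0 < x i₀ → |K x| ≤ C) (hR : ∀ x, R ≤ ‖x‖ → K x = 0)
    (hlim : ∀ x : Eu n, x i₀ = 0 → Tendsto (fun τ : ℝ => K (x + τ • ev i₀)) (𝓝[>] 0) (𝓝 (K₀ x))) :
    Tendsto (fun m : ℕ => layerInt i₀ ((m : ℝ) + 1) K) atTop (𝓝 (bdryInt i₀ K₀)) := by
  have hC0 : 0 ≤ C := (abs_nonneg _).trans (hC (ev i₀) (by simp))
  obtain ⟨Cs, -, hCs⟩ := exists_cutDeriv_le
  have hk : ∀ m : ℕ, (0 : ℝ) < (m : ℝ) + 1 := fun m => by positivity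
  rw [show (fun m : ℕ => layerInt i₀ ((m : ℝ) + 1) K) = fun m : ℕ => ∫ z, cutDeriv (z i₀) *
    K (pl i₀ z + (z i₀ / ((m : ℝ) + 1)) • ev i₀) from funext fun m => layerInt_eq (hk m) K]
  refine tendsto_integral_of_dominated_convergence _ (fun m => ?_)
    (integrable_indicator_closedBall (R + 2) (Cs * C))
    (fun m => Eventually.of_forall (abs_cutDeriv_mul_le hCs hC0 (hk m) hC hR))
    (Eventually.of_forall fun z => ?_)
  · have h1 : Continuous fun z : Eu n => cutDeriv (1 * z i₀) *
        K (pl i₀ z + (z i₀ / ((m : ℝ) + 1)) • ev i₀) := by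
      refine continuous_cut_mul one_pos (continuous_coord i₀) continuous_cutDeriv
        (fun _ => cutDeriv_of_le) (hK.comp ?_ ?_)
      · have := continuous_pl i₀
        fun_prop
      · intro z (hz : 0 < z i₀)
        show 0 < (pl i₀ z + (z i₀ / ((m : ℝ) + 1)) • ev i₀) i₀
        rw [coord_add_smul_ev, pl_apply_self, zero_add]
        exact div_pos hz (hk m)
    simpa using h1.aestronglyMeasurable
  · by_cases h1 : z i₀ ≤ 1
    · simp [cutDeriv_of_le h1]
    · push Not at h1
      refine ((hlim (pl i₀ z) (pl_apply_self i₀ z)).comp ?_).const_mul _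
      refine tendsto_nhdsWithin_iff.2 ⟨?_, Eventually.of_forall fun m => ?_⟩
      · exact tendsto_const_nhds.div_atTop
          (tendsto_atTop_add_const_right _ _ tendsto_natCast_atTop_atTop)
      · exact div_pos (by linarith) (hk m)

/-- Time-integrated convergence of layer integrals to boundary integrals. -/
lemma tendsto_integral_layerInt {C R a b : ℝ} {K K₀ : Eu n × ℝ → ℝ}
    {w : ℝ → ℝ} (hw : Continuous w) (hK : ContinuousOn K ({x | 0 < x i₀} ×ˢ univ))
    (hC : ∀ x, 0 < x i₀ → ∀ t, |K (x, t)| ≤ C) (hR : ∀ x t, R ≤ ‖x‖ → K (x, t) = 0)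
    (hlim : ∀ x : Eu n, x i₀ = 0 → ∀ t,
      Tendsto (fun τ : ℝ => K (x + τ • ev i₀, t)) (𝓝[>] 0) (𝓝 (K₀ (x, t)))) :
    Tendsto (fun m : ℕ => ∫ t in a..b, w t * layerInt i₀ ((m : ℝ) + 1) (fun x => K (x, t))) atTop
      (𝓝 (∫ t in a..b, w t * bdryInt i₀ (fun x => K₀ (x, t)))) := by
  have hC0 : 0 ≤ C := (abs_nonneg _).trans (hC (ev i₀) (by simp) 0)
  obtain ⟨D, hD⟩ := exists_abs_layerInt_le i₀ (R := R) hC0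
  have hk : ∀ m : ℕ, (0 : ℝ) < (m : ℝ) + 1 := fun m => by positivity
  refine intervalIntegral.tendsto_integral_filter_of_dominated_convergence (fun t => |w t| * D)
    (Eventually.of_forall fun m => ?_) (Eventually.of_forall fun m => ?_) ?_ ?_
  · refine Continuous.aestronglyMeasurable (hw.mul ?_)
    exact continuous_integral_param (R := R) (continuous_cutDeriv_mul_prod (hk m) hK)
      fun x t hx => by rw [hR x t hx, mul_zero]
  · refine Eventually.of_forall fun t _ => ?_
    rw [norm_mul]
    exact mul_le_mul_of_nonneg_left (hD _ (hk m) _ (fun x hx => hC x hx t) fun x => hR x t)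
      (norm_nonneg _)
  · exact (by fun_prop : Continuous fun t => |w t| * D).intervalIntegrable _ _
  · refine Eventually.of_forall fun t _ => ?_
    refine (tendsto_layerInt (C := C) (R := R) ?_ (fun x hx => hC x hx t) (fun x => hR x t)
      fun x hx => hlim x hx t).const_mul _
    exact hK.comp (by fun_prop) fun x hx => ⟨hx, mem_univ _⟩

end IntegralTools

section BoundaryIntegral

variable {n : ℕ} {i₀ : Fin n}

lemma continuous_bdry_integrand {g : Eu n → ℝ} (hg : ContinuousOn g {x | x i₀ = 0}) :
    Continuous fun z => cutDeriv (z i₀) * g (pl i₀ z) := by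
  refine (continuous_cutDeriv.comp (continuous_coord i₀)).mul ?_
  rw [← continuousOn_univ]
  exact hg.comp (continuous_pl i₀).continuousOn fun z _ => pl_apply_self i₀ z

lemma bdry_integrand_eq_zero {g : Eu n → ℝ} {R : ℝ} (hR : ∀ x, R ≤ ‖x‖ → g x = 0) (z : Eu n)
    (hz : R + 2 ≤ ‖z‖) : cutDeriv (z i₀) * g (pl i₀ z) = 0 := by
  by_cases h1 : z i₀ ≤ 1
  · rw [cutDeriv_of_le h1, zero_mul]
  by_cases h2 : 2 ≤ z i₀
  · rw [cutDeriv_of_ge h2, zero_mul]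
  push Not at h1 h2
  rw [hR, mul_zero]
  have h3 := norm_le_pl_add i₀ z
  rw [abs_of_pos (by linarith)] at h3
  linarith

lemma integrable_bdry {g : Eu n → ℝ} {R : ℝ} (hg : ContinuousOn g {x | x i₀ = 0})
    (hR : ∀ x, R ≤ ‖x‖ → g x = 0) : Integrable fun z => cutDeriv (z i₀) * g (pl i₀ z) :=
  integrable_of_continuous_of_zero (continuous_bdry_integrand hg) (bdry_integrand_eq_zero hR)

lemma bdryInt_mono {f g : Eu n → ℝ} {R : ℝ} (hf : ContinuousOn f {x | x i₀ = 0})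
    (hfR : ∀ x, R ≤ ‖x‖ → f x = 0) (hg : ContinuousOn g {x | x i₀ = 0})
    (hgR : ∀ x, R ≤ ‖x‖ → g x = 0) (h : ∀ x : Eu n, x i₀ = 0 → f x ≤ g x) :
    bdryInt i₀ f ≤ bdryInt i₀ g :=
  integral_mono (integrable_bdry hf hfR) (integrable_bdry hg hgR) fun z =>
    mul_le_mul_of_nonneg_left (h _ (pl_apply_self i₀ z)) (cutDeriv_nonneg _)

lemma bdryInt_nonneg {g : Eu n → ℝ} (h : ∀ x : Eu n, x i₀ = 0 → 0 ≤ g x) : 0 ≤ bdryInt i₀ g :=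
  integral_nonneg fun z => mul_nonneg (cutDeriv_nonneg _) (h _ (pl_apply_self i₀ z))

lemma bdryInt_const_mul (c : ℝ) (g : Eu n → ℝ) :
    bdryInt i₀ (fun x => c * g x) = c * bdryInt i₀ g := by
  unfold bdryInt
  rw [← integral_const_mul]
  congr 1
  funext z
  ring

lemma bdryInt_sub {f g : Eu n → ℝ} {R : ℝ} (hf : ContinuousOn f {x | x i₀ = 0})
    (hfR : ∀ x, R ≤ ‖x‖ → f x = 0) (hg : ContinuousOn g {x | x i₀ = 0})
    (hgR : ∀ x, R ≤ ‖x‖ → g x = 0) :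
    bdryInt i₀ (fun x => f x - g x) = bdryInt i₀ f - bdryInt i₀ g := by
  unfold bdryInt
  rw [← integral_sub (integrable_bdry hf hfR) (integrable_bdry hg hgR)]
  congr 1
  funext z
  ring

lemma continuous_bdryInt_param {g : Eu n × ℝ → ℝ} {R : ℝ}
    (hg : ContinuousOn g ({x | x i₀ = 0} ×ˢ univ)) (hR : ∀ x t, R ≤ ‖x‖ → g (x, t) = 0) :
    Continuous fun t => bdryInt i₀ fun x => g (x, t) := by
  refine continuous_integral_param (R := R + 2)
    (F := fun p : Eu n × ℝ => cutDeriv (p.1 i₀) * g (pl i₀ p.1, p.2)) ?_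
    fun x t hx => bdry_integrand_eq_zero (fun x => hR x t) x hx
  refine (continuous_cutDeriv.comp ((continuous_coord i₀).comp continuous_fst)).mul ?_
  rw [← continuousOn_univ]
  refine hg.comp ?_ fun z _ => ⟨pl_apply_self i₀ z.1, mem_univ _⟩
  exact ((continuous_pl i₀).comp continuous_fst |>.prodMk continuous_snd).continuousOn

lemma pl_pl_add (z : Eu n) (s : ℝ) : pl i₀ (pl i₀ z + s • ev i₀) = pl i₀ z := by
  have h1 : (pl i₀ z + s • ev i₀) i₀ = s := by simp [pl_apply_self]
  conv_lhs => rw [pl]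
  rw [h1, add_sub_cancel_right]

lemma layerInt_comp_pl {k : ℝ} (hk : 0 < k) (g : Eu n → ℝ) :
    layerInt i₀ k (fun x => g (pl i₀ x)) = bdryInt i₀ g := by
  rw [layerInt_eq hk]
  simp_rw [pl_pl_add]
  rfl

lemma bdryInt_eq_scaled {R : ℝ} (hR : 0 < R) (g : Eu n → ℝ) :
    bdryInt i₀ g = R ^ n / R * bdryInt i₀ fun x => g (R • x) := by
  have h1 := Measure.integral_comp_smul (volume : Measure (Eu n))
    (fun z => cutDeriv (z i₀) * g (pl i₀ z)) R
  rw [finrank_euclideanSpace_fin, abs_of_pos (by positivity)] at h1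
  rw [← layerInt_comp_pl hR fun x => g (R • x), layerInt]
  simp_rw [mul_assoc]
  rw [integral_const_mul]
  simp only [pl_smul, PiLp.smul_apply, smul_eq_mul] at h1
  rw [h1, bdryInt]
  field_simp

lemma exists_abs_bdryInt_le (i₀ : Fin n) : ∃ D > 0, ∀ R > 0, ∀ C ≥ 0, ∀ g : Eu n → ℝ,
    (∀ x : Eu n, x i₀ = 0 → |g x| ≤ C) → (∀ x, R ≤ ‖x‖ → g x = 0) →
    |bdryInt i₀ g| ≤ D * C * (R ^ n / R) := by
  obtain ⟨Cs, hCs0, hCs⟩ := exists_cutDeriv_le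
  set V := ∫ z, (Metric.closedBall (0 : Eu n) (1 + 2)).indicator (fun _ => (1 : ℝ)) z with hV
  have hV0 : 0 ≤ V := integral_nonneg fun z => indicator_nonneg (fun _ _ => zero_le_one) z
  refine ⟨Cs * V + 1, by positivity, fun R hR C hC0 g hC hg => ?_⟩
  rw [bdryInt_eq_scaled hR, abs_mul, abs_of_pos (by positivity), mul_comm]
  refine mul_le_mul_of_nonneg_right ?_ (by positivity)
  have h1 : |bdryInt i₀ fun x => g (R • x)| ≤
      ∫ z, (Metric.closedBall (0 : Eu n) (1 + 2)).indicator (fun _ => Cs * C) z := by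
    rw [bdryInt, ← Real.norm_eq_abs]
    refine norm_integral_le_of_norm_le (integrable_indicator_closedBall _ _)
      (Eventually.of_forall fun z => ?_)
    by_cases hz : z ∈ Metric.closedBall (0 : Eu n) (1 + 2)
    · rw [indicator_of_mem hz, Real.norm_eq_abs, abs_mul, abs_of_nonneg (cutDeriv_nonneg _)]
      exact mul_le_mul (hCs _) (hC _ (by simp [pl_apply_self])) (abs_nonneg _) hCs0.le
    · rw [indicator_of_notMem hz, bdry_integrand_eq_zero (R := 1) (g := fun x => g (R • x))
        (fun x hx => hg _ ?_) z ?_, norm_zero]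
      · rw [mem_closedBall_zero_iff, not_le] at hz
        linarith
      · rw [norm_smul, Real.norm_eq_abs, abs_of_pos hR]
        exact le_mul_of_one_le_right hR.le hx
  refine h1.trans ?_
  have h2 : ∫ z, (Metric.closedBall (0 : Eu n) (1 + 2)).indicator (fun _ => Cs * C) z
      = Cs * C * V := by
    rw [hV, ← integral_const_mul]
    congr 1
    funext z
    by_cases hz : z ∈ Metric.closedBall (0 : Eu n) (1 + 2) <;> simp [indicator, hz]
  rw [h2]
  nlinarith

end BoundaryIntegral

section Bump

lemma hasDerivAt_max_pow (k : ℕ) (s : ℝ) :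
    HasDerivAt (fun s : ℝ => max s 0 ^ (k + 2)) (((k : ℝ) + 2) * max s 0 ^ (k + 1)) s := by
  rcases lt_trichotomy s 0 with hs | hs | hs
  · have : (fun s : ℝ => max s 0 ^ (k + 2)) =ᶠ[𝓝 s] fun _ => 0 := by
      filter_upwards [Iio_mem_nhds hs] with r hr
      rw [max_eq_right (le_of_lt hr), zero_pow (by omega)]
    rw [max_eq_right hs.le, zero_pow (by omega), mul_zero]
    exact (hasDerivAt_const s 0).congr_of_eventuallyEq this
  · subst hs
    rw [max_self, zero_pow (by omega), mul_zero, hasDerivAt_iff_isLittleO_nhds_zero]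
    simp only [zero_add, max_self, smul_zero, sub_zero, ne_eq, Nat.add_eq_zero_iff, OfNat.ofNat_ne_zero, and_false,
      not_false_eq_true, zero_pow]
    have h1 : (fun h : ℝ => h ^ (k + 2)) =o[𝓝 0] fun h => h := by
      simpa using Asymptotics.isLittleO_pow_pow (𝕜 := ℝ) (m := 1) (n := k + 2) (by omega)
    refine Asymptotics.IsBigO.trans_isLittleO ?_ h1
    refine Asymptotics.IsBigO.of_bound 1 (Eventually.of_forall fun h => ?_)
    rw [one_mul, norm_pow, norm_pow]
    refine pow_le_pow_left₀ (norm_nonneg _) ?_ _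
    rw [Real.norm_eq_abs, abs_of_nonneg (le_max_right _ _)]
    exact max_le (le_abs_self _) (abs_nonneg _)
  · have : (fun s : ℝ => max s 0 ^ (k + 2)) =ᶠ[𝓝 s] fun s => s ^ (k + 2) := by
      filter_upwards [Ioi_mem_nhds hs] with r hr
      rw [max_eq_left (le_of_lt hr)]
    rw [max_eq_left hs.le]
    have h2 := (hasDerivAt_pow (k + 2) s)
    push_cast at h2
    exact h2.congr_of_eventuallyEq this

lemma contDiff_max_pow_two (k : ℕ) : ContDiff ℝ 1 fun s : ℝ => max s 0 ^ (k + 2) := by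
  rw [contDiff_one_iff_deriv]
  refine ⟨fun s => (hasDerivAt_max_pow k s).differentiableAt, ?_⟩
  rw [show deriv (fun s : ℝ => max s 0 ^ (k + 2)) = fun s => ((k : ℝ) + 2) * max s 0 ^ (k + 1) from
    funext fun s => (hasDerivAt_max_pow k s).deriv]
  fun_prop

lemma contDiff_max_pow_three (k : ℕ) : ContDiff ℝ 2 fun s : ℝ => max s 0 ^ (k + 3) := by
  rw [show (2 : WithTop ℕ∞) = 1 + 1 by norm_num, contDiff_succ_iff_deriv]
  refine ⟨fun s => (hasDerivAt_max_pow (k + 1) s).differentiableAt, by simp, ?_⟩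
  rw [show deriv (fun s : ℝ => max s 0 ^ (k + 3)) =
    fun s => (((k + 1 : ℕ) : ℝ) + 2) * max s 0 ^ (k + 2) from
    funext fun s => (hasDerivAt_max_pow (k + 1) s).deriv]
  exact contDiff_const.mul (contDiff_max_pow_two k)

variable {n : ℕ}

/-- The truncated paraboloid `(1 - |x|² / R²)₊`. -/
noncomputable def cap (R : ℝ) (x : Eu n) : ℝ := max (1 - ‖x‖ ^ 2 / R ^ 2) 0

lemma cap_nonneg (R : ℝ) (x : Eu n) : 0 ≤ cap R x := le_max_right _ _

lemma cap_le_one (R : ℝ) (x : Eu n) : cap R x ≤ 1 :=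
  max_le (by have : 0 ≤ ‖x‖ ^ 2 / R ^ 2 := by positivity
             linarith) zero_le_one

lemma cap_eq_zero {R : ℝ} (hR : 0 < R) {x : Eu n} (hx : R ≤ ‖x‖) : cap R x = 0 := by
  refine max_eq_right ?_
  rw [sub_nonpos, le_div_iff₀ (by positivity), one_mul]
  gcongr

lemma cap_mul_norm_sq (R : ℝ) (x : Eu n) :
    cap R x * (‖x‖ ^ 2 / R ^ 2) = cap R x * (1 - cap R x) := by
  unfold cap
  rcases le_total (1 - ‖x‖ ^ 2 / R ^ 2) 0 with h | h
  · rw [max_eq_right h]; ring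
  · rw [max_eq_left h]; ring

lemma continuous_cap (R : ℝ) : Continuous (cap R : Eu n → ℝ) := by
  unfold cap
  fun_prop

lemma contDiff_cap_pow_two (R : ℝ) (k : ℕ) : ContDiff ℝ 1 fun x : Eu n => cap R x ^ (k + 2) :=
  (contDiff_max_pow_two k).comp (contDiff_const.sub ((contDiff_norm_sq ℝ).div_const _))

lemma contDiff_cap_pow_three (R : ℝ) (k : ℕ) : ContDiff ℝ 2 fun x : Eu n => cap R x ^ (k + 3) :=
  (contDiff_max_pow_three k).comp (contDiff_const.sub ((contDiff_norm_sq ℝ).div_const _))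

lemma hasDerivAt_norm_sq_line (x : Eu n) (i : Fin n) :
    HasDerivAt (fun τ : ℝ => ‖x + τ • ev i‖ ^ 2) (2 * x i) 0 := by
  have h1 : (fun τ : ℝ => ‖x + τ • ev i‖ ^ 2) = fun τ => ‖x‖ ^ 2 + (2 * x i * τ + τ ^ 2) := by
    funext τ
    rw [norm_add_sq_real, inner_smul_right, EuclideanSpace.inner_single_right, norm_smul]
    simp
    ring
  rw [h1]
  have h2 := (((hasDerivAt_id (0 : ℝ)).const_mul (2 * x i)).add
    (hasDerivAt_pow 2 (0 : ℝ))).const_add (‖x‖ ^ 2)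
  simpa using h2

lemma hasDerivAt_cap_pow_line (R : ℝ) (k : ℕ) (x : Eu n) (i : Fin n) :
    HasDerivAt (fun τ : ℝ => cap R (x + τ • ev i) ^ (k + 2))
      (((k : ℝ) + 2) * cap R x ^ (k + 1) * (-(2 * x i) / R ^ 2)) 0 := by
  have h1 := ((hasDerivAt_norm_sq_line x i).div_const (R ^ 2)).const_sub 1
  have h2 := hasDerivAt_max_pow k (1 - ‖x + (0 : ℝ) • ev i‖ ^ 2 / R ^ 2)
  have h3 := h2.comp (0 : ℝ) h1
  refine h3.congr_deriv ?_
  simp only [zero_smul, add_zero, cap]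
  ring

lemma fderiv_cap_pow (R : ℝ) (k : ℕ) (x : Eu n) (i : Fin n) :
    fderiv ℝ (fun x : Eu n => cap R x ^ (k + 2)) x (ev i) =
      ((k : ℝ) + 2) * cap R x ^ (k + 1) * (-(2 * x i) / R ^ 2) :=
  (hasDerivAt_line_zero ((contDiff_cap_pow_two R k).differentiable (by simp) x)).unique
    (hasDerivAt_cap_pow_line R k x i)

end Bump

namespace HalfSol

variable {n : ℕ} {i₀ : Fin n} {q M : ℝ} {u : Eu n × ℝ → ℝ}

lemma continuousOn_pos (h : HalfSol i₀ q M u) : ContinuousOn u ({x | 0 < x i₀} ×ˢ univ) :=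
  h.cont.mono (prod_mono (fun x (hx : 0 < x i₀) => hx.le) subset_rfl)

lemma contDiffOn (h : HalfSol i₀ q M u) (t : ℝ) :
    ContDiffOn ℝ 2 (fun x => u (x, t)) {x | 0 < x i₀} :=
  fun x hx => (h.caloric x hx t).1.contDiffWithinAt

lemma contDiffOn_fderiv (h : HalfSol i₀ q M u) (t : ℝ) (i : Fin n) :
    ContDiffOn ℝ 1 (fun x => fderiv ℝ (fun y => u (y, t)) x (ev i)) {x | 0 < x i₀} :=
  fun x hx => ((h.caloric x hx t).1.fderiv_apply_const (ev i)).contDiffWithinAt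

lemma continuousOn_lap (h : HalfSol i₀ q M u) (t : ℝ) :
    ContinuousOn (lap fun x => u (x, t)) {x | 0 < x i₀} := by
  unfold lap
  exact continuousOn_finsetSum _ fun i _ => continuousOn_fderiv_apply (h.contDiffOn_fderiv t i) _

lemma continuousOn_slice (h : HalfSol i₀ q M u) (t : ℝ) :
    ContinuousOn (fun x => u (x, t)) {x | 0 < x i₀} := (h.contDiffOn t).continuousOn

lemma exists_abs_cut_lap_le (h : HalfSol i₀ q M u) (hq : 0 ≤ q) {k : ℝ} (hk : 0 < k) :
    ∃ C, ∀ x t, |cutFun (k * x i₀) * lap (fun y => u (y, t)) x| ≤ C := by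
  obtain ⟨C, hC0, hC⟩ := h.abs_lap_le_rpow hq
  refine ⟨C * (1 / k) ^ (-(3 / 2) : ℝ), fun x t => ?_⟩
  by_cases hx : k * x i₀ ≤ 1
  · rw [cutFun_of_le hx, zero_mul, abs_zero]
    positivity
  · push Not at hx
    have h1 : 1 / k ≤ x i₀ := by
      rw [div_le_iff₀ hk]; linarith
    have h2 : 0 < x i₀ := lt_of_lt_of_le (by positivity) h1
    rw [abs_mul, abs_of_nonneg (cutFun_nonneg _)]
    refine (mul_le_of_le_one_left (abs_nonneg _) (cutFun_le_one _)).trans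
      ((hC x h2 t).trans ?_)
    exact mul_le_mul_of_nonneg_left
      (Real.rpow_le_rpow_of_nonpos (by positivity) h1 (by norm_num)) hC0.le

lemma hasDerivAt_cut_integral (h : HalfSol i₀ q M u) (hq : 0 ≤ q) {k R : ℝ} (hk : 0 < k)
    {Φ Φ' : ℝ → ℝ} (hΦ : ∀ s, HasDerivAt Φ (Φ' s) s) (hΦ' : Continuous Φ')
    {ψ : Eu n → ℝ} (hψ : Continuous ψ) (hR : ∀ x, R ≤ ‖x‖ → ψ x = 0) (t : ℝ) :
    HasDerivAt (fun s => ∫ x, cutFun (k * x i₀) * (Φ (u (x, s)) * ψ x))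
      (∫ x, cutFun (k * x i₀) * (Φ' (u (x, t)) * lap (fun y => u (y, t)) x * ψ x)) t := by
  obtain ⟨C, hC⟩ := h.exists_abs_cut_lap_le hq hk
  obtain ⟨A, hA⟩ := (isCompact_Icc (a := (0 : ℝ)) (b := M)).exists_bound_of_continuousOn
    hΦ'.continuousOn
  obtain ⟨B, hB⟩ : ∃ B, ∀ x, |ψ x| ≤ B :=
    (hψ.bounded_above_of_compact_support (HasCompactSupport.intro
      (isCompact_closedBall (0 : Eu n) R) fun x hx => hR x (by
        rw [mem_closedBall_zero_iff, not_le] at hx; exact hx.le)))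
  have hΦc : Continuous Φ := continuous_iff_continuousAt.2 fun s => (hΦ s).continuousAt
  refine hasDerivAt_integral_param (R := R) (C := A * C * B)
    (F := fun p : Eu n × ℝ => cutFun (k * p.1 i₀) * (Φ (u p) * ψ p.1))
    (F' := fun p : Eu n × ℝ =>
      cutFun (k * p.1 i₀) * (Φ' (u p) * lap (fun y => u (y, p.2)) p.1 * ψ p.1))
    (fun t => ?_) (fun t => ?_) (fun x t hx => ?_) (fun x t hx => ?_) (fun x t => ?_)
    (fun x t => ?_) t
  · exact continuous_cutFun_mul hk ((hΦc.comp_continuousOn (h.continuousOn_slice t)).mul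
      hψ.continuousOn)
  · exact continuous_cutFun_mul hk (((hΦ'.comp_continuousOn (h.continuousOn_slice t)).mul
      (h.continuousOn_lap t)).mul hψ.continuousOn)
  · simp [hR x hx]
  · simp [hR x hx]
  · by_cases hx : 0 < x i₀
    · rw [show cutFun (k * x i₀) * (Φ' (u (x, t)) * lap (fun y => u (y, t)) x * ψ x) =
        Φ' (u (x, t)) * (cutFun (k * x i₀) * lap (fun y => u (y, t)) x) * ψ x by ring,
        abs_mul, abs_mul]
      have h1 := hA (u (x, t)) ⟨(h.pos x hx.le t).le, h.le x hx.le t⟩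
      rw [Real.norm_eq_abs] at h1
      have hA0 := (abs_nonneg _).trans h1
      have hC0 := (abs_nonneg _).trans (hC x t)
      exact mul_le_mul (mul_le_mul h1 (hC x t) (abs_nonneg _) hA0) (hB x) (abs_nonneg _)
        (mul_nonneg hA0 hC0)
    · have h1 := hA (u (ev i₀, 0)) ⟨(h.pos _ (by simp) 0).le, h.le _ (by simp) 0⟩
      have hA0 := (norm_nonneg _).trans h1
      have hC0 := (abs_nonneg _).trans (hC x t)
      have hB0 := (abs_nonneg _).trans (hB x)
      simp only
      rw [cutFun_of_le (by nlinarith [not_lt.1 hx]), zero_mul, abs_zero]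
      positivity
  · by_cases hx : 0 < x i₀
    · have h1 : HasDerivAt (fun s => Φ (u (x, s))) (Φ' (u (x, t)) * lap (fun y => u (y, t)) x) t :=
        (hΦ _).comp t (h.caloric x hx t).2
      exact (h1.mul_const (ψ x)).const_mul (cutFun (k * x i₀))
    · have : cutFun (k * x i₀) = 0 := cutFun_of_le (by nlinarith [not_lt.1 hx])
      simp only [this, zero_mul]
      exact hasDerivAt_const _ _

end HalfSol

section Aux

lemma cutFun_monotone : Monotone cutFun :=
  monotone_of_deriv_nonneg (fun s => (hasDerivAt_cutFun s).differentiableAt)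
    fun s => by rw [(hasDerivAt_cutFun s).deriv]; exact cutDeriv_nonneg s

lemma integral_le_sub_of_hasDerivAt {y y' P : ℝ → ℝ} (hy : ∀ t, HasDerivAt y (y' t) t)
    (hP : Continuous P) (hle : ∀ t, P t ≤ y' t) {a b : ℝ} (hab : a ≤ b) :
    ∫ t in a..b, P t ≤ y b - y a :=
  intervalIntegral.integral_le_sub_of_hasDeriv_right_of_le hab
    (fun t _ => (hy t).continuousAt.continuousWithinAt) (fun t _ => (hy t).hasDerivWithinAt)
    (hP.integrableOn_Icc) fun t _ => hle t

variable {n : ℕ} {i₀ : Fin n}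

lemma integral_cut_mono {k R : ℝ} (hk : 0 < k) {f g : Eu n → ℝ}
    (hf : ContinuousOn f {x | 0 < x i₀}) (hg : ContinuousOn g {x | 0 < x i₀})
    (hfR : ∀ x, R ≤ ‖x‖ → f x = 0) (hgR : ∀ x, R ≤ ‖x‖ → g x = 0)
    (hfg : ∀ x, 0 < x i₀ → f x ≤ g x) :
    ∫ x, cutFun (k * x i₀) * f x ≤ ∫ x, cutFun (k * x i₀) * g x := by
  refine integral_mono
    (integrable_of_continuous_of_zero (R := R) (continuous_cutFun_mul hk hf) ?_)
    (integrable_of_continuous_of_zero (R := R) (continuous_cutFun_mul hk hg) ?_) fun x => ?_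
  · intro x hx; rw [hfR x hx, mul_zero]
  · intro x hx; rw [hgR x hx, mul_zero]
  · by_cases hx : 0 < x i₀
    · exact mul_le_mul_of_nonneg_left (hfg x hx) (cutFun_nonneg _)
    · simp only
      rw [cutFun_of_le (by nlinarith [not_lt.1 hx]), zero_mul, zero_mul]

lemma integral_cut_nonneg {k : ℝ} (hk : 0 < k) {f : Eu n → ℝ} (hf : ∀ x, 0 < x i₀ → 0 ≤ f x) :
    0 ≤ ∫ x, cutFun (k * x i₀) * f x := by
  refine integral_nonneg fun x => ?_
  by_cases hx : 0 < x i₀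
  · exact mul_nonneg (cutFun_nonneg _) (hf x hx)
  · simp only
    rw [cutFun_of_le (by nlinarith [not_lt.1 hx]), zero_mul]; rfl

lemma integral_cut_add {k R : ℝ} (hk : 0 < k) {f g : Eu n → ℝ}
    (hf : ContinuousOn f {x | 0 < x i₀}) (hg : ContinuousOn g {x | 0 < x i₀})
    (hfR : ∀ x, R ≤ ‖x‖ → f x = 0) (hgR : ∀ x, R ≤ ‖x‖ → g x = 0) :
    ∫ x, cutFun (k * x i₀) * (f x + g x) =
      (∫ x, cutFun (k * x i₀) * f x) + ∫ x, cutFun (k * x i₀) * g x := by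
  rw [← integral_add
    (integrable_of_continuous_of_zero (R := R) (continuous_cutFun_mul hk hf) ?_)
    (integrable_of_continuous_of_zero (R := R) (continuous_cutFun_mul hk hg) ?_)]
  · simp_rw [mul_add]
  · intro x hx; rw [hfR x hx, mul_zero]
  · intro x hx; rw [hgR x hx, mul_zero]

lemma integral_cut_const_mul (k c : ℝ) (f : Eu n → ℝ) :
    ∫ x, cutFun (k * x i₀) * (c * f x) = c * ∫ x, cutFun (k * x i₀) * f x := by
  rw [← integral_const_mul]
  congr 1
  funext x
  ring

end Aux

section Weight

variable {n : ℕ} (i₀ : Fin n)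

/-- The test function `exp (-K x₁ / R) (1 - |x|² / R²)₊³`. -/
noncomputable def wt (K R : ℝ) (x : Eu n) : ℝ := Real.exp (-(K / R) * x i₀) * cap R x ^ 3

variable {i₀}

lemma wt_nonneg (K R : ℝ) (x : Eu n) : 0 ≤ wt i₀ K R x :=
  mul_nonneg (Real.exp_pos _).le (pow_nonneg (cap_nonneg _ _) _)

lemma wt_eq_zero {K R : ℝ} (hR : 0 < R) {x : Eu n} (hx : R ≤ ‖x‖) : wt i₀ K R x = 0 := by
  simp [wt, cap_eq_zero hR hx]

lemma wt_le_one {K R : ℝ} (hK : 0 ≤ K) (hR : 0 < R) {x : Eu n} (hx : 0 ≤ x i₀) :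
    wt i₀ K R x ≤ 1 := by
  refine mul_le_one₀ (Real.exp_le_one_iff.2 ?_) (pow_nonneg (cap_nonneg _ _) _)
    (pow_le_one₀ (cap_nonneg _ _) (cap_le_one _ _))
  have : 0 ≤ K / R * x i₀ := by positivity
  linarith

lemma contDiff_wt (K R : ℝ) : ContDiff ℝ 2 (wt i₀ K R) := by
  have h1 : ContDiff ℝ 2 fun x : Eu n => Real.exp (-(K / R) * x i₀) := by fun_prop
  exact h1.mul (contDiff_cap_pow_three R 0)

lemma hasDerivAt_exp_line (K R : ℝ) (x : Eu n) (i : Fin n) :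
    HasDerivAt (fun τ : ℝ => Real.exp (-(K / R) * (x + τ • ev i) i₀))
      (Real.exp (-(K / R) * x i₀) * (-(K / R) * if i = i₀ then 1 else 0)) 0 := by
  have h1 : HasDerivAt (fun τ : ℝ => -(K / R) * (x + τ • ev i) i₀)
      (-(K / R) * if i = i₀ then 1 else 0) 0 := by
    have h2 : (fun τ : ℝ => -(K / R) * (x + τ • ev i) i₀) =
        fun τ => -(K / R) * (x i₀ + τ * if i = i₀ then 1 else 0) := by
      funext τ
      by_cases hi : i = i₀
      · subst hi; simp
      · simp [hi, Ne.symm hi]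
    rw [h2]
    have := (((hasDerivAt_id (0 : ℝ)).mul_const (if i = i₀ then (1 : ℝ) else 0)).const_add
      (x i₀)).const_mul (-(K / R))
    simpa using this
  simpa using h1.exp

lemma fderiv_wt (K R : ℝ) (x : Eu n) (i : Fin n) :
    fderiv ℝ (wt i₀ K R) x (ev i) = Real.exp (-(K / R) * x i₀) *
      ((-(K / R) * if i = i₀ then 1 else 0) * cap R x ^ 3 +
        3 * cap R x ^ 2 * (-(2 * x i) / R ^ 2)) := by
  refine (hasDerivAt_line_zero ((contDiff_wt K R).differentiable (by simp) x)).unique ?_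
  have h1 := (hasDerivAt_exp_line (i₀ := i₀) K R x i).mul (hasDerivAt_cap_pow_line R 1 x i)
  refine h1.congr_deriv ?_
  simp only [zero_smul, add_zero]
  push_cast
  ring

lemma fderiv_fderiv_wt (K R : ℝ) (x : Eu n) (i : Fin n) :
    fderiv ℝ (fun y => fderiv ℝ (wt i₀ K R) y (ev i)) x (ev i) =
      Real.exp (-(K / R) * x i₀) *
      ((K / R) ^ 2 * (if i = i₀ then 1 else 0) * cap R x ^ 3 +
        12 * (K / R) * (if i = i₀ then 1 else 0) * cap R x ^ 2 * x i / R ^ 2 +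
        24 * cap R x * x i ^ 2 / R ^ 4 - 6 * cap R x ^ 2 / R ^ 2) := by
  refine (hasDerivAt_line_zero
    (((contDiff_wt K R).contDiffAt.fderiv_apply_const (ev i)).differentiableAt
      (by simp))).unique ?_
  simp only [fderiv_wt]
  have h0 : HasDerivAt (fun τ : ℝ => -(2 * (x + τ • ev i) i) / R ^ 2) (-2 / R ^ 2) 0 := by
    have h2 : (fun τ : ℝ => -(2 * (x + τ • ev i) i) / R ^ 2) =
        fun τ => -(2 * (x i + τ)) / R ^ 2 := by
      funext τ; simp
    rw [h2]
    have := ((((hasDerivAt_id (0 : ℝ)).const_add (x i)).const_mul 2).neg).div_const (R ^ 2)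
    simpa using this
  have h1 := (hasDerivAt_exp_line (i₀ := i₀) K R x i).mul
    (((hasDerivAt_cap_pow_line R 1 x i).const_mul (-(K / R) * if i = i₀ then 1 else 0)).add
      (((hasDerivAt_cap_pow_line R 0 x i).const_mul 3).mul h0))
  refine h1.congr_deriv ?_
  simp only [zero_smul, add_zero, Pi.add_apply, Pi.mul_apply]
  push_cast
  split_ifs <;> ring

lemma lap_wt (K R : ℝ) (x : Eu n) :
    lap (wt i₀ K R) x = Real.exp (-(K / R) * x i₀) *
      ((K / R) ^ 2 * cap R x ^ 3 + 12 * (K / R) * cap R x ^ 2 * x i₀ / R ^ 2 +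
        24 * cap R x * ‖x‖ ^ 2 / R ^ 4 - 6 * n * cap R x ^ 2 / R ^ 2) := by
  have h1 : lap (wt i₀ K R) x = ∑ i, Real.exp (-(K / R) * x i₀) *
      ((K / R) ^ 2 * (if i = i₀ then 1 else 0) * cap R x ^ 3 +
        12 * (K / R) * (if i = i₀ then 1 else 0) * cap R x ^ 2 * x i / R ^ 2 +
        24 * cap R x * x i ^ 2 / R ^ 4 - 6 * cap R x ^ 2 / R ^ 2) :=
    Finset.sum_congr rfl fun i _ => fderiv_fderiv_wt K R x i
  rw [h1, ← Finset.mul_sum, Finset.sum_sub_distrib, Finset.sum_add_distrib,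
    Finset.sum_add_distrib, EuclideanSpace.norm_sq_eq]
  congr 1
  simp only [Real.norm_eq_abs, sq_abs, mul_ite, ite_mul, mul_one, mul_zero, zero_mul, zero_div,
    ite_div, Finset.sum_ite_eq', Finset.mem_univ, if_true, Finset.sum_const, Finset.card_univ,
    Fintype.card_fin, nsmul_eq_mul, ← Finset.sum_div, ← Finset.mul_sum]
  ring

lemma le_lap_wt {R : ℝ} (hR : 0 < R) {x : Eu n} (hx : 0 ≤ x i₀) :
    wt i₀ (4 + n) R x / R ^ 2 ≤ lap (wt i₀ (4 + n) R) x := by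
  rw [lap_wt, wt, mul_div_assoc]
  refine mul_le_mul_of_nonneg_left ?_ (Real.exp_pos _).le
  have hc := cap_nonneg R x
  have hc1 := cap_le_one R x
  have h2 := cap_mul_norm_sq R x
  set c := cap R x
  have h3 : 24 * c * ‖x‖ ^ 2 / R ^ 4 = 24 * (c * (1 - c)) / R ^ 2 := by
    rw [← h2]; field_simp
  have h4 : 0 ≤ 12 * ((4 + n : ℝ) / R) * c ^ 2 * x i₀ / R ^ 2 := by positivity
  have h5 : c ^ 3 / R ^ 2 ≤ ((4 + n : ℝ) / R) ^ 2 * c ^ 3 + 24 * (c * (1 - c)) / R ^ 2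
      - 6 * n * c ^ 2 / R ^ 2 := by
    rw [div_pow, div_mul_eq_mul_div, ← add_div, ← sub_div]
    refine div_le_div_of_nonneg_right ?_ (by positivity)
    have h6 : 0 ≤ c * ((((4 + n : ℝ)) * c - 3) ^ 2 + 14 + (1 - c) * (1 + c)) :=
      mul_nonneg hc (by have := mul_nonneg (sub_nonneg.2 hc1) (by linarith : 0 ≤ 1 + c)
                        positivity)
    nlinarith
  rw [h3]
  linarith

lemma fderiv_wt_of_bdry (K R : ℝ) {x : Eu n} (hx : x i₀ = 0) :
    fderiv ℝ (wt i₀ K R) x (ev i₀) = -(K / R) * wt i₀ K R x := by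
  rw [fderiv_wt, wt, hx]
  simp

lemma le_wt_of_norm_le {K R : ℝ} (hK : 0 ≤ K) (hR : 0 < R) {x : Eu n} (hx : ‖x‖ ≤ R) :
    Real.exp (-K / 2) * (27 / 64) ≤ wt i₀ K (2 * R) x := by
  refine mul_le_mul (Real.exp_le_exp.2 ?_) ?_ (by norm_num) (Real.exp_pos _).le
  · have h1 : x i₀ ≤ R := (le_abs_self _).trans ((PiLp.norm_apply_le x i₀).trans hx)
    have h2 : K / (2 * R) * x i₀ ≤ K / (2 * R) * R :=
      mul_le_mul_of_nonneg_left h1 (by positivity)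
    have h3 : K / (2 * R) * R = K / 2 := by field_simp
    linarith
  · have h1 : 3 / 4 ≤ cap (2 * R) x := by
      refine le_trans ?_ (le_max_left _ _)
      have : ‖x‖ ^ 2 / (2 * R) ^ 2 ≤ 1 / 4 := by
        rw [div_le_iff₀ (by positivity)]
        nlinarith [norm_nonneg x]
      linarith
    calc (27 / 64 : ℝ) = (3 / 4) ^ 3 := by norm_num
      _ ≤ _ := pow_le_pow_left₀ (by norm_num) h1 3

end Weight

namespace HalfSol

variable {n : ℕ} {i₀ : Fin n} {q M : ℝ} {u : Eu n × ℝ → ℝ}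

lemma fderiv_mul_apply {f g : Eu n → ℝ} {x : Eu n} (hf : DifferentiableAt ℝ f x)
    (hg : DifferentiableAt ℝ g x) (v : Eu n) :
    fderiv ℝ (fun y => f y * g y) x v = f x * fderiv ℝ g x v + fderiv ℝ f x v * g x := by
  rw [fderiv_fun_mul hf hg]
  simp [mul_comm]

lemma integral_cut_lap_mul (h : HalfSol i₀ q M u) {k R : ℝ} (hk : 0 < k)
    {ψ : Eu n → ℝ} (hψ : ContDiff ℝ 2 ψ) (hR : ∀ x, R ≤ ‖x‖ → ψ x = 0) (t : ℝ) :
    ∫ x, cutFun (k * x i₀) * (lap (fun y => u (y, t)) x * ψ x) =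
      (∫ x, cutFun (k * x i₀) * (u (x, t) * lap ψ x)) +
        layerInt i₀ k (fun x => u (x, t) * fderiv ℝ ψ x (ev i₀) -
          fderiv ℝ (fun y => u (y, t)) x (ev i₀) * ψ x) := by
  have hdψ : ∀ i, ContDiff ℝ 1 fun x => fderiv ℝ ψ x (ev i) := fun i =>
    contDiff_iff_contDiffAt.2 fun x => hψ.contDiffAt.fderiv_apply_const (ev i)
  have hψ1 : ContDiff ℝ 1 ψ := hψ.of_le (by norm_num)
  have hu1 : ContDiffOn ℝ 1 (fun x => u (x, t)) {x | 0 < x i₀} :=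
    (h.contDiffOn t).of_le (by norm_num)
  have hlapψ : ContinuousOn (lap ψ) {x | 0 < x i₀} :=
    continuousOn_finsetSum _ fun i _ => continuousOn_fderiv_apply (hdψ i).contDiffOn _
  have hRd : ∀ i x, R + 1 ≤ ‖x‖ → fderiv ℝ ψ x (ev i) = 0 := fun i =>
    fderiv_eq_zero_of_zero hR _
  have hRl : ∀ x, R + 1 + 1 ≤ ‖x‖ → lap ψ x = 0 := fun x hx =>
    Finset.sum_eq_zero fun i _ => fderiv_eq_zero_of_zero (hRd i) _ x hx
  have h1 := integral_cut_div (i₀ := i₀) (R := R + 1) hk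
    (f := fun i x => u (x, t) * fderiv ℝ ψ x (ev i) -
      fderiv ℝ (fun y => u (y, t)) x (ev i) * ψ x)
    (fun i => (hu1.mul (hdψ i).contDiffOn).sub ((h.contDiffOn_fderiv t i).mul hψ1.contDiffOn))
    (fun i x hx => by rw [hRd i x hx, hR x (by linarith), mul_zero, mul_zero, sub_zero])
  have h2 : ∀ x, cutFun (k * x i₀) * (lap (fun y => u (y, t)) x * ψ x) +
      cutFun (k * x i₀) * ∑ i, fderiv ℝ (fun x => u (x, t) * fderiv ℝ ψ x (ev i) -
        fderiv ℝ (fun y => u (y, t)) x (ev i) * ψ x) x (ev i) =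
      cutFun (k * x i₀) * (u (x, t) * lap ψ x) := by
    intro x
    by_cases hx : 0 < x i₀
    · rw [← mul_add]
      congr 1
      have hm := (isOpen_coord_pos i₀).mem_nhds hx
      have d1 : DifferentiableAt ℝ (fun x => u (x, t)) x :=
        (hu1.contDiffAt hm).differentiableAt (by simp)
      have d2 : DifferentiableAt ℝ ψ x := hψ1.contDiffAt.differentiableAt (by simp)
      have h3 : ∀ i, fderiv ℝ (fun x => u (x, t) * fderiv ℝ ψ x (ev i) -
          fderiv ℝ (fun y => u (y, t)) x (ev i) * ψ x) x (ev i) =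
          u (x, t) * fderiv ℝ (fun y => fderiv ℝ ψ y (ev i)) x (ev i) -
          fderiv ℝ (fun z => fderiv ℝ (fun y => u (y, t)) z (ev i)) x (ev i) * ψ x := by
        intro i
        have d3 : DifferentiableAt ℝ (fun x => fderiv ℝ ψ x (ev i)) x :=
          (hdψ i).contDiffAt.differentiableAt (by simp)
        have d4 : DifferentiableAt ℝ (fun x => fderiv ℝ (fun y => u (y, t)) x (ev i)) x :=
          ((h.contDiffOn_fderiv t i).contDiffAt hm).differentiableAt (by simp)
        rw [fderiv_fun_sub (d1.fun_mul d3) (d4.fun_mul d2), sub_apply,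
          fderiv_mul_apply d1 d3, fderiv_mul_apply d4 d2]
        ring
      simp_rw [h3]
      rw [Finset.sum_sub_distrib, ← Finset.mul_sum, ← Finset.sum_mul]
      unfold lap
      ring
    · rw [cutFun_of_le (by nlinarith [not_lt.1 hx])]
      ring
  have h3 : (∫ x, cutFun (k * x i₀) * (lap (fun y => u (y, t)) x * ψ x)) +
      (∫ x, cutFun (k * x i₀) * ∑ i, fderiv ℝ (fun x => u (x, t) * fderiv ℝ ψ x (ev i) -
        fderiv ℝ (fun y => u (y, t)) x (ev i) * ψ x) x (ev i)) =
      ∫ x, cutFun (k * x i₀) * (u (x, t) * lap ψ x) := by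
    rw [← integral_add]
    · exact integral_congr_ae (Eventually.of_forall h2)
    · refine integrable_of_continuous_of_zero (R := R) (continuous_cutFun_mul hk
        ((h.continuousOn_lap t).mul hψ.continuous.continuousOn)) fun x hx => ?_
      rw [hR x hx, mul_zero, mul_zero]
    · refine Integrable.congr (f := fun x => cutFun (k * x i₀) * (u (x, t) * lap ψ x) -
        cutFun (k * x i₀) * (lap (fun y => u (y, t)) x * ψ x)) ?_
        (Eventually.of_forall fun x => by simp only; linarith [h2 x])
      refine integrable_of_continuous_of_zero (R := R + 1 + 1) ?_ fun x hx => ?_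
      · exact (continuous_cutFun_mul hk ((h.continuousOn_slice t).mul hlapψ)).sub
          (continuous_cutFun_mul hk ((h.continuousOn_lap t).mul hψ.continuous.continuousOn))
      · rw [hRl x hx, hR x (by linarith)]
        ring
  rw [h1] at h3
  linarith

lemma continuousOn_bdry (h : HalfSol i₀ q M u) :
    ContinuousOn u ({x | x i₀ = 0} ×ˢ univ) :=
  h.cont.mono (prod_mono (fun x (hx : x i₀ = 0) => hx.ge) subset_rfl)

lemma continuousOn_bdry_rpow (h : HalfSol i₀ q M u) (hq : 0 ≤ q) :
    ContinuousOn (fun p => u p ^ q) ({x | x i₀ = 0} ×ˢ univ) :=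
  h.continuousOn_bdry.rpow_const fun _ _ => Or.inr hq

/-- Flux terms in a thin layer converge to boundary integrals. -/
lemma tendsto_integral_flux (h : HalfSol i₀ q M u) (hq : 0 ≤ q) {w : ℝ → ℝ} (hw : Continuous w)
    {R : ℝ} {φ χ : Eu n × ℝ → ℝ} (hφ : ContinuousOn φ ({x | 0 ≤ x i₀} ×ˢ univ))
    (hχ : ContinuousOn χ ({x | 0 ≤ x i₀} ×ˢ univ)) {A B : ℝ}
    (hA : ∀ x, 0 < x i₀ → ∀ t, |φ (x, t)| ≤ A) (hB : ∀ x, 0 < x i₀ → ∀ t, |χ (x, t)| ≤ B)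
    (hφR : ∀ x t, R ≤ ‖x‖ → φ (x, t) = 0) (hχR : ∀ x t, R ≤ ‖x‖ → χ (x, t) = 0) (a b : ℝ) :
    Tendsto (fun m : ℕ => ∫ t in a..b, w t * layerInt i₀ ((m : ℝ) + 1) (fun x =>
      φ (x, t) - fderiv ℝ (fun y => u (y, t)) x (ev i₀) * χ (x, t))) atTop
      (𝓝 (∫ t in a..b, w t * bdryInt i₀ (fun x => φ (x, t) + u (x, t) ^ q * χ (x, t)))) := by
  obtain ⟨L, hL0, hL⟩ := h.normal_lipschitz hq
  have hsub : {x : Eu n | 0 < x i₀} ×ˢ (univ : Set ℝ) ⊆ {x | 0 ≤ x i₀} ×ˢ univ :=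
    prod_mono (fun x (hx : 0 < x i₀) => hx.le) subset_rfl
  have hline : ∀ {g : Eu n × ℝ → ℝ}, ContinuousOn g ({x | 0 ≤ x i₀} ×ˢ univ) → ∀ x : Eu n,
      x i₀ = 0 → ∀ t, Tendsto (fun τ : ℝ => g (x + τ • ev i₀, t)) (𝓝[>] 0) (𝓝 (g (x, t))) := by
    intro g hg x hx t
    refine (hg (x, t) ⟨hx.ge, mem_univ _⟩).tendsto.comp (tendsto_nhdsWithin_iff.2 ⟨?_, ?_⟩)
    · have h2 : Continuous fun τ : ℝ => (x + τ • ev i₀, t) := by fun_prop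
      have h3 := h2.tendsto 0
      simp only [zero_smul, add_zero] at h3
      exact h3.mono_left nhdsWithin_le_nhds
    · filter_upwards [self_mem_nhdsWithin] with τ hτ
      have : (0 : ℝ) < τ := hτ
      exact ⟨by simp [hx, this.le], mem_univ _⟩
  refine tendsto_integral_layerInt (R := R) (C := A + L * B) hw
    (K := fun p => φ p - fderiv ℝ (fun y => u (y, p.2)) p.1 (ev i₀) * χ p)
    (K₀ := fun p => φ p + u p ^ q * χ p)
    ((hφ.mono hsub).sub ((h.continuousOn_fderiv i₀).mul (hχ.mono hsub))) ?_ ?_ ?_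
  · intro x hx t
    refine (abs_sub _ _).trans (add_le_add (hA x hx t) ?_)
    rw [abs_mul]
    exact mul_le_mul (h.abs_fderiv_normal_le hL hx t) (hB x hx t) (abs_nonneg _) hL0.le
  · intro x t hx
    simp [hφR x t hx, hχR x t hx]
  · intro x hx t
    have h1 := (hline hφ x hx t).sub ((h.bdry_tendsto x hx t).mul (hline hχ x hx t))
    simpa using h1

end HalfSol

lemma mul_le_half_rpow_add {q b s : ℝ} (hq : 1 < q) (hb : 0 ≤ b) (hs : 0 < s) :
    b * s ≤ s ^ q / 2 + b * (2 * b) ^ (1 / (q - 1)) := by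
  have hq1 : 0 < q - 1 := by linarith
  rcases le_total (2 * b) (s ^ (q - 1)) with h1 | h1
  · have h2 : s ^ q = s ^ (q - 1) * s := by
      rw [← Real.rpow_add_one hs.ne']; congr 1; ring
    have h3 : 0 ≤ b * (2 * b) ^ (1 / (q - 1)) := by positivity
    nlinarith
  · have h2 : s ≤ (2 * b) ^ (1 / (q - 1)) := by
      have h3 := Real.rpow_le_rpow (by positivity) h1 (one_div_nonneg.2 hq1.le)
      rwa [← Real.rpow_mul hs.le, mul_one_div_cancel hq1.ne', Real.rpow_one] at h3
    have h4 : 0 ≤ s ^ q / 2 := by positivity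
    nlinarith

lemma scale_identity {n : ℕ} {q K R : ℝ} (hK : 0 < K) (hR : 0 < R) :
    K / R * (2 * (K / R)) ^ (1 / (q - 1)) * (R ^ n / R) =
      K * (2 * K) ^ (1 / (q - 1)) * R ^ ((n : ℝ) - 1 / (q - 1) - 2) := by
  rw [← mul_div_assoc 2, Real.div_rpow (by positivity) hR.le,
    show (n : ℝ) - 1 / (q - 1) - 2 = (n : ℝ) - 1 - (1 / (q - 1)) - 1 by ring,
    Real.rpow_sub_one hR.ne', Real.rpow_sub hR, Real.rpow_sub_one hR.ne', Real.rpow_natCast]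
  field_simp

namespace HalfSol

variable {n : ℕ} {i₀ : Fin n} {q M : ℝ} {u : Eu n × ℝ → ℝ}

lemma exists_wt_estimate (h : HalfSol i₀ q M u) (hq : 1 < q) : ∃ C > 0, ∀ R > 0,
    (∀ k > 0, ∀ t, ∫ x, cutFun (k * x i₀) * (u (x, t) * wt i₀ (4 + n) R x) ≤
      C * R ^ ((n : ℝ) - 1 / (q - 1) - 2) * R ^ 2) ∧
    ∀ a b, a ≤ b → ∫ t in a..b, bdryInt i₀ (fun x => u (x, t) ^ q * wt i₀ (4 + n) R x) ≤
      C * R ^ ((n : ℝ) - 1 / (q - 1) - 2) * (R ^ 2 + (b - a)) := by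
  obtain ⟨D, hD0, hD⟩ := exists_abs_bdryInt_le i₀
  set K : ℝ := 4 + n with hK
  have hK0 : 0 < K := by positivity
  have hq0 : 0 ≤ q := by linarith
  have hM := h.M_pos
  refine ⟨2 * (D * (K * (2 * K) ^ (1 / (q - 1)))), by positivity, fun R hR => ?_⟩
  set S := R ^ ((n : ℝ) - 1 / (q - 1) - 2) with hS
  set E := D * (K * (2 * K) ^ (1 / (q - 1))) * S with hE
  have hE0 : 0 < E := by positivity
  set ψ : Eu n → ℝ := wt i₀ K R with hψ
  have hψ0 : ∀ x, 0 ≤ ψ x := wt_nonneg K R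
  have hψc : Continuous ψ := (contDiff_wt K R).continuous
  have hψR : ∀ x, R ≤ ‖x‖ → ψ x = 0 := fun x hx => wt_eq_zero hR hx
  have hdψc : Continuous fun x => fderiv ℝ ψ x (ev i₀) :=
    ((contDiff_wt K R).continuous_fderiv (by simp)).clm_apply continuous_const
  have hdψR : ∀ x, R + 1 ≤ ‖x‖ → fderiv ℝ ψ x (ev i₀) = 0 := fderiv_eq_zero_of_zero hψR _
  obtain ⟨A, hA⟩ : ∃ A, ∀ x, |fderiv ℝ ψ x (ev i₀)| ≤ A :=
    hdψc.bounded_above_of_compact_support (HasCompactSupport.intro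
      (isCompact_closedBall (0 : Eu n) (R + 1)) fun x hx => hdψR x (by
        rw [mem_closedBall_zero_iff, not_le] at hx; exact hx.le))
  have hupos : ∀ x : Eu n, 0 ≤ x i₀ → ∀ t, 0 < u (x, t) := h.pos
  set P : ℝ → ℝ → ℝ := fun k t => layerInt i₀ k (fun x => u (x, t) * fderiv ℝ ψ x (ev i₀) -
          fderiv ℝ (fun y => u (y, t)) x (ev i₀) * ψ x) with hP
  have hPc : ∀ k > 0, Continuous (P k) := by
    intro k hk
    refine continuous_integral_param (R := R + 1)
      (F := fun p : Eu n × ℝ => k * cutDeriv (k * p.1 i₀) * (u p * fderiv ℝ ψ p.1 (ev i₀) -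
          fderiv ℝ (fun y => u (y, p.2)) p.1 (ev i₀) * ψ p.1)) ?_ fun x t hx => ?_
    · refine continuous_cutDeriv_mul_prod hk ((h.continuousOn_pos.mul
        (hdψc.comp continuous_fst).continuousOn).sub
        ((h.continuousOn_fderiv i₀).mul (hψc.comp continuous_fst).continuousOn))
    · simp only
      rw [hdψR x hx, hψR x (by linarith)]
      ring
  set y : ℝ → ℝ → ℝ := fun k t => ∫ x, cutFun (k * x i₀) * (u (x, t) * ψ x) with hy
  have hslice : ∀ t, ContinuousOn (fun x => u (x, t) * ψ x) {x | 0 < x i₀} := fun t =>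
    (h.continuousOn_slice t).mul hψc.continuousOn
  have hy0 : ∀ k > 0, ∀ t, 0 ≤ y k t := fun k hk t =>
    integral_cut_nonneg hk fun x hx => mul_nonneg (hupos x hx.le t).le (hψ0 x)
  obtain ⟨V, hV0, hV⟩ : ∃ V, 0 ≤ V ∧ ∀ k > 0, ∀ t, y k t ≤ V := by
    refine ⟨∫ x, M * ψ x, integral_nonneg fun x => mul_nonneg hM.le (hψ0 x), fun k hk t => ?_⟩
    refine integral_mono (integrable_of_continuous_of_zero (R := R)
      (continuous_cutFun_mul hk (hslice t)) fun x hx => by rw [hψR x hx]; ring)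
      (integrable_of_continuous_of_zero (R := R) (by fun_prop) fun x hx => by
        rw [hψR x hx]; ring) fun x => ?_
    by_cases hx : 0 < x i₀
    · exact (mul_le_of_le_one_left (mul_nonneg (hupos x hx.le t).le (hψ0 x))
        (cutFun_le_one _)).trans (mul_le_mul_of_nonneg_right (h.le x hx.le t) (hψ0 x))
    · simp only
      rw [cutFun_of_le (by nlinarith [not_lt.1 hx]), zero_mul]
      exact mul_nonneg hM.le (hψ0 x)
  have hderiv : ∀ k > 0, ∀ t, ∃ d, HasDerivAt (y k) d t ∧ y k t / R ^ 2 + P k t ≤ d := by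
    intro k hk t
    refine ⟨_, h.hasDerivAt_cut_integral hq0 hk (Φ := id) (Φ' := fun _ => 1) hasDerivAt_id
      continuous_const hψc hψR t, ?_⟩
    simp only [one_mul]
    rw [h.integral_cut_lap_mul hk (contDiff_wt K R) hψR t]
    refine add_le_add_left ?_ _
    have hRd : ∀ i x, R + 1 ≤ ‖x‖ → fderiv ℝ ψ x (ev i) = 0 := fun i =>
      fderiv_eq_zero_of_zero hψR _
    have hlap : ContinuousOn (lap ψ) {x | 0 < x i₀} :=
      continuousOn_finsetSum _ fun i _ => continuousOn_fderiv_apply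
        (fun x _ => ((contDiff_wt K R).contDiffAt.fderiv_apply_const
          (ev i)).contDiffWithinAt) _
    have h1 := integral_cut_mono (i₀ := i₀) (R := R + 1 + 1) hk
      (f := fun x => (R ^ 2)⁻¹ * (u (x, t) * ψ x)) (g := fun x => u (x, t) * lap ψ x)
      (continuousOn_const.mul (hslice t)) ((h.continuousOn_slice t).mul hlap)
      (fun x hx => by rw [hψR x (by linarith)]; ring)
      (fun x hx => by
        rw [show lap ψ x = 0 from Finset.sum_eq_zero fun i _ =>
          fderiv_eq_zero_of_zero (hRd i) _ x hx, mul_zero])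
      (fun x hx => by
        have := mul_le_mul_of_nonneg_left (le_lap_wt hR hx.le) (hupos x hx.le t).le
        refine le_trans (le_of_eq ?_) this
        rw [← hK]
        ring)
    rw [integral_cut_const_mul] at h1
    rw [div_eq_inv_mul]
    exact h1
  choose! y' hy' hy'le using hderiv
  set B : ℝ → ℝ := fun t => bdryInt i₀ (fun x => u (x, t) * fderiv ℝ ψ x (ev i₀) +
    u (x, t) ^ q * ψ x) with hB
  set Bq : ℝ → ℝ := fun t => bdryInt i₀ (fun x => u (x, t) ^ q * ψ x) with hBq
  have hψfst : ContinuousOn (fun p : Eu n × ℝ => ψ p.1) ({x | x i₀ = 0} ×ˢ univ) :=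
    (hψc.comp continuous_fst).continuousOn
  have hBc : Continuous B := by
    refine continuous_bdryInt_param (R := R + 1)
      (g := fun p => u p * fderiv ℝ ψ p.1 (ev i₀) + u p ^ q * ψ p.1)
      ((h.continuousOn_bdry.mul (hdψc.comp continuous_fst).continuousOn).add
        ((h.continuousOn_bdry_rpow hq0).mul hψfst)) fun x t hx => ?_
    rw [hdψR x hx, hψR x (by linarith)]; ring
  have hBqc : Continuous Bq := by
    refine continuous_bdryInt_param (R := R) (g := fun p => u p ^ q * ψ p.1)
      ((h.continuousOn_bdry_rpow hq0).mul hψfst) fun x t hx => ?_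
    rw [hψR x hx]; ring
  have hBq0 : ∀ t, 0 ≤ Bq t := fun t => bdryInt_nonneg fun x hx =>
    mul_nonneg (Real.rpow_nonneg (hupos x hx.ge t).le _) (hψ0 x)
  have hBE : ∀ t, Bq t / 2 - E ≤ B t := by
    intro t
    set e := K / R * (2 * (K / R)) ^ (1 / (q - 1)) with he
    have he0 : 0 ≤ e := by positivity
    have h1 : |bdryInt i₀ fun x => e * ψ x| ≤ E := by
      refine (hD R hR e he0 _ (fun x hx => ?_) fun x hx => by rw [hψR x hx, mul_zero]).trans_eq ?_
      · rw [abs_of_nonneg (mul_nonneg he0 (hψ0 x))]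
        exact mul_le_of_le_one_right he0 (wt_le_one hK0.le hR hx.ge)
      · rw [mul_assoc, scale_identity hK0 hR, hE]
        ring
    have hc1 : ContinuousOn (fun x => u (x, t) ^ q * ψ x) {x | x i₀ = 0} :=
      ((h.continuousOn_bdry_rpow hq0).mul hψfst).comp (f := fun x => (x, t)) (by fun_prop)
        fun x hx => ⟨hx, mem_univ _⟩
    have hc2 : ContinuousOn (fun x => u (x, t) * fderiv ℝ ψ x (ev i₀) + u (x, t) ^ q * ψ x)
        {x | x i₀ = 0} :=
      (((h.continuousOn_bdry.mul (hdψc.comp continuous_fst).continuousOn).add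
        ((h.continuousOn_bdry_rpow hq0).mul hψfst))).comp (f := fun x => (x, t)) (by fun_prop)
        fun x hx => ⟨hx, mem_univ _⟩
    have h2 : (1 / 2) * Bq t - bdryInt i₀ (fun x => e * ψ x) ≤ B t := by
      rw [hBq, ← bdryInt_const_mul, ← bdryInt_sub (R := R)]
      · refine bdryInt_mono (R := R + 1) ?_ ?_ hc2 ?_ ?_
        · exact (continuousOn_const.mul hc1).sub (continuous_const.mul hψc).continuousOn
        · intro x hx; rw [hψR x (by linarith)]; ring
        · intro x hx; rw [hψR x (by linarith), hdψR x hx]; ring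
        · intro x hx
          rw [fderiv_wt_of_bdry K R hx]
          have h3 := mul_le_half_rpow_add hq (b := K / R) (by positivity) (hupos x hx.ge t)
          have h4 := mul_le_mul_of_nonneg_right h3 (hψ0 x)
          rw [← he] at h4
          change _ ≤ u (x, t) * (-(K / R) * ψ x) + _
          linarith
      · exact continuousOn_const.mul hc1
      · intro x hx; rw [hψR x hx]; ring
      · exact (continuous_const.mul hψc).continuousOn
      · intro x hx; rw [hψR x hx]; ring
    have := abs_le.1 h1
    linarith
  have hlim : ∀ {w : ℝ → ℝ}, Continuous w → ∀ a b, Tendsto (fun m : ℕ =>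
      ∫ t in a..b, w t * P ((m : ℝ) + 1) t) atTop (𝓝 (∫ t in a..b, w t * B t)) := by
    intro w hw a b
    refine h.tendsto_integral_flux hq0 hw (R := R + 1) (A := M * A) (B := 1)
      (φ := fun p => u p * fderiv ℝ ψ p.1 (ev i₀)) (χ := fun p => ψ p.1)
      (h.cont.mul (hdψc.comp continuous_fst).continuousOn)
      (hψc.comp continuous_fst).continuousOn (fun x hx t => ?_) (fun x hx t => ?_)
      (fun x t hx => ?_) (fun x t hx => ?_) a b
    · simp only
      rw [abs_mul, abs_of_pos (hupos x hx.le t)]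
      exact mul_le_mul (h.le x hx.le t) (hA x) (abs_nonneg _) hM.le
    · simp only
      rw [abs_of_nonneg (hψ0 x)]
      exact wt_le_one hK0.le hR hx.le
    · simp only
      rw [hdψR x hx, mul_zero]
    · exact hψR x (by linarith)
  have hm : ∀ m : ℕ, (0 : ℝ) < (m : ℝ) + 1 := fun m => by positivity
  have hyE : ∀ k > 0, ∀ t, y k t ≤ E * R ^ 2 := by
    intro k hk a
    set w : ℝ → ℝ := fun s => Real.exp (-(s / R ^ 2)) with hw
    have hwc : Continuous w := by fun_prop
    have hw0 : ∀ s, 0 < w s := fun s => Real.exp_pos _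
    have hwd : ∀ s, HasDerivAt w (-(w s / R ^ 2)) s := by
      intro s
      have h1 := (((hasDerivAt_id s).div_const (R ^ 2)).neg).exp
      refine h1.congr_deriv ?_
      simp only [hw, id, Pi.neg_apply]
      ring
    have hmain : ∀ b ≥ a, w a * y k a ≤ w b * V + E * R ^ 2 * (w a - w b) := by
      intro b hab
      have h1 : -∫ t in a..b, w t * B t ≤ E * R ^ 2 * (w a - w b) := by
        rw [← intervalIntegral.integral_neg]
        have h2 := integral_le_sub_of_hasDerivAt (y := fun s => -(E * R ^ 2 * w s))
          (y' := fun s => E * w s) (P := fun s => -(w s * B s)) (fun s => ?_)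
          (hwc.mul hBc).neg (fun s => ?_) hab
        · linarith
        · refine (((hwd s).const_mul (E * R ^ 2)).neg).congr_deriv ?_
          field_simp
        · have := mul_le_mul_of_nonneg_left (hBE s) (hw0 s).le
          have h3 := mul_nonneg (hw0 s).le (hBq0 s)
          linarith
      have h2 : w a * y k a - w b * V ≤ -∫ t in a..b, w t * B t := by
        refine ge_of_tendsto (hlim hwc a b).neg ?_
        obtain ⟨N, hN⟩ := exists_nat_ge k
        filter_upwards [eventually_ge_atTop N] with m hmN
        have hkm : k ≤ (m : ℝ) + 1 := hN.trans (by
          have : (N : ℝ) ≤ m := by exact_mod_cast hmN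
          linarith)
        have h3 : y k a ≤ y ((m : ℝ) + 1) a := by
          refine integral_mono (integrable_of_continuous_of_zero (R := R)
            (continuous_cutFun_mul hk (hslice a)) fun x hx => by rw [hψR x hx]; ring)
            (integrable_of_continuous_of_zero (R := R)
            (continuous_cutFun_mul (hm m) (hslice a)) fun x hx => by rw [hψR x hx]; ring)
            fun x => ?_
          by_cases hx : 0 < x i₀
          · exact mul_le_mul_of_nonneg_right
              (cutFun_monotone (mul_le_mul_of_nonneg_right hkm hx.le))
              (mul_nonneg (hupos x hx.le a).le (hψ0 x))
          · simp only
            rw [cutFun_of_le (by nlinarith [not_lt.1 hx]),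
              cutFun_of_le (by nlinarith [not_lt.1 hx, hm m])]
        have h4 := integral_le_sub_of_hasDerivAt (y := fun s => w s * y ((m : ℝ) + 1) s)
          (P := fun s => w s * P ((m : ℝ) + 1) s)
          (fun s => (hwd s).mul (hy' _ (hm m) s)) (hwc.mul (hPc _ (hm m))) (fun s => ?_) hab
        · have h5 := mul_le_mul_of_nonneg_left h3 (hw0 a).le
          have h6 := mul_le_mul_of_nonneg_left (hV _ (hm m) b) (hw0 b).le
          linarith
        · have h5 := mul_le_mul_of_nonneg_left (hy'le _ (hm m) s) (hw0 s).le
          have h6 : w s * (y ((m : ℝ) + 1) s / R ^ 2) =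
            w s / R ^ 2 * y ((m : ℝ) + 1) s := by ring
          linarith
      linarith
    have hwlim : Tendsto w atTop (𝓝 0) := by
      refine Real.tendsto_exp_neg_atTop_nhds_zero.comp ?_
      exact tendsto_id.atTop_div_const (by positivity)
    have h1 : Tendsto (fun b => w b * V + E * R ^ 2 * (w a - w b)) atTop
        (𝓝 (0 * V + E * R ^ 2 * (w a - 0))) :=
      (hwlim.mul_const V).add ((hwlim.const_sub (w a)).const_mul _)
    have h2 := ge_of_tendsto h1 ((eventually_ge_atTop a).mono hmain)
    have h3 : w a * y k a ≤ w a * (E * R ^ 2) := by linarith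
    exact le_of_mul_le_mul_left h3 (hw0 a)
  refine ⟨fun k hk t => (hyE k hk t).trans ?_, fun a b hab => ?_⟩
  · have h1 : 0 ≤ E * R ^ 2 := by positivity
    have h2 : 2 * (D * (K * (2 * K) ^ (1 / (q - 1)))) * S * R ^ 2 = 2 * (E * R ^ 2) := by
      rw [hE]; ring
    linarith
  have h1 : ∫ t in a..b, B t ≤ E * R ^ 2 := by
    have h2 := hlim (w := fun _ => 1) continuous_const a b
    simp only [one_mul] at h2
    refine le_of_tendsto h2 (Eventually.of_forall fun m => ?_)
    have h3 := integral_le_sub_of_hasDerivAt (hy' _ (hm m)) (hPc _ (hm m)) (fun s => ?_) hab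
    · have h4 := hyE _ (hm m) b
      have h5 := hy0 _ (hm m) a
      linarith
    · have h4 := hy'le _ (hm m) s
      have h5 : 0 ≤ y ((m : ℝ) + 1) s / R ^ 2 := div_nonneg (hy0 _ (hm m) s) (by positivity)
      linarith
  have h2 : ∫ t in a..b, (Bq t / 2 - E) ≤ ∫ t in a..b, B t :=
    intervalIntegral.integral_mono_on hab
      ((hBqc.div_const 2).sub continuous_const |>.intervalIntegrable _ _)
      (hBc.intervalIntegrable _ _) fun t _ => hBE t
  rw [intervalIntegral.integral_sub ((hBqc.div_const 2).intervalIntegrable _ _)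
    (continuous_const.intervalIntegrable _ _), intervalIntegral.integral_div,
    intervalIntegral.integral_const, smul_eq_mul] at h2
  have h3 : 2 * (D * (K * (2 * K) ^ (1 / (q - 1)))) * S * (R ^ 2 + (b - a)) =
      2 * (E * R ^ 2 + (b - a) * E) := by
    rw [hE]; ring
  rw [h3]
  linarith

end HalfSol

namespace HalfSol

variable {n : ℕ} {i₀ : Fin n} {q M : ℝ} {u : Eu n × ℝ → ℝ}

lemma exists_ball_estimate (h : HalfSol i₀ q M u) (hq : 1 < q) : ∃ C > 0, ∀ R > 0,
    ∀ ζ : Eu n → ℝ, Continuous ζ → (∀ x, 0 ≤ ζ x) → (∀ x, ζ x ≤ 1) → (∀ x, R ≤ ‖x‖ → ζ x = 0) →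
    (∀ k > 0, ∀ t, ∫ x, cutFun (k * x i₀) * (u (x, t) * ζ x) ≤
      C * R ^ ((n : ℝ) - 1 / (q - 1) - 2) * R ^ 2) ∧
    ∀ a b, a ≤ b → ∫ t in a..b, bdryInt i₀ (fun x => u (x, t) ^ q * ζ x) ≤
      C * R ^ ((n : ℝ) - 1 / (q - 1) - 2) * (R ^ 2 + (b - a)) := by
  obtain ⟨C, hC0, hC⟩ := h.exists_wt_estimate hq
  have hq0 : 0 ≤ q := by linarith
  set e := (n : ℝ) - 1 / (q - 1) - 2 with he
  set c := Real.exp (-(4 + n : ℝ) / 2) * (27 / 64) with hc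
  have hc0 : 0 < c := by positivity
  refine ⟨c⁻¹ * C * 2 ^ e * 4, by positivity, fun R hR ζ hζ hζ0 hζ1 hζR => ?_⟩
  obtain ⟨h1, h2⟩ := hC (2 * R) (by positivity)
  rw [Real.mul_rpow zero_le_two hR.le] at h1 h2
  set ψ : Eu n → ℝ := wt i₀ (4 + n) (2 * R) with hψ
  have hψc : Continuous ψ := (contDiff_wt _ _).continuous
  have hψR : ∀ x, 2 * R ≤ ‖x‖ → ψ x = 0 := fun x hx => wt_eq_zero (by positivity) hx
  have hle : ∀ x, ζ x ≤ c⁻¹ * ψ x := by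
    intro x
    rcases le_total ‖x‖ R with hx | hx
    · have h3 := le_wt_of_norm_le (i₀ := i₀) (K := 4 + n) (by positivity) hR hx
      rw [← div_eq_inv_mul, le_div_iff₀ hc0]
      have h4 := hζ1 x
      have h5 : ζ x * c ≤ 1 * c := mul_le_mul_of_nonneg_right h4 hc0.le
      exact h5.trans (by rw [one_mul]; exact h3)
    · rw [hζR x hx]
      exact mul_nonneg (by positivity) (wt_nonneg _ _ _)
  refine ⟨fun k hk t => ?_, fun a b hab => ?_⟩
  · have h3 := integral_cut_mono (i₀ := i₀) (R := 2 * R) hk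
      (f := fun x => u (x, t) * ζ x) (g := fun x => c⁻¹ * (u (x, t) * ψ x))
      ((h.continuousOn_slice t).mul hζ.continuousOn)
      (continuousOn_const.mul ((h.continuousOn_slice t).mul hψc.continuousOn))
      (fun x hx => by rw [hζR x (by linarith), mul_zero])
      (fun x hx => by rw [hψR x hx]; ring)
      (fun x hx => by
        have := mul_le_mul_of_nonneg_left (hle x) (h.pos x hx.le t).le
        linarith)
    rw [integral_cut_const_mul] at h3
    have h4 := mul_le_mul_of_nonneg_left (h1 k hk t) (inv_nonneg.2 hc0.le)
    refine h3.trans (h4.trans_eq ?_)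
    ring
  · have hcont : ∀ {g : Eu n → ℝ}, Continuous g → ContinuousOn
        (fun p : Eu n × ℝ => u p ^ q * g p.1) ({x | x i₀ = 0} ×ˢ univ) := fun hg =>
      (h.continuousOn_bdry_rpow hq0).mul (hg.comp continuous_fst).continuousOn
    have hslice : ∀ {g : Eu n → ℝ}, Continuous g → ∀ t, ContinuousOn
        (fun x : Eu n => u (x, t) ^ q * g x) {x | x i₀ = 0} := fun hg t =>
      (hcont hg).comp (f := fun x => (x, t)) (by fun_prop) fun x hx => ⟨hx, mem_univ _⟩
    have hc1 : Continuous fun t => bdryInt i₀ fun x => u (x, t) ^ q * ζ x :=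
      continuous_bdryInt_param (R := R) (g := fun p => u p ^ q * ζ p.1) (hcont hζ)
        fun x t hx => by rw [hζR x hx, mul_zero]
    have hc2 : Continuous fun t => bdryInt i₀ fun x => u (x, t) ^ q * ψ x :=
      continuous_bdryInt_param (R := 2 * R) (g := fun p => u p ^ q * ψ p.1) (hcont hψc)
        fun x t hx => by rw [hψR x hx, mul_zero]
    have h3 : ∫ t in a..b, bdryInt i₀ (fun x => u (x, t) ^ q * ζ x) ≤
        ∫ t in a..b, c⁻¹ * bdryInt i₀ (fun x => u (x, t) ^ q * ψ x) := by
      refine intervalIntegral.integral_mono_on hab (hc1.intervalIntegrable _ _)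
        ((hc2.const_mul _).intervalIntegrable _ _) fun t _ => ?_
      rw [← bdryInt_const_mul]
      refine bdryInt_mono (R := 2 * R) (hslice hζ t)
        (fun x hx => by rw [hζR x (by linarith), mul_zero])
        (continuousOn_const.mul (hslice hψc t)) (fun x hx => by rw [hψR x hx]; ring)
        fun x hx => ?_
      have := mul_le_mul_of_nonneg_left (hle x) (Real.rpow_nonneg (h.pos x hx.ge t).le q)
      linarith
    rw [intervalIntegral.integral_const_mul] at h3
    have h4 := mul_le_mul_of_nonneg_left (h2 a b hab) (inv_nonneg.2 hc0.le)
    refine h3.trans (h4.trans ?_)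
    have h5 : (2 * R) ^ 2 + (b - a) ≤ 4 * (R ^ 2 + (b - a)) := by nlinarith
    have h6 := mul_le_mul_of_nonneg_left h5
      (show 0 ≤ c⁻¹ * C * 2 ^ e * R ^ e by positivity)
    linarith

/-- The squared norm of the spatial gradient. -/
noncomputable def gradSq (u : Eu n × ℝ → ℝ) (p : Eu n × ℝ) : ℝ :=
  ∑ i, fderiv ℝ (fun y => u (y, p.2)) p.1 (ev i) ^ 2

lemma gradSq_nonneg (u : Eu n × ℝ → ℝ) (p : Eu n × ℝ) : 0 ≤ gradSq u p :=
  Finset.sum_nonneg fun _ _ => sq_nonneg _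

lemma continuousOn_gradSq (h : HalfSol i₀ q M u) :
    ContinuousOn (gradSq u) ({x | 0 < x i₀} ×ˢ univ) :=
  continuousOn_finsetSum _ fun i _ => (h.continuousOn_fderiv i).pow 2

lemma continuousOn_gradSq_slice (h : HalfSol i₀ q M u) (t : ℝ) :
    ContinuousOn (fun x => gradSq u (x, t)) {x | 0 < x i₀} :=
  h.continuousOn_gradSq.comp (f := fun x => (x, t)) (by fun_prop) fun x hx => ⟨hx, mem_univ _⟩

lemma integral_cut_mul_lap (h : HalfSol i₀ q M u) {k R : ℝ} (hk : 0 < k)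
    {φ : Eu n → ℝ} (hφ : ContDiff ℝ 1 φ) (hR : ∀ x, R ≤ ‖x‖ → φ x = 0) (t : ℝ) :
    ∫ x, cutFun (k * x i₀) * (u (x, t) * lap (fun y => u (y, t)) x * φ x) =
      (∫ x, cutFun (k * x i₀) * (-(gradSq u (x, t) * φ x) -
        ∑ i, u (x, t) * fderiv ℝ (fun y => u (y, t)) x (ev i) * fderiv ℝ φ x (ev i))) -
        layerInt i₀ k (fun x => fderiv ℝ (fun y => u (y, t)) x (ev i₀) * (u (x, t) * φ x)) := by
  have hu1 : ContDiffOn ℝ 1 (fun x => u (x, t)) {x | 0 < x i₀} :=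
    (h.contDiffOn t).of_le (by norm_num)
  have hdφ : ∀ i, Continuous fun x => fderiv ℝ φ x (ev i) := fun i =>
    (hφ.continuous_fderiv (by simp)).clm_apply continuous_const
  have hRd : ∀ i x, R + 1 ≤ ‖x‖ → fderiv ℝ φ x (ev i) = 0 := fun i =>
    fderiv_eq_zero_of_zero hR _
  have h1 := integral_cut_div (i₀ := i₀) (R := R) hk
    (f := fun i x => fderiv ℝ (fun y => u (y, t)) x (ev i) * (u (x, t) * φ x))
    (fun i => (h.contDiffOn_fderiv t i).mul (hu1.mul hφ.contDiffOn))
    (fun i x hx => by rw [hR x hx, mul_zero, mul_zero])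
  rw [sub_eq_add_neg, ← h1, ← integral_add]
  · refine integral_congr_ae (Eventually.of_forall fun x => ?_)
    simp only
    by_cases hx : 0 < x i₀
    · rw [← mul_add]
      congr 1
      have hm := (isOpen_coord_pos i₀).mem_nhds hx
      have d1 : DifferentiableAt ℝ (fun x => u (x, t)) x :=
        (hu1.contDiffAt hm).differentiableAt (by simp)
      have d2 : DifferentiableAt ℝ φ x := hφ.contDiffAt.differentiableAt (by simp)
      have h3 : ∀ i, fderiv ℝ (fun x => fderiv ℝ (fun y => u (y, t)) x (ev i) *
          (u (x, t) * φ x)) x (ev i) =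
          fderiv ℝ (fun y => u (y, t)) x (ev i) ^ 2 * φ x +
          u (x, t) * fderiv ℝ (fun y => u (y, t)) x (ev i) * fderiv ℝ φ x (ev i) +
          fderiv ℝ (fun z => fderiv ℝ (fun y => u (y, t)) z (ev i)) x (ev i) *
            (u (x, t) * φ x) := by
        intro i
        have d4 : DifferentiableAt ℝ (fun x => fderiv ℝ (fun y => u (y, t)) x (ev i)) x :=
          ((h.contDiffOn_fderiv t i).contDiffAt hm).differentiableAt (by simp)
        rw [fderiv_mul_apply d4 (d1.fun_mul d2), fderiv_mul_apply d1 d2]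
        ring
      simp_rw [h3]
      rw [Finset.sum_add_distrib, Finset.sum_add_distrib, ← Finset.sum_mul, ← Finset.sum_mul]
      unfold lap gradSq
      ring
    · rw [cutFun_of_le (by nlinarith [not_lt.1 hx])]
      ring
  · refine integrable_of_continuous_of_zero (R := R + 1) (continuous_cutFun_mul hk
      (((h.continuousOn_gradSq_slice t).mul hφ.continuous.continuousOn).neg.sub
      (continuousOn_finsetSum _ fun i _ => ((h.continuousOn_slice t).mul
        (continuousOn_fderiv_apply hu1 _)).mul (hdφ i).continuousOn))) fun x hx => ?_
    rw [hR x (by linarith), Finset.sum_eq_zero fun i _ => by rw [hRd i x hx, mul_zero]]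
    ring
  · refine integrable_of_continuous_of_zero (R := R + 1) (continuous_cutFun_mul hk
      (continuousOn_finsetSum _ fun i _ => continuousOn_fderiv_apply
        ((h.contDiffOn_fderiv t i).mul (hu1.mul hφ.contDiffOn)) _)) fun x hx => ?_
    rw [Finset.sum_eq_zero fun i _ => fderiv_eq_zero_of_zero (R := R)
      (fun x hx => by simp [hR x hx]) (ev i) x hx, mul_zero]

end HalfSol

namespace HalfSol

variable {n : ℕ} {i₀ : Fin n} {q M : ℝ} {u : Eu n × ℝ → ℝ}

lemma grad_cross_le (h : HalfSol i₀ q M u) {R : ℝ} {x : Eu n} (hx : 0 < x i₀)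
    (t : ℝ) : -(gradSq u (x, t) * cap R x ^ 4) -
      ∑ i, u (x, t) * fderiv ℝ (fun y => u (y, t)) x (ev i) *
        fderiv ℝ (fun x => cap R x ^ 4) x (ev i) ≤
      -(1 / 2) * (gradSq u (x, t) * cap R x ^ 4) + 32 * M / R ^ 2 * (u (x, t) * cap R x) := by
  have hd : ∀ i, fderiv ℝ (fun x : Eu n => cap R x ^ 4) x (ev i) =
      4 * cap R x ^ 3 * (-(2 * x i) / R ^ 2) := by
    intro i
    have := fderiv_cap_pow R 2 x i
    push_cast at this
    rw [this]
    norm_num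
  simp_rw [hd]
  have h1 : -∑ i, u (x, t) * fderiv ℝ (fun y => u (y, t)) x (ev i) *
      (4 * cap R x ^ 3 * (-(2 * x i) / R ^ 2)) ≤
      ∑ i, (1 / 2 * cap R x ^ 4 * fderiv ℝ (fun y => u (y, t)) x (ev i) ^ 2 +
        32 * u (x, t) ^ 2 * cap R x ^ 2 / R ^ 4 * x i ^ 2) := by
    rw [← Finset.sum_neg_distrib]
    refine Finset.sum_le_sum fun i _ => ?_
    have h2 := sq_nonneg (cap R x ^ 2 * fderiv ℝ (fun y => u (y, t)) x (ev i) -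
      8 * u (x, t) * cap R x / R ^ 2 * x i)
    have h3 : (cap R x ^ 2 * fderiv ℝ (fun y => u (y, t)) x (ev i) -
      8 * u (x, t) * cap R x / R ^ 2 * x i) ^ 2 = 2 * (
        (1 / 2 * cap R x ^ 4 * fderiv ℝ (fun y => u (y, t)) x (ev i) ^ 2 +
        32 * u (x, t) ^ 2 * cap R x ^ 2 / R ^ 4 * x i ^ 2) - -(u (x, t) *
          fderiv ℝ (fun y => u (y, t)) x (ev i) *
          (4 * cap R x ^ 3 * (-(2 * x i) / R ^ 2)))) := by ring
    linarith
  rw [Finset.sum_add_distrib, ← Finset.mul_sum, ← Finset.mul_sum] at h1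
  have h2 : ∑ i, x i ^ 2 = ‖x‖ ^ 2 := by
    rw [EuclideanSpace.norm_sq_eq]
    simp
  rw [h2] at h1
  have h3 : 32 * u (x, t) ^ 2 * cap R x ^ 2 / R ^ 4 * ‖x‖ ^ 2 =
      32 / R ^ 2 * (u (x, t) ^ 2 * (cap R x * (cap R x * (1 - cap R x)))) := by
    rw [← cap_mul_norm_sq R x]
    by_cases hR : R = 0
    · simp [hR]
    · field_simp
  have hu0 := h.pos x hx.le t
  have hc0 := cap_nonneg R x
  have hc1 := cap_le_one R x
  have h4 : u (x, t) ^ 2 * (cap R x * (cap R x * (1 - cap R x))) ≤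
      M * u (x, t) * cap R x := by
    have h5 : u (x, t) ^ 2 ≤ M * u (x, t) := by nlinarith [h.le x hx.le t]
    have h6 : cap R x * (cap R x * (1 - cap R x)) ≤ cap R x :=
      mul_le_of_le_one_right hc0 (mul_le_one₀ hc1 (by linarith) (by linarith))
    exact mul_le_mul h5 h6 (mul_nonneg hc0 (mul_nonneg hc0 (by linarith)))
      (mul_nonneg h.M_pos.le hu0.le)
  have h5 := mul_le_mul_of_nonneg_left h4 (show 0 ≤ 32 / R ^ 2 by positivity)
  rw [h3] at h1
  have h6 : 32 / R ^ 2 * (M * u (x, t) * cap R x) = 32 * M / R ^ 2 * (u (x, t) * cap R x) := by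
    ring
  unfold gradSq at *
  linarith

lemma exists_grad_estimate (h : HalfSol i₀ q M u) (hq : 1 < q) : ∃ C > 0, ∀ R > 0, ∀ a b, a ≤ b →
    ∀ᶠ m : ℕ in atTop, ∫ t in a..b, (∫ x, cutFun (((m : ℝ) + 1) * x i₀) *
      (gradSq u (x, t) * cap R x ^ 4)) ≤
      C * R ^ ((n : ℝ) - 1 / (q - 1) - 2) * (R ^ 2 + (b - a)) := by
  obtain ⟨C, hC0, hC⟩ := h.exists_ball_estimate hq
  have hq0 : 0 ≤ q := by linarith
  have hM := h.M_pos
  set e := (n : ℝ) - 1 / (q - 1) - 2 with he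
  refine ⟨2 * (M * C + 32 * M * C + M * C + 1), by positivity, fun R hR a b hab => ?_⟩
  obtain ⟨hZ, hB⟩ := hC R hR (cap R) (continuous_cap R) (cap_nonneg R) (cap_le_one R)
    fun x hx => cap_eq_zero hR hx
  set S := R ^ e with hS
  have hS0 : 0 < S := by positivity
  have hcc := continuous_cap (n := n) R
  set φ : Eu n → ℝ := fun x => cap R x ^ 4 with hφ
  have hφ1 : ContDiff ℝ 1 φ := contDiff_cap_pow_two R 2
  have hφc : Continuous φ := hφ1.continuous
  have hφR : ∀ x, R ≤ ‖x‖ → φ x = 0 := fun x hx => by simp [hφ, cap_eq_zero hR hx]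
  have hφ0 : ∀ x, 0 ≤ φ x := fun x => pow_nonneg (cap_nonneg _ _) _
  have hφle : ∀ x, φ x ≤ cap R x := fun x =>
    pow_le_of_le_one (cap_nonneg _ _) (cap_le_one _ _) (by norm_num)
  have hφle1 : ∀ x, φ x ≤ 1 := fun x => (hφle x).trans (cap_le_one _ _)
  have hdφR : ∀ i x, R + 1 ≤ ‖x‖ → fderiv ℝ φ x (ev i) = 0 := fun i =>
    fderiv_eq_zero_of_zero hφR _
  have hdφ : ∀ i, Continuous fun x => fderiv ℝ φ x (ev i) := fun i =>
    (hφ1.continuous_fderiv (by simp)).clm_apply continuous_const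
  set P : ℝ → ℝ → ℝ := fun k t => layerInt i₀ k (fun x =>
    0 - fderiv ℝ (fun y => u (y, t)) x (ev i₀) * (u (x, t) * φ x)) with hP
  set G : ℝ → ℝ → ℝ := fun k t => ∫ x, cutFun (k * x i₀) * (gradSq u (x, t) * φ x) with hG
  set Z : ℝ → ℝ → ℝ := fun k t => ∫ x, cutFun (k * x i₀) * (u (x, t) * cap R x) with hZdef
  set y : ℝ → ℝ → ℝ := fun k t => ∫ x, cutFun (k * x i₀) * (u (x, t) ^ 2 / 2 * φ x) with hy
  have hPc : ∀ k > 0, Continuous (P k) := by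
    intro k hk
    refine continuous_integral_param (R := R)
      (F := fun p : Eu n × ℝ => k * cutDeriv (k * p.1 i₀) *
        (0 - fderiv ℝ (fun y => u (y, p.2)) p.1 (ev i₀) * (u p * φ p.1))) ?_ fun x t hx => ?_
    · exact continuous_cutDeriv_mul_prod hk (continuousOn_const.sub
        ((h.continuousOn_fderiv i₀).mul
          (h.continuousOn_pos.mul (hφc.comp continuous_fst).continuousOn)))
    · simp only
      rw [hφR x hx]
      ring
  have hGc : ∀ k > 0, Continuous (G k) := by
    intro k hk
    refine continuous_integral_param (R := R)
      (F := fun p : Eu n × ℝ => cutFun (k * p.1 i₀) * (gradSq u p * φ p.1)) ?_ fun x t hx => ?_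
    · exact continuous_cutFun_mul_prod hk (h.continuousOn_gradSq.mul
        (hφc.comp continuous_fst).continuousOn)
    · simp only
      rw [hφR x hx]
      ring
  have hderiv : ∀ k > 0, ∀ t, ∃ d, HasDerivAt (fun s => -y k s) d t ∧
      1 / 2 * G k t - 32 * M * C * S - P k t ≤ d := by
    intro k hk t
    refine ⟨_, (h.hasDerivAt_cut_integral hq0 hk (Φ := fun s => s ^ 2 / 2) (Φ' := fun s => s)
      (fun s => ?_) continuous_id hφc hφR t).neg, ?_⟩
    · have := (hasDerivAt_pow 2 s).div_const 2
      simpa using this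
    rw [h.integral_cut_mul_lap hk hφ1 hφR t]
    have h1 := integral_cut_mono (i₀ := i₀) (R := R + 1) hk
      (f := fun x => -(gradSq u (x, t) * φ x) -
        ∑ i, u (x, t) * fderiv ℝ (fun y => u (y, t)) x (ev i) * fderiv ℝ φ x (ev i))
      (g := fun x => -(1 / 2) * (gradSq u (x, t) * φ x) +
        32 * M / R ^ 2 * (u (x, t) * cap R x))
      (((h.continuousOn_gradSq_slice t).mul hφc.continuousOn).neg.sub
        (continuousOn_finsetSum _ fun i _ => ((h.continuousOn_slice t).mul
          (continuousOn_fderiv_apply ((h.contDiffOn t).of_le (by norm_num)) _)).mul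
            (hdφ i).continuousOn))
      ((continuousOn_const.mul ((h.continuousOn_gradSq_slice t).mul hφc.continuousOn)).add
        (continuousOn_const.mul ((h.continuousOn_slice t).mul hcc.continuousOn)))
      (fun x hx => by
        rw [hφR x (by linarith), Finset.sum_eq_zero fun i _ => by rw [hdφR i x hx, mul_zero]]
        ring)
      (fun x hx => by rw [hφR x (by linarith), cap_eq_zero hR (by linarith)]; ring)
      (fun x hx => h.grad_cross_le hx t)
    rw [integral_cut_add (R := R) hk (f := fun x => -(1 / 2) * (gradSq u (x, t) * φ x))
      (g := fun x => 32 * M / R ^ 2 * (u (x, t) * cap R x))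
      (continuousOn_const.mul ((h.continuousOn_gradSq_slice t).mul hφc.continuousOn))
      (continuousOn_const.mul ((h.continuousOn_slice t).mul hcc.continuousOn))
      (fun x hx => by rw [hφR x hx]; ring) (fun x hx => by rw [cap_eq_zero hR hx]; ring),
      integral_cut_const_mul, integral_cut_const_mul] at h1
    have h2 : 32 * M / R ^ 2 * Z k t ≤ 32 * M * C * S := by
      refine (mul_le_mul_of_nonneg_left (hZ k hk t) (by positivity)).trans_eq ?_
      field_simp
    have h3 : P k t = -layerInt i₀ k fun x =>
        fderiv ℝ (fun y => u (y, t)) x (ev i₀) * (u (x, t) * φ x) := by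
      rw [hP]
      simp only [layerInt, zero_sub, mul_neg, integral_neg]
    change _ ≤ -(1 / 2) * G k t + 32 * M / R ^ 2 * Z k t at h1
    rw [h3]
    linarith
  choose! y' hy' hy'le using hderiv
  have hy0 : ∀ k > 0, ∀ t, 0 ≤ y k t := fun k hk t =>
    integral_cut_nonneg hk fun x _ => mul_nonneg (by positivity) (hφ0 x)
  have hyle : ∀ k > 0, ∀ t, y k t ≤ M * C * S * R ^ 2 := by
    intro k hk t
    have h1 := integral_cut_mono (i₀ := i₀) (R := R) hk
      (f := fun x => u (x, t) ^ 2 / 2 * φ x) (g := fun x => M * (u (x, t) * cap R x))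
      ((((h.continuousOn_slice t).pow 2).div_const 2).mul hφc.continuousOn)
      (continuousOn_const.mul ((h.continuousOn_slice t).mul hcc.continuousOn))
      (fun x hx => by rw [hφR x hx]; ring) (fun x hx => by rw [cap_eq_zero hR hx]; ring)
      (fun x hx => by
        have hu0 := h.pos x hx.le t
        rw [← mul_assoc]
        exact mul_le_mul (by nlinarith [h.le x hx.le t]) (hφle x) (hφ0 x)
          (mul_nonneg hM.le hu0.le))
    rw [integral_cut_const_mul] at h1
    refine h1.trans ((mul_le_mul_of_nonneg_left (hZ k hk t) hM.le).trans_eq ?_)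
    ring
  have hlim := h.tendsto_integral_flux hq0 (w := fun _ => 1) continuous_const (R := R)
    (φ := fun _ => 0) (χ := fun p => u p * φ p.1) (A := 0) (B := M) continuousOn_const
    (h.cont.mul (hφc.comp continuous_fst).continuousOn) (fun x _ t => by simp)
    (fun x hx t => by
      rw [abs_of_nonneg (mul_nonneg (h.pos x hx.le t).le (hφ0 x))]
      exact (mul_le_of_le_one_right (h.pos x hx.le t).le (hφle1 x)).trans (h.le x hx.le t))
    (fun x t _ => rfl) (fun x t hx => by simp only; rw [hφR x hx, mul_zero]) a b
  simp only [one_mul, zero_add] at hlim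
  have hbd : ∫ t in a..b, bdryInt i₀ (fun x => u (x, t) ^ q * (u (x, t) * φ x)) ≤
      M * C * S * (R ^ 2 + (b - a)) := by
    have hcont1 : ContinuousOn (fun p : Eu n × ℝ => u p ^ q * (u p * φ p.1))
        ({x | x i₀ = 0} ×ˢ univ) := (h.continuousOn_bdry_rpow hq0).mul
        (h.continuousOn_bdry.mul (hφc.comp continuous_fst).continuousOn)
    have hcont2 : ContinuousOn (fun p : Eu n × ℝ => u p ^ q * cap R p.1)
        ({x | x i₀ = 0} ×ˢ univ) := (h.continuousOn_bdry_rpow hq0).mul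
        (hcc.comp continuous_fst).continuousOn
    have hpair : ∀ t : ℝ, ContinuousOn (fun x : Eu n => (x, t)) {x | x i₀ = 0} := fun t => by
      fun_prop
    have h1 : ∫ t in a..b, bdryInt i₀ (fun x => u (x, t) ^ q * (u (x, t) * φ x)) ≤
        ∫ t in a..b, M * bdryInt i₀ (fun x => u (x, t) ^ q * cap R x) := by
      refine intervalIntegral.integral_mono_on hab
        (Continuous.intervalIntegrable (continuous_bdryInt_param (R := R) hcont1
          fun x t hx => by rw [hφR x hx]; ring) _ _)
        (Continuous.intervalIntegrable ((continuous_bdryInt_param (R := R) hcont2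
          fun x t hx => by rw [cap_eq_zero hR hx]; ring).const_mul _) _ _) fun t _ => ?_
      rw [← bdryInt_const_mul]
      refine bdryInt_mono (R := R)
        (hcont1.comp (hpair t) fun x hx => ⟨hx, mem_univ _⟩)
        (fun x hx => by rw [hφR x hx]; ring)
        (continuousOn_const.mul (hcont2.comp (hpair t) fun x hx => ⟨hx, mem_univ _⟩))
        (fun x hx => by simp [cap_eq_zero hR hx]) fun x hx => ?_
      have h2 := mul_le_mul (h.le x hx.ge t) (hφle x) (hφ0 x) hM.le
      have h3 := mul_le_mul_of_nonneg_left h2 (Real.rpow_nonneg (h.pos x hx.ge t).le q)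
      linarith
    rw [intervalIntegral.integral_const_mul] at h1
    refine h1.trans ((mul_le_mul_of_nonneg_left (hB a b hab) hM.le).trans_eq ?_)
    ring
  have hpos : 0 < S * R ^ 2 := by positivity
  have hev := hlim.eventually_lt_const
    (show _ < M * C * S * (R ^ 2 + (b - a)) + S * R ^ 2 by linarith)
  filter_upwards [hev] with m hm
  have hk : (0 : ℝ) < (m : ℝ) + 1 := by positivity
  have h1 := integral_le_sub_of_hasDerivAt (hy' _ hk)
    (P := fun t => 1 / 2 * G ((m : ℝ) + 1) t - 32 * M * C * S - P ((m : ℝ) + 1) t)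
    ((((hGc _ hk).const_mul _).sub continuous_const).sub (hPc _ hk)) (hy'le _ hk) hab
  have hsplit : ∫ t in a..b, (1 / 2 * G ((m : ℝ) + 1) t - 32 * M * C * S - P ((m : ℝ) + 1) t) =
      1 / 2 * (∫ t in a..b, G ((m : ℝ) + 1) t) - (b - a) * (32 * M * C * S) -
        ∫ t in a..b, P ((m : ℝ) + 1) t := by
    have hi1 : IntervalIntegrable (fun t => 1 / 2 * G ((m : ℝ) + 1) t) volume a b :=
      ((hGc _ hk).const_mul _).intervalIntegrable _ _
    have hi2 : IntervalIntegrable (fun t => 1 / 2 * G ((m : ℝ) + 1) t - 32 * M * C * S)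
        volume a b := (((hGc _ hk).const_mul _).sub continuous_const).intervalIntegrable _ _
    rw [intervalIntegral.integral_sub hi2 ((hPc _ hk).intervalIntegrable _ _),
      intervalIntegral.integral_sub hi1 (continuous_const.intervalIntegrable _ _),
      intervalIntegral.integral_const_mul, intervalIntegral.integral_const, smul_eq_mul]
  rw [hsplit] at h1
  have h2 := hyle _ hk a
  have h3 := hy0 _ hk b
  have h4 : 0 ≤ M * C * S * (b - a) := mul_nonneg (by positivity) (by linarith)
  have h5 : 0 ≤ 32 * M * C * S * R ^ 2 := by positivity
  have h6 : 0 ≤ S * (b - a) := mul_nonneg hS0.le (by linarith)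
  have h7 : ∫ t in a..b, G ((m : ℝ) + 1) t ≤ 2 * (M * C * S * R ^ 2 + 32 * M * C * S * (b - a) +
    (M * C * S * (R ^ 2 + (b - a)) + S * R ^ 2)) := by linarith
  refine h7.trans ?_
  linarith

end HalfSol

section Algebra

lemma neg_mul_le_of_sq_le {X z Z δ : ℝ} (hz : 0 ≤ z) (hZ : 0 ≤ Z) (h : X ^ 2 ≤ z * Z) :
    -(δ * X) ≤ z * δ ^ 2 + Z / 4 := by
  have h1 : |δ * X| ≤ z * δ ^ 2 + Z / 4 := by
    refine abs_le_of_sq_le_sq ?_ (by positivity)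
    have := mul_le_mul_of_nonneg_left h (sq_nonneg δ)
    nlinarith [sq_nonneg (z * δ ^ 2 - Z / 4)]
  have := neg_abs_le (δ * X)
  linarith

lemma energy_pointwise {ι : Type*} [Fintype ι] (i₀ : ι) {a b d : ι → ℝ} {δ z w c K ρ ρ' A : ℝ}
    (hz : 0 ≤ z) (hw : 0 ≤ w) (hc : 0 ≤ c) (hK : 0 ≤ K) (hρ0 : 0 ≤ ρ) (hρ1 : ρ ≤ 1)
    (hρ' : -A ≤ ρ') (hd : 0 ≤ ρ * d i₀) (hsum : ∑ i, d i ^ 2 ≤ c * z * w) :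
    -(∑ i, a i * (δ * d i + (a i - b i) * z)) -
      K * (ρ * (z * (2 * δ * (a i₀ - b i₀)) + d i₀ * δ ^ 2) + ρ' * (z * δ ^ 2)) ≤
    1 / 2 * ((∑ i, b i ^ 2) * z) - 1 / 2 * ((∑ i, a i ^ 2) * z) + c / 4 * ((∑ i, a i ^ 2) * w) +
      2 * (1 + K * A + 2 * K ^ 2) * (1 / 2 * δ ^ 2 * z) := by
  have h1 : -(δ * ∑ i, a i * d i) ≤ z * δ ^ 2 + (c * ((∑ i, a i ^ 2) * w)) / 4 := by
    refine neg_mul_le_of_sq_le hz (by positivity) ?_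
    refine (Finset.sum_mul_sq_le_sq_mul_sq _ _ _).trans ?_
    have h2 : 0 ≤ ∑ i, a i ^ 2 := Finset.sum_nonneg fun i _ => sq_nonneg _
    refine (mul_le_mul_of_nonneg_left hsum h2).trans_eq (by ring)
  have h2 : ∑ i, a i * (δ * d i + (a i - b i) * z) = δ * ∑ i, a i * d i +
      (1 / 2 * ((∑ i, a i ^ 2) * z) - 1 / 2 * ((∑ i, b i ^ 2) * z) +
        1 / 2 * ((∑ i, (a i - b i) ^ 2) * z)) := by
    simp only [Finset.mul_sum, Finset.sum_mul]
    rw [← Finset.sum_sub_distrib, ← Finset.sum_add_distrib, ← Finset.sum_add_distrib]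
    refine Finset.sum_congr rfl fun i _ => ?_
    ring
  have h3 : (a i₀ - b i₀) ^ 2 ≤ ∑ i, (a i - b i) ^ 2 :=
    Finset.single_le_sum (f := fun i => (a i - b i) ^ 2) (fun i _ => sq_nonneg _)
      (Finset.mem_univ i₀)
  have h4 := mul_le_mul_of_nonneg_right h3 hz
  have h5 : 0 ≤ K * (ρ * d i₀ * δ ^ 2) := by positivity
  have h6 : 0 ≤ K * ((ρ' + A) * (z * δ ^ 2)) := by
    have : 0 ≤ ρ' + A := by linarith
    positivity
  have h7 : 0 ≤ z * ((a i₀ - b i₀) + 2 * K * ρ * δ) ^ 2 := by positivity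
  have h8 : z * δ ^ 2 * K ^ 2 * ρ ^ 2 ≤ z * δ ^ 2 * K ^ 2 :=
    mul_le_of_le_one_right (by positivity) (pow_le_one₀ hρ0 hρ1)
  rw [h2]
  nlinarith

end Algebra

/-- A test function `ζ` for the energy inequality together with a weight `ω` controlling it. -/
structure TestPair {n : ℕ} (i₀ : Fin n) (r c : ℝ) (ζ ω : Eu n → ℝ) : Prop where
  contDiff : ContDiff ℝ 1 ζ
  cont : Continuous ω
  nonneg : ∀ x, 0 ≤ ζ x
  le_one : ∀ x, ζ x ≤ 1
  weight_nonneg : ∀ x, 0 ≤ ω x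
  zero : ∀ x, r ≤ ‖x‖ → ζ x = 0
  weight_zero : ∀ x, r ≤ ‖x‖ → ω x = 0
  mono : ∀ x : Eu n, x i₀ ≤ 2 → 0 ≤ fderiv ℝ ζ x (ev i₀)
  grad : ∀ x, ∑ i, fderiv ℝ ζ x (ev i) ^ 2 ≤ c * ζ x * ω x

namespace HalfSol

variable {n : ℕ} {i₀ : Fin n} {q M : ℝ} {u : Eu n × ℝ → ℝ}

lemma integral_cut_lap_mul_of_contDiffOn (h : HalfSol i₀ q M u) {k R : ℝ} (hk : 0 < k)
    {ψ : Eu n → ℝ} (hψ : ContDiffOn ℝ 1 ψ {x | 0 < x i₀}) (hR : ∀ x, R ≤ ‖x‖ → ψ x = 0) (t : ℝ) :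
    ∫ x, cutFun (k * x i₀) * (lap (fun y => u (y, t)) x * ψ x) =
      (∫ x, cutFun (k * x i₀) *
        -∑ i, fderiv ℝ (fun y => u (y, t)) x (ev i) * fderiv ℝ ψ x (ev i)) -
        layerInt i₀ k (fun x => fderiv ℝ (fun y => u (y, t)) x (ev i₀) * ψ x) := by
  have hu1 : ContDiffOn ℝ 1 (fun x => u (x, t)) {x | 0 < x i₀} :=
    (h.contDiffOn t).of_le (by norm_num)
  have hRd : ∀ i x, R + 1 ≤ ‖x‖ → fderiv ℝ ψ x (ev i) = 0 := fun i =>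
    fderiv_eq_zero_of_zero hR _
  have h1 := integral_cut_div (i₀ := i₀) (R := R) hk
    (f := fun i x => fderiv ℝ (fun y => u (y, t)) x (ev i) * ψ x)
    (fun i => (h.contDiffOn_fderiv t i).mul hψ) (fun i x hx => by rw [hR x hx, mul_zero])
  rw [sub_eq_add_neg, ← h1, ← integral_add]
  · refine integral_congr_ae (Eventually.of_forall fun x => ?_)
    simp only
    by_cases hx : 0 < x i₀
    · rw [← mul_add]
      congr 1
      have hm := (isOpen_coord_pos i₀).mem_nhds hx
      have d2 : DifferentiableAt ℝ ψ x := (hψ.contDiffAt hm).differentiableAt (by simp)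
      have h3 : ∀ i, fderiv ℝ (fun x => fderiv ℝ (fun y => u (y, t)) x (ev i) * ψ x) x (ev i) =
          fderiv ℝ (fun y => u (y, t)) x (ev i) * fderiv ℝ ψ x (ev i) +
          fderiv ℝ (fun z => fderiv ℝ (fun y => u (y, t)) z (ev i)) x (ev i) * ψ x := by
        intro i
        exact fderiv_mul_apply (((h.contDiffOn_fderiv t i).contDiffAt hm).differentiableAt
          (by simp)) d2 _
      simp_rw [h3]
      rw [Finset.sum_add_distrib, ← Finset.sum_mul]
      unfold lap
      ring
    · rw [cutFun_of_le (by nlinarith [not_lt.1 hx])]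
      ring
  · refine integrable_of_continuous_of_zero (R := R + 1) (continuous_cutFun_mul hk
      (continuousOn_finsetSum _ fun i _ => (continuousOn_fderiv_apply hu1 _).mul
        (continuousOn_fderiv_apply hψ _)).neg) fun x hx => ?_
    rw [Finset.sum_eq_zero fun i _ => by rw [hRd i x hx, mul_zero]]
    ring
  · refine integrable_of_continuous_of_zero (R := R + 1) (continuous_cutFun_mul hk
      (continuousOn_finsetSum _ fun i _ => continuousOn_fderiv_apply
        ((h.contDiffOn_fderiv t i).mul hψ) _)) fun x hx => ?_
    rw [Finset.sum_eq_zero fun i _ => fderiv_eq_zero_of_zero (R := R)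
      (fun x hx => by simp [hR x hx]) (ev i) x hx, mul_zero]

lemma hasDerivAt_cut_sq_diff (h : HalfSol i₀ q M u) (hq : 0 ≤ q) {k R : ℝ} (hk : 0 < k)
    {ψ : Eu n → ℝ} (hψ : Continuous ψ) (hR : ∀ x, R ≤ ‖x‖ → ψ x = 0) (t s : ℝ) :
    HasDerivAt (fun s => ∫ x, cutFun (k * x i₀) * (1 / 2 * (u (x, s) - u (x, t)) ^ 2 * ψ x))
      (∫ x, cutFun (k * x i₀) *
        (lap (fun y => u (y, s)) x * ((u (x, s) - u (x, t)) * ψ x))) s := by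
  obtain ⟨C, hC⟩ := h.exists_abs_cut_lap_le hq hk
  obtain ⟨B, hB⟩ : ∃ B, ∀ x, |ψ x| ≤ B :=
    (hψ.bounded_above_of_compact_support (HasCompactSupport.intro
      (isCompact_closedBall (0 : Eu n) R) fun x hx => hR x (by
        rw [mem_closedBall_zero_iff, not_le] at hx; exact hx.le)))
  have hM := h.M_pos
  refine hasDerivAt_integral_param (R := R) (C := C * (M * B))
    (F := fun p : Eu n × ℝ => cutFun (k * p.1 i₀) * (1 / 2 * (u p - u (p.1, t)) ^ 2 * ψ p.1))
    (F' := fun p : Eu n × ℝ =>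
      cutFun (k * p.1 i₀) * (lap (fun y => u (y, p.2)) p.1 * ((u p - u (p.1, t)) * ψ p.1)))
    (fun s => ?_) (fun s => ?_) (fun x s hx => ?_) (fun x s hx => ?_) (fun x s => ?_)
    (fun x s => ?_) s
  · exact continuous_cutFun_mul hk ((continuousOn_const.mul
      (((h.continuousOn_slice s).sub (h.continuousOn_slice t)).pow 2)).mul hψ.continuousOn)
  · exact continuous_cutFun_mul hk ((h.continuousOn_lap s).mul
      (((h.continuousOn_slice s).sub (h.continuousOn_slice t)).mul hψ.continuousOn))
  · simp [hR x hx]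
  · simp [hR x hx]
  · have hC0 := (abs_nonneg _).trans (hC x s)
    have hB0 := (abs_nonneg _).trans (hB x)
    by_cases hx : 0 < x i₀
    · simp only
      rw [← mul_assoc, abs_mul, abs_mul (u (x, s) - u (x, t))]
      exact mul_le_mul (hC x s) (mul_le_mul (h.abs_sub_le_M hx.le hx.le s t) (hB x) (abs_nonneg _) hM.le)
        (by positivity) hC0
    · simp only
      rw [cutFun_of_le (by nlinarith [not_lt.1 hx]), zero_mul, abs_zero]
      positivity
  · by_cases hx : 0 < x i₀
    · have h1 := (((((h.caloric x hx s).2.sub_const (u (x, t))).fun_pow 2).const_mul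
        (1 / 2 : ℝ)).mul_const (ψ x)).const_mul (cutFun (k * x i₀))
      refine h1.congr_deriv ?_
      simp only
      push_cast
      ring
    · have : cutFun (k * x i₀) = 0 := cutFun_of_le (by nlinarith [not_lt.1 hx])
      simp only [this, zero_mul]
      exact hasDerivAt_const _ _

end HalfSol

lemma layerInt_sub_of_continuousOn {n : ℕ} {i₀ : Fin n} {k R : ℝ} (hk : 0 < k) {f g : Eu n → ℝ}
    (hf : ContinuousOn f {x | 0 < x i₀}) (hg : ContinuousOn g {x | 0 < x i₀})
    (hfR : ∀ x, R ≤ ‖x‖ → f x = 0) (hgR : ∀ x, R ≤ ‖x‖ → g x = 0) :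
    layerInt i₀ k (fun x => f x - g x) = layerInt i₀ k f - layerInt i₀ k g := by
  unfold layerInt
  rw [← integral_sub]
  · simp only [mul_sub]
  · exact integrable_of_continuous_of_zero (R := R) (continuous_cutDeriv_mul hk hf)
      fun x hx => by rw [hfR x hx, mul_zero]
  · exact integrable_of_continuous_of_zero (R := R) (continuous_cutDeriv_mul hk hg)
      fun x hx => by rw [hgR x hx, mul_zero]

lemma layerInt_const_mul {n : ℕ} {i₀ : Fin n} (k c : ℝ) (f : Eu n → ℝ) :
    layerInt i₀ k (fun x => c * f x) = c * layerInt i₀ k f := by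
  unfold layerInt
  rw [← integral_const_mul]
  congr 1
  funext x
  ring

namespace HalfSol

variable {n : ℕ} {i₀ : Fin n} {q M : ℝ} {u : Eu n × ℝ → ℝ}

lemma energy_inequality (h : HalfSol i₀ q M u) {k r c A K : ℝ} (hk : 0 < k) (hc : 0 ≤ c)
    (hK : 0 ≤ K) (hA : ∀ s, cutDeriv s ≤ A) {ζ ω : Eu n → ℝ} (hp : TestPair i₀ r c ζ ω) (t s : ℝ) :
    ∫ x, cutFun (k * x i₀) * (lap (fun y => u (y, s)) x * ((u (x, s) - u (x, t)) * ζ x)) ≤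
      1 / 2 * (∫ x, cutFun (k * x i₀) * (gradSq u (x, t) * ζ x)) -
      1 / 2 * (∫ x, cutFun (k * x i₀) * (gradSq u (x, s) * ζ x)) +
      c / 4 * (∫ x, cutFun (k * x i₀) * (gradSq u (x, s) * ω x)) +
      2 * (1 + K * A + 2 * K ^ 2) *
        (∫ x, cutFun (k * x i₀) * (1 / 2 * (u (x, s) - u (x, t)) ^ 2 * ζ x)) +
      layerInt i₀ k (fun x => -K * ((1 - cutFun (x i₀)) * (ζ x * (u (x, s) - u (x, t)) ^ 2)) -
        fderiv ℝ (fun y => u (y, s)) x (ev i₀) * ((u (x, s) - u (x, t)) * ζ x)) := by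
  have hu1 : ∀ t, ContDiffOn ℝ 1 (fun x => u (x, t)) {x | 0 < x i₀} := fun t =>
    (h.contDiffOn t).of_le (by norm_num)
  have hζ := hp.contDiff.contDiffOn (s := {x | 0 < x i₀})
  have hζc := hp.contDiff.continuous
  have hρ : ContDiff ℝ 1 fun x : Eu n => 1 - cutFun (x i₀) :=
    contDiff_const.sub ((contDiff_cutFun.of_le (by norm_num)).comp (by fun_prop))
  set ψ : Eu n → ℝ := fun x => (u (x, s) - u (x, t)) * ζ x with hψ
  set ξ : Eu n → ℝ := fun x => ζ x * (u (x, s) - u (x, t)) ^ 2 with hξ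
  set g : Eu n → ℝ := fun x => (1 - cutFun (x i₀)) * ξ x with hg
  have hψ1 : ContDiffOn ℝ 1 ψ {x | 0 < x i₀} := ((hu1 s).sub (hu1 t)).mul hζ
  have hξ1 : ContDiffOn ℝ 1 ξ {x | 0 < x i₀} := hζ.mul (((hu1 s).sub (hu1 t)).pow 2)
  have hg1 : ContDiffOn ℝ 1 g {x | 0 < x i₀} := hρ.contDiffOn.mul hξ1
  have hψR : ∀ x, r ≤ ‖x‖ → ψ x = 0 := fun x hx => by simp [hψ, hp.zero x hx]
  have hgR : ∀ x, r ≤ ‖x‖ → g x = 0 := fun x hx => by simp [hg, hξ, hp.zero x hx]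
  have hψd : ∀ x, 0 < x i₀ → ∀ i, fderiv ℝ ψ x (ev i) = (u (x, s) - u (x, t)) *
      fderiv ℝ ζ x (ev i) + (fderiv ℝ (fun y => u (y, s)) x (ev i) -
        fderiv ℝ (fun y => u (y, t)) x (ev i)) * ζ x := by
    intro x hx i
    have hm := (isOpen_coord_pos i₀).mem_nhds hx
    have d1 := ((hu1 s).contDiffAt hm).differentiableAt (by simp)
    have d2 := ((hu1 t).contDiffAt hm).differentiableAt (by simp)
    rw [hψ, fderiv_mul_apply (d1.fun_sub d2) (hp.contDiff.contDiffAt.differentiableAt (by simp)),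
      fderiv_fun_sub d1 d2, sub_apply]
  have hgd : ∀ x, 0 < x i₀ → fderiv ℝ g x (ev i₀) = (1 - cutFun (x i₀)) *
      (ζ x * (2 * (u (x, s) - u (x, t)) * (fderiv ℝ (fun y => u (y, s)) x (ev i₀) -
        fderiv ℝ (fun y => u (y, t)) x (ev i₀))) +
        fderiv ℝ ζ x (ev i₀) * (u (x, s) - u (x, t)) ^ 2) +
      -cutDeriv (x i₀) * (ζ x * (u (x, s) - u (x, t)) ^ 2) := by
    intro x hx
    have hm := (isOpen_coord_pos i₀).mem_nhds hx
    have d1 := ((hu1 s).contDiffAt hm).differentiableAt (by simp)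
    have d2 := ((hu1 t).contDiffAt hm).differentiableAt (by simp)
    have d3 := hp.contDiff.contDiffAt.differentiableAt (x := x) (by simp)
    have d4 := (d1.fun_sub d2).fun_pow 2
    have e1 : fderiv ℝ (fun x : Eu n => 1 - cutFun (x i₀)) x (ev i₀) = -cutDeriv (x i₀) := by
      have h1 := hasDerivAt_line_zero (e := ev i₀)
        (hρ.contDiffAt.differentiableAt (x := x) (by simp))
      have h2 : HasDerivAt (fun τ : ℝ => 1 - cutFun ((x + τ • ev i₀) i₀)) (-cutDeriv (x i₀)) 0 := by
        simp only [coord_add_smul_ev]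
        have h3 := (hasDerivAt_cutFun (x i₀ + 0)).comp (0 : ℝ)
          ((hasDerivAt_id (0 : ℝ)).const_add (x i₀))
        simpa using h3.const_sub 1
      exact h1.unique h2
    have e2 : fderiv ℝ (fun x => (u (x, s) - u (x, t)) ^ 2) x (ev i₀) =
        2 * (u (x, s) - u (x, t)) * (fderiv ℝ (fun y => u (y, s)) x (ev i₀) -
        fderiv ℝ (fun y => u (y, t)) x (ev i₀)) := by
      rw [show (fun x => (u (x, s) - u (x, t)) ^ 2) = fun x => (u (x, s) - u (x, t)) *
        (u (x, s) - u (x, t)) by funext x; ring, fderiv_mul_apply (d1.fun_sub d2) (d1.fun_sub d2),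
        fderiv_fun_sub d1 d2, sub_apply]
      ring
    rw [hg, fderiv_mul_apply (hρ.contDiffAt.differentiableAt (by simp)) (d3.fun_mul d4), e1,
      fderiv_mul_apply d3 d4, e2]
  have c1 := h.integral_cut_lap_mul_of_contDiffOn hk hψ1 hψR s
  have c2 := integral_cut_fderiv (i₀ := i₀) hk hg1 hgR i₀
  rw [if_pos rfl] at c2
  have hDu : ∀ i t, ContinuousOn (fun x => fderiv ℝ (fun y => u (y, t)) x (ev i))
      {x | 0 < x i₀} := fun i t => continuousOn_fderiv_apply (hu1 t) _
  have c5 : layerInt i₀ k (fun x => -K * g x - fderiv ℝ (fun y => u (y, s)) x (ev i₀) * ψ x) =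
      -K * layerInt i₀ k g -
        layerInt i₀ k (fun x => fderiv ℝ (fun y => u (y, s)) x (ev i₀) * ψ x) := by
    rw [layerInt_sub_of_continuousOn (R := r) (f := fun x => -K * g x)
      (g := fun x => fderiv ℝ (fun y => u (y, s)) x (ev i₀) * ψ x) hk
      (continuousOn_const.mul hg1.continuousOn)
      ((hDu _ _).mul hψ1.continuousOn) (fun x hx => by rw [hgR x hx, mul_zero])
      (fun x hx => by rw [hψR x hx, mul_zero]), layerInt_const_mul]
  rw [c1]
  change _ ≤ _ + layerInt i₀ k (fun x => -K * g x -
    fderiv ℝ (fun y => u (y, s)) x (ev i₀) * ψ x)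
  rw [c5]
  have hRdψ : ∀ i x, r + 1 ≤ ‖x‖ → fderiv ℝ ψ x (ev i) = 0 := fun i =>
    fderiv_eq_zero_of_zero hψR _
  have hRdg := fderiv_eq_zero_of_zero hgR (ev i₀)
  have hsum0 : ∀ x, r + 1 ≤ ‖x‖ → -∑ i, fderiv ℝ (fun y => u (y, s)) x (ev i) *
      fderiv ℝ ψ x (ev i) = 0 := fun x hx => by
    rw [Finset.sum_eq_zero fun i _ => by rw [hRdψ i x hx, mul_zero], neg_zero]
  have hcsum : ContinuousOn (fun x => -∑ i, fderiv ℝ (fun y => u (y, s)) x (ev i) *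
      fderiv ℝ ψ x (ev i)) {x | 0 < x i₀} :=
    (continuousOn_finsetSum _ fun i _ => (hDu i s).mul (continuousOn_fderiv_apply hψ1 _)).neg
  have hcdg := continuousOn_fderiv_apply hg1 (ev i₀)
  have c3 := integral_cut_add (R := r + 1) hk
    (f := fun x => -∑ i, fderiv ℝ (fun y => u (y, s)) x (ev i) * fderiv ℝ ψ x (ev i))
    (g := fun x => -K * fderiv ℝ g x (ev i₀)) hcsum (continuousOn_const.mul hcdg) hsum0
    (fun x hx => by rw [hRdg x hx, mul_zero])
  rw [integral_cut_const_mul, c2] at c3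
  set κ := 2 * (1 + K * A + 2 * K ^ 2) with hκ
  have hE : ∀ t, ContinuousOn (fun x => gradSq u (x, t) * ζ x) {x | 0 < x i₀} := fun t =>
    (h.continuousOn_gradSq_slice t).mul hζc.continuousOn
  have hEω : ContinuousOn (fun x => gradSq u (x, s) * ω x) {x | 0 < x i₀} :=
    (h.continuousOn_gradSq_slice s).mul hp.cont.continuousOn
  have hN : ContinuousOn (fun x => 1 / 2 * (u (x, s) - u (x, t)) ^ 2 * ζ x) {x | 0 < x i₀} :=
    (continuousOn_const.mul (((h.continuousOn_slice s).sub (h.continuousOn_slice t)).pow 2)).mul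
      hζc.continuousOn
  have z1 : ∀ x, r + 1 ≤ ‖x‖ → ζ x = 0 := fun x hx => hp.zero x (by linarith)
  have z2 : ∀ x, r + 1 ≤ ‖x‖ → ω x = 0 := fun x hx => hp.weight_zero x (by linarith)
  have c4 := integral_cut_mono (R := r + 1) hk
    (f := fun x => -∑ i, fderiv ℝ (fun y => u (y, s)) x (ev i) * fderiv ℝ ψ x (ev i) +
      -K * fderiv ℝ g x (ev i₀))
    (g := fun x => (1 / 2 * (gradSq u (x, t) * ζ x) + -(1 / 2) * (gradSq u (x, s) * ζ x)) +
      c / 4 * (gradSq u (x, s) * ω x) + κ * (1 / 2 * (u (x, s) - u (x, t)) ^ 2 * ζ x))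
    (hcsum.add (continuousOn_const.mul hcdg))
    ((((continuousOn_const.mul (hE t)).add (continuousOn_const.mul (hE s))).add
      (continuousOn_const.mul hEω)).add (continuousOn_const.mul hN))
    (fun x hx => by rw [hsum0 x hx, hRdg x hx]; ring)
    (fun x hx => by rw [z1 x hx, z2 x hx]; ring)
    (fun x hx => by
      have h1 : 0 ≤ (1 - cutFun (x i₀)) * fderiv ℝ ζ x (ev i₀) := by
        by_cases h2 : x i₀ ≤ 2
        · exact mul_nonneg (by linarith [cutFun_le_one (x i₀)]) (hp.mono x h2)
        · rw [cutFun_of_ge (not_le.1 h2).le]; simp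
      have := energy_pointwise i₀ (a := fun i => fderiv ℝ (fun y => u (y, s)) x (ev i))
        (b := fun i => fderiv ℝ (fun y => u (y, t)) x (ev i)) (d := fun i => fderiv ℝ ζ x (ev i))
        (δ := u (x, s) - u (x, t)) (A := A) (ρ' := -cutDeriv (x i₀)) (hp.nonneg x)
        (hp.weight_nonneg x) hc hK
        (by linarith [cutFun_le_one (x i₀)]) (by linarith [cutFun_nonneg (x i₀)])
        (by linarith [hA (x i₀)]) h1 (hp.grad x)
      simp only [hψd x hx, hgd x hx]
      unfold gradSq
      simp only at this ⊢
      linarith)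
  rw [integral_cut_add (R := r + 1) hk
      (f := fun x => (1 / 2 * (gradSq u (x, t) * ζ x) + -(1 / 2) * (gradSq u (x, s) * ζ x)) +
        c / 4 * (gradSq u (x, s) * ω x))
      (g := fun x => κ * (1 / 2 * (u (x, s) - u (x, t)) ^ 2 * ζ x))
      (((continuousOn_const.mul (hE t)).add (continuousOn_const.mul (hE s))).add
        (continuousOn_const.mul hEω)) (continuousOn_const.mul hN)
      (fun x hx => by rw [z1 x hx, z2 x hx]; ring) (fun x hx => by rw [z1 x hx]; ring),
    integral_cut_add (R := r + 1) hk
      (f := fun x => 1 / 2 * (gradSq u (x, t) * ζ x) + -(1 / 2) * (gradSq u (x, s) * ζ x))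
      (g := fun x => c / 4 * (gradSq u (x, s) * ω x))
      ((continuousOn_const.mul (hE t)).add (continuousOn_const.mul (hE s)))
      (continuousOn_const.mul hEω)
      (fun x hx => by rw [z1 x hx]; ring) (fun x hx => by rw [z2 x hx]; ring),
    integral_cut_add (R := r + 1) hk
      (f := fun x => 1 / 2 * (gradSq u (x, t) * ζ x))
      (g := fun x => -(1 / 2) * (gradSq u (x, s) * ζ x))
      (continuousOn_const.mul (hE t)) (continuousOn_const.mul (hE s))
      (fun x hx => by rw [z1 x hx]; ring) (fun x hx => by rw [z1 x hx]; ring),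
    integral_cut_const_mul, integral_cut_const_mul, integral_cut_const_mul,
    integral_cut_const_mul] at c4
  linarith

end HalfSol

/-- The tent function of half-width `T`. -/
noncomputable def tent (T t : ℝ) : ℝ := max (1 - |t| / T) 0

lemma tent_nonneg (T t : ℝ) : 0 ≤ tent T t := le_max_right _ _

lemma tent_le_one {T : ℝ} (hT : 0 < T) (t : ℝ) : tent T t ≤ 1 :=
  max_le (by have : 0 ≤ |t| / T := by positivity
             linarith) zero_le_one

lemma tent_eq_zero {T t : ℝ} (hT : 0 < T) (h : T ≤ |t|) : tent T t = 0 :=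
  max_eq_right (by rw [sub_nonpos, one_le_div hT]; exact h)

lemma continuous_tent (T : ℝ) : Continuous (tent T) := by
  unfold tent
  fun_prop

lemma tent_mono {T T' : ℝ} (hT : 0 < T) (h : T ≤ T') (t : ℝ) : tent T t ≤ tent T' t :=
  max_le_max (sub_le_sub_left (div_le_div_of_nonneg_left (abs_nonneg t) hT h) _) le_rfl

lemma tent_sub_le {T : ℝ} (hT : 0 < T) (t h : ℝ) : |tent T (t - h) - tent T t| ≤ |h| / T := by
  unfold tent
  refine (abs_max_sub_max_le_abs _ _ _).trans ?_
  rw [show 1 - |t - h| / T - (1 - |t| / T) = (|t| - |t - h|) / T by ring, abs_div, abs_of_pos hT]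
  refine div_le_div_of_nonneg_right ?_ hT.le
  refine (abs_abs_sub_abs_le t (t - h)).trans_eq ?_
  congr 1
  ring

lemma integral_tent_mul_shift {T h : ℝ} (hT : 0 < T) (h0 : 0 ≤ h) (h1 : h ≤ 1) {Y : ℝ → ℝ}
    (hY : Continuous Y) :
    ∫ t in -(T + 1)..(T + 1), tent T t * Y (t + h) =
      ∫ t in -(T + 1)..(T + 1), tent T (t - h) * Y t := by
  have hc : Continuous fun t => tent T (t - h) * Y t :=
    ((continuous_tent T).comp (by fun_prop)).mul hY
  have hi : ∀ a b, IntervalIntegrable (fun t => tent T (t - h) * Y t) volume a b :=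
    fun a b => hc.intervalIntegrable a b
  have e1 := intervalIntegral.integral_comp_add_right (a := -(T + 1)) (b := T + 1)
    (fun t => tent T (t - h) * Y t) h
  simp only [add_sub_cancel_right] at e1
  rw [e1, ← intervalIntegral.integral_add_adjacent_intervals (hi _ (T + 1)) (hi _ _),
    ← intervalIntegral.integral_add_adjacent_intervals (hi (-(T + 1)) (-(T + 1) + h)) (hi _ (T + 1))]
  have z1 : ∫ t in (T + 1)..(T + 1 + h), tent T (t - h) * Y t = 0 := by
    rw [intervalIntegral.integral_congr (g := fun _ => 0)]
    · simp
    · intro t ht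
      rw [uIcc_of_le (by linarith)] at ht
      simp only
      rw [tent_eq_zero hT (by rw [le_abs]; left; linarith [ht.1]), zero_mul]
  have z2 : ∫ t in -(T + 1)..(-(T + 1) + h), tent T (t - h) * Y t = 0 := by
    rw [intervalIntegral.integral_congr (g := fun _ => 0)]
    · simp
    · intro t ht
      rw [uIcc_of_le (by linarith)] at ht
      simp only
      rw [tent_eq_zero hT (by rw [le_abs]; right; linarith [ht.2]), zero_mul]
  rw [z1, z2]
  ring

lemma integral_tent_mul_integral_shift {T H : ℝ} (hT : 0 < T) (h0 : 0 ≤ H) (h1 : H ≤ 1)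
    {Y f : ℝ → ℝ} (hY : Continuous Y) (hf : Continuous f) :
    ∫ t in -(T + 1)..(T + 1), tent T t * ∫ h in 0..H, f h * Y (t + h) =
      ∫ h in 0..H, f h * ∫ t in -(T + 1)..(T + 1), tent T (t - h) * Y t := by
  have hθ := continuous_tent T
  simp only [← intervalIntegral.integral_const_mul]
  rw [intervalIntegral_intervalIntegral_swap]
  · refine intervalIntegral.integral_congr fun h hh => ?_
    rw [uIcc_of_le h0] at hh
    simp only [intervalIntegral.integral_const_mul]
    rw [← integral_tent_mul_shift hT hh.1 (hh.2.trans h1) hY,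
      ← intervalIntegral.integral_const_mul]
    congr 1
    funext t
    ring
  · have : Continuous (Function.uncurry fun t h => tent T t * (f h * Y (t + h))) := by
      unfold Function.uncurry
      fun_prop
    exact (this.continuousOn.integrableOn_compact (isCompact_uIcc.prod isCompact_uIcc)).mono_set
      (prod_mono uIoc_subset_uIcc uIoc_subset_uIcc)

lemma integral_tent_shift_le {T H : ℝ} (hT : 0 < T) (h0 : 0 ≤ H) (h1 : H ≤ 1)
    {Y f : ℝ → ℝ} (hY : Continuous Y) (hf : Continuous f) (hY0 : ∀ t, 0 ≤ Y t)
    (hf0 : ∀ t, 0 ≤ f t) (hf1 : ∀ t, 0 ≤ t → f t ≤ 1) :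
    ∫ t in -(T + 1)..(T + 1), tent T t * ∫ h in 0..H, f h * Y (t + h) ≤
      ∫ t in -(T + 1)..(T + 1), Y t := by
  have hθ := continuous_tent T
  rw [integral_tent_mul_integral_shift hT h0 h1 hY hf]
  set I := ∫ t in -(T + 1)..(T + 1), Y t with hI
  have hI0 : 0 ≤ I := intervalIntegral.integral_nonneg (by linarith) fun t _ => hY0 t
  have hin : ∀ h, ∫ t in -(T + 1)..(T + 1), tent T (t - h) * Y t ≤ I := fun h => by
    refine intervalIntegral.integral_mono_on (by linarith) ?_ (hY.intervalIntegrable _ _)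
      fun t _ => mul_le_of_le_one_left (hY0 t) (tent_le_one hT _)
    exact Continuous.intervalIntegrable (by fun_prop) _ _
  have hc : Continuous fun h => ∫ t in -(T + 1)..(T + 1), tent T (t - h) * Y t :=
    intervalIntegral.continuous_parametric_intervalIntegral_of_continuous' (by
      unfold Function.uncurry; fun_prop) _ _
  calc _ ≤ ∫ h in 0..H, I := by
        refine intervalIntegral.integral_mono_on h0 ((hf.mul hc).intervalIntegrable _ _)
          (by simp) fun h hh => ?_
        calc _ ≤ f h * I := mul_le_mul_of_nonneg_left (hin h) (hf0 h)
          _ ≤ I := mul_le_of_le_one_left hI0 (hf1 h hh.1)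
    _ ≤ I := by simpa using mul_le_of_le_one_left hI0 h1

lemma abs_integral_tent_diff_le {T H : ℝ} (hT : 0 < T) (h0 : 0 ≤ H) (h1 : H ≤ 1)
    {Y f : ℝ → ℝ} (hY : Continuous Y) (hf : Continuous f) (hY0 : ∀ t, 0 ≤ Y t)
    (hf0 : ∀ t, 0 ≤ f t) (hf1 : ∀ t, 0 ≤ t → f t ≤ 1) :
    |∫ t in -(T + 1)..(T + 1), tent T t * ∫ h in 0..H, f h * (Y (t + h) - Y t)| ≤
      1 / T * ∫ t in -(T + 1)..(T + 1), Y t := by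
  have hθ := continuous_tent T
  set I := ∫ t in -(T + 1)..(T + 1), Y t with hI
  have hI0 : 0 ≤ I := intervalIntegral.integral_nonneg (by linarith) fun t _ => hY0 t
  have ci : ∀ {g : ℝ → ℝ} {a b : ℝ}, Continuous g → IntervalIntegrable g volume a b :=
    fun hg => hg.intervalIntegrable _ _
  have hc : Continuous fun h => ∫ t in -(T + 1)..(T + 1), tent T (t - h) * Y t :=
    intervalIntegral.continuous_parametric_intervalIntegral_of_continuous' (by
      unfold Function.uncurry; fun_prop) _ _
  have hc2 : Continuous fun t => ∫ h in 0..H, f h * Y (t + h) :=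
    intervalIntegral.continuous_parametric_intervalIntegral_of_continuous' (by
      unfold Function.uncurry; fun_prop) _ _
  have e1 : ∫ t in -(T + 1)..(T + 1), tent T t * ∫ h in 0..H, f h * (Y (t + h) - Y t) =
      ∫ h in 0..H, f h * ((∫ t in -(T + 1)..(T + 1), tent T (t - h) * Y t) -
        ∫ t in -(T + 1)..(T + 1), tent T t * Y t) := by
    have a1 : ∀ t, tent T t * ∫ h in 0..H, f h * (Y (t + h) - Y t) =
        tent T t * (∫ h in 0..H, f h * Y (t + h)) - (∫ h in 0..H, f h) * (tent T t * Y t) := by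
      intro t
      simp only [mul_sub]
      rw [intervalIntegral.integral_sub (ci (by fun_prop)) (ci (by fun_prop)),
        intervalIntegral.integral_mul_const]
      ring
    simp only [a1]
    simp only [mul_sub]
    rw [intervalIntegral.integral_sub (ci (by fun_prop)) (ci (by fun_prop)),
      intervalIntegral.integral_sub (ci (by fun_prop)) (ci (by fun_prop)),
      intervalIntegral.integral_mul_const, intervalIntegral.integral_const_mul,
      integral_tent_mul_integral_shift hT h0 h1 hY hf]
  rw [e1]
  have hin : ∀ h, 0 ≤ h → h ≤ 1 → |(∫ t in -(T + 1)..(T + 1), tent T (t - h) * Y t) -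
      ∫ t in -(T + 1)..(T + 1), tent T t * Y t| ≤ 1 / T * I := fun h a1 a2 => by
    rw [← intervalIntegral.integral_sub (ci (by fun_prop)) (ci (by fun_prop)), hI,
      ← intervalIntegral.integral_const_mul]
    refine (intervalIntegral.abs_integral_le_integral_abs (by linarith)).trans ?_
    refine intervalIntegral.integral_mono_on (by linarith) (ci (by fun_prop))
      (ci (by fun_prop)) fun t _ => ?_
    rw [← sub_mul, abs_mul, abs_of_nonneg (hY0 t)]
    refine mul_le_mul_of_nonneg_right ((tent_sub_le hT t h).trans ?_) (hY0 t)
    rw [abs_of_nonneg a1]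
    gcongr
  have hI1 : 0 ≤ 1 / T * I := by positivity
  calc _ ≤ ∫ h in 0..H, |f h * ((∫ t in -(T + 1)..(T + 1), tent T (t - h) * Y t) -
        ∫ t in -(T + 1)..(T + 1), tent T t * Y t)| :=
        intervalIntegral.abs_integral_le_integral_abs h0
    _ ≤ ∫ h in 0..H, 1 / T * I := by
        refine intervalIntegral.integral_mono_on h0 (ci (by fun_prop)) (by simp) fun h hh => ?_
        rw [abs_mul, abs_of_nonneg (hf0 h)]
        calc _ ≤ f h * (1 / T * I) :=
              mul_le_mul_of_nonneg_left (hin h hh.1 (hh.2.trans h1)) (hf0 h)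
          _ ≤ _ := mul_le_of_le_one_left hI1 (hf1 h hh.1)
    _ ≤ _ := by
        rw [intervalIntegral.integral_const, smul_eq_mul, sub_zero]
        exact mul_le_of_le_one_left hI1 h1

lemma continuous_integral_param_prod {n : ℕ} {F : Eu n × ℝ × ℝ → ℝ} {R : ℝ} (hF : Continuous F)
    (hR : ∀ x p, R ≤ ‖x‖ → F (x, p) = 0) : Continuous fun p => ∫ x, F (x, p) := by
  have := continuous_parametric_integral_of_continuous (μ := (volume : Measure (Eu n)))
    (f := fun p x => F (x, p)) (hF.comp continuous_swap)
    (isCompact_closedBall (0 : Eu n) R)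
  exact this.congr fun t => setIntegral_closedBall_eq fun x hx => hR x t hx

namespace HalfSol

variable {n : ℕ} {i₀ : Fin n} {q M : ℝ} {u : Eu n × ℝ → ℝ}

/-- The localized squared increment of `u` between the times `t` and `s`. -/
noncomputable def incr (u : Eu n × ℝ → ℝ) (i₀ : Fin n) (ζ : Eu n → ℝ) (k t s : ℝ) : ℝ :=
  ∫ x, cutFun (k * x i₀) * (1 / 2 * (u (x, s) - u (x, t)) ^ 2 * ζ x)

/-- The localized Dirichlet energy of `u` at time `t`. -/
noncomputable def energy (u : Eu n × ℝ → ℝ) (i₀ : Fin n) (ω : Eu n → ℝ) (k t : ℝ) : ℝ :=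
  ∫ x, cutFun (k * x i₀) * (gradSq u (x, t) * ω x)

/-- The boundary layer term of the energy inequality. -/
noncomputable def flux (u : Eu n × ℝ → ℝ) (i₀ : Fin n) (K : ℝ) (ζ : Eu n → ℝ) (k t s : ℝ) : ℝ :=
  layerInt i₀ k (fun x => -K * ((1 - cutFun (x i₀)) * (ζ x * (u (x, s) - u (x, t)) ^ 2)) -
    fderiv ℝ (fun y => u (y, s)) x (ev i₀) * ((u (x, s) - u (x, t)) * ζ x))

lemma continuousOn_comp_fst (h : HalfSol i₀ q M u) :
    ContinuousOn (fun p : Eu n × ℝ × ℝ => u (p.1, p.2.1)) {p | 0 < p.1 i₀} :=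
  h.continuousOn_pos.comp (by fun_prop) fun _ hp => ⟨hp, mem_univ _⟩

lemma continuousOn_comp_snd (h : HalfSol i₀ q M u) :
    ContinuousOn (fun p : Eu n × ℝ × ℝ => u (p.1, p.2.2)) {p | 0 < p.1 i₀} :=
  h.continuousOn_pos.comp (by fun_prop) fun _ hp => ⟨hp, mem_univ _⟩

lemma continuous_incr (h : HalfSol i₀ q M u) {k r : ℝ} (hk : 0 < k) {ζ : Eu n → ℝ}
    (hζ : Continuous ζ) (hr : ∀ x, r ≤ ‖x‖ → ζ x = 0) :
    Continuous fun p : ℝ × ℝ => incr u i₀ ζ k p.1 p.2 := by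
  refine continuous_integral_param_prod (R := r) (F := fun p : Eu n × ℝ × ℝ =>
    cutFun (k * p.1 i₀) * (1 / 2 * (u (p.1, p.2.2) - u (p.1, p.2.1)) ^ 2 * ζ p.1)) ?_
    fun x p hx => by simp [hr x hx]
  refine continuous_cut_mul hk ((continuous_coord i₀).comp continuous_fst) continuous_cutFun
    (fun _ => cutFun_of_le) ?_
  exact (continuousOn_const.mul ((h.continuousOn_comp_snd.sub h.continuousOn_comp_fst).pow 2)).mul
    (hζ.comp continuous_fst).continuousOn

lemma continuous_energy (h : HalfSol i₀ q M u) {k r : ℝ} (hk : 0 < k) {ω : Eu n → ℝ}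
    (hω : Continuous ω) (hr : ∀ x, r ≤ ‖x‖ → ω x = 0) :
    Continuous fun t => energy u i₀ ω k t :=
  continuous_integral_param (R := r) (F := fun p : Eu n × ℝ =>
    cutFun (k * p.1 i₀) * (gradSq u p * ω p.1)) (continuous_cutFun_mul_prod hk
      (h.continuousOn_gradSq.mul (hω.comp continuous_fst).continuousOn))
    fun x p hx => by simp [hr x hx]

lemma continuous_flux (h : HalfSol i₀ q M u) {k r K : ℝ} (hk : 0 < k) {ζ : Eu n → ℝ}
    (hζ : Continuous ζ) (hr : ∀ x, r ≤ ‖x‖ → ζ x = 0) :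
    Continuous fun p : ℝ × ℝ => flux u i₀ K ζ k p.1 p.2 := by
  refine continuous_integral_param_prod (R := r) (F := fun p : Eu n × ℝ × ℝ =>
    k * cutDeriv (k * p.1 i₀) * (-K * ((1 - cutFun (p.1 i₀)) * (ζ p.1 *
      (u (p.1, p.2.2) - u (p.1, p.2.1)) ^ 2)) - fderiv ℝ (fun y => u (y, p.2.2)) p.1 (ev i₀) *
        ((u (p.1, p.2.2) - u (p.1, p.2.1)) * ζ p.1))) ?_
    fun x p hx => by simp [hr x hx]
  simp only [mul_assoc]
  refine (continuous_cut_mul hk ((continuous_coord i₀).comp continuous_fst) continuous_cutDeriv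
    (fun _ => cutDeriv_of_le) ?_).const_mul k
  have hd := h.continuousOn_comp_snd.sub h.continuousOn_comp_fst
  have hz : ContinuousOn (fun p : Eu n × ℝ × ℝ => ζ p.1) {p | 0 < p.1 i₀} :=
    (hζ.comp continuous_fst).continuousOn
  have hD : ContinuousOn (fun p : Eu n × ℝ × ℝ => fderiv ℝ (fun y => u (y, p.2.2)) p.1 (ev i₀))
      {p | 0 < p.1 i₀} :=
    (h.continuousOn_fderiv i₀).comp (g := fun p : Eu n × ℝ =>
      fderiv ℝ (fun y => u (y, p.2)) p.1 (ev i₀)) (f := fun p : Eu n × ℝ × ℝ => (p.1, p.2.2))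
      (by fun_prop) fun _ hp => ⟨hp, mem_univ _⟩
  have hc : ContinuousOn (fun p : Eu n × ℝ × ℝ => 1 - cutFun (p.1 i₀)) {p | 0 < p.1 i₀} :=
    (continuous_const.sub (continuous_cutFun.comp ((continuous_coord i₀).comp
      continuous_fst))).continuousOn
  exact (continuousOn_const.mul (hc.mul (hz.mul (hd.pow 2)))).sub (hD.mul (hd.mul hz))

lemma energy_nonneg {k : ℝ} (hk : 0 < k) {ω : Eu n → ℝ}
    (hω : ∀ x, 0 ≤ ω x) (t : ℝ) : 0 ≤ energy u i₀ ω k t :=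
  integral_cut_nonneg hk fun x _ => mul_nonneg (gradSq_nonneg _ _) (hω x)

lemma incr_nonneg {k : ℝ} (hk : 0 < k) {ζ : Eu n → ℝ}
    (hζ : ∀ x, 0 ≤ ζ x) (t s : ℝ) : 0 ≤ incr u i₀ ζ k t s :=
  integral_cut_nonneg hk fun x _ => mul_nonneg (by positivity) (hζ x)

lemma exp_mul_incr_le (h : HalfSol i₀ q M u) (hq : 0 ≤ q) {k r c A K : ℝ} (hk : 0 < k) (hc : 0 ≤ c)
    (hK : 0 ≤ K) (hA : ∀ s, cutDeriv s ≤ A) {ζ ω : Eu n → ℝ} (hp : TestPair i₀ r c ζ ω)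
    (t : ℝ) {H κ : ℝ} (hH : 0 ≤ H) (hκ : κ = 2 * (1 + K * A + 2 * K ^ 2)) :
    Real.exp (-(κ * H)) * incr u i₀ ζ k t (t + H) ≤
      ∫ h in 0..H, Real.exp (-(κ * h)) *
        (-(1 / 2) * (energy u i₀ ζ k (t + h) - energy u i₀ ζ k t) +
          c / 4 * energy u i₀ ω k (t + h) + flux u i₀ K ζ k t (t + h)) := by
  have hζc := hp.contDiff.continuous
  have cI := h.continuous_incr hk hζc hp.zero
  have cE := h.continuous_energy hk hζc hp.zero
  have cG := h.continuous_energy hk hp.cont hp.weight_zero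
  have cF := h.continuous_flux (K := K) hk hζc hp.zero
  have cF' : Continuous fun s : ℝ => flux u i₀ K ζ k t (t + s) :=
    cF.comp (g := fun p : ℝ × ℝ => flux u i₀ K ζ k p.1 p.2) (f := fun s : ℝ => (t, t + s))
      (by fun_prop)
  have hder : ∀ s, HasDerivAt (fun s => -(Real.exp (-(κ * s)) * incr u i₀ ζ k t (t + s)))
      (-(Real.exp (-(κ * s)) * (-κ) * incr u i₀ ζ k t (t + s) + Real.exp (-(κ * s)) *
        (∫ x, cutFun (k * x i₀) * (lap (fun y => u (y, t + s)) x *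
          ((u (x, t + s) - u (x, t)) * ζ x))))) s := by
    intro s
    have d1 := h.hasDerivAt_cut_sq_diff hq hk hζc hp.zero t (t + s)
    have d2 : HasDerivAt (fun s => incr u i₀ ζ k t (t + s)) _ s :=
      HasDerivAt.comp_const_add t s d1
    have d3 : HasDerivAt (fun s : ℝ => Real.exp (-(κ * s))) (Real.exp (-(κ * s)) * (-κ)) s := by
      have := ((hasDerivAt_id s).const_mul κ).neg.exp
      simpa using this
    exact (d3.mul d2).neg
  have key := integral_le_sub_of_hasDerivAt (P := fun s => -(Real.exp (-(κ * s)) *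
        (-(1 / 2) * (energy u i₀ ζ k (t + s) - energy u i₀ ζ k t) +
          c / 4 * energy u i₀ ω k (t + s) + flux u i₀ K ζ k t (t + s)))) hder (by fun_prop)
    (fun s => by
      have e1 := h.energy_inequality hk hc hK hA hp t (t + s)
      have e2 := mul_le_mul_of_nonneg_left e1 (Real.exp_pos (-(κ * s))).le
      rw [← hκ] at e2
      simp only [incr, energy, flux]
      linarith) hH
  have z : incr u i₀ ζ k t t = 0 := by simp [incr]
  rw [intervalIntegral.integral_neg] at key
  simp only [add_zero, z, mul_zero, neg_zero, sub_zero] at key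
  linarith

end HalfSol

lemma abs_rpow_sub_rpow_le {q M a b : ℝ} (hq : 1 < q) (ha : 0 < a) (hb : 0 < b) (haM : a ≤ M)
    (hbM : b ≤ M) : |a ^ q - b ^ q| ≤ q * M ^ (q - 1) * |a - b| := by
  have := Convex.norm_image_sub_le_of_norm_hasDerivWithin_le (𝕜 := ℝ) (f := fun s : ℝ => s ^ q)
    (f' := fun s => q * s ^ (q - 1)) (s := Icc 0 M) (C := q * M ^ (q - 1)) (x := b) (y := a)
    (fun s _ => (Real.hasDerivAt_rpow_const (Or.inr hq.le)).hasDerivWithinAt)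
    (fun s hs => by
      have h1 : 0 ≤ s ^ (q - 1) := Real.rpow_nonneg hs.1 _
      rw [Real.norm_of_nonneg (by positivity)]
      have := Real.rpow_le_rpow hs.1 hs.2 (by linarith : 0 ≤ q - 1)
      gcongr) (convex_Icc 0 M) ⟨hb.le, hbM⟩ ⟨ha.le, haM⟩
  simpa only [Real.norm_eq_abs] using this

lemma rpow_mul_sub_le {q M a b : ℝ} (hq : 1 < q) (ha : 0 < a) (hb : 0 < b) (haM : a ≤ M)
    (hbM : b ≤ M) : a ^ q * (a - b) ≤ a ^ (q + 1) / (q + 1) - b ^ (q + 1) / (q + 1) +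
      q * M ^ (q - 1) * (a - b) ^ 2 := by
  have hM : 0 < M := ha.trans_le haM
  have hd : ∀ s : ℝ, HasDerivAt (fun s : ℝ => a ^ q * s - s ^ (q + 1) / (q + 1)) (a ^ q - s ^ q) s := by
    intro s
    have h1 := ((hasDerivAt_id s).const_mul (a ^ q)).sub
      ((Real.hasDerivAt_rpow_const (x := s) (p := q + 1) (Or.inr (by linarith))).div_const (q + 1))
    refine h1.congr_deriv ?_
    rw [add_sub_cancel_right]
    field_simp
  have := Convex.norm_image_sub_le_of_norm_hasDerivWithin_le (𝕜 := ℝ)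
    (f := fun s : ℝ => a ^ q * s - s ^ (q + 1) / (q + 1))
    (f' := fun s => a ^ q - s ^ q) (s := uIcc a b) (C := q * M ^ (q - 1) * |a - b|) (x := b)
    (y := a) (fun s _ => (hd s).hasDerivWithinAt)
    (fun s hs => by
      rw [Real.norm_eq_abs]
      have h1 : min a b ≤ s := hs.1
      have h2 : s ≤ max a b := hs.2
      refine (abs_rpow_sub_rpow_le hq ha ((lt_min ha hb).trans_le h1) haM
        (h2.trans (max_le haM hbM))).trans ?_
      have h3 : |a - s| ≤ |a - b| := by
        rw [abs_sub_comm a s, abs_sub_comm a b]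
        exact abs_sub_left_of_mem_uIcc hs
      have : 0 ≤ M ^ (q - 1) := Real.rpow_nonneg hM.le _
      gcongr) (convex_uIcc a b) right_mem_uIcc left_mem_uIcc
  simp only [Real.norm_eq_abs] at this
  have h2 := (le_abs_self _).trans this
  have h3 : |a - b| * |a - b| = (a - b) ^ 2 := by rw [← sq, sq_abs]
  rw [← h3]
  linarith

namespace HalfSol

variable {n : ℕ} {i₀ : Fin n} {q M : ℝ} {u : Eu n × ℝ → ℝ}

/-- The potential energy of the nonlinear flux on the boundary. -/
noncomputable def bdryEnergy (u : Eu n × ℝ → ℝ) (i₀ : Fin n) (q : ℝ) (ζ : Eu n → ℝ) (t : ℝ) : ℝ :=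
  bdryInt i₀ fun x => u (x, t) ^ (q + 1) / (q + 1) * ζ x

lemma continuousOn_bdryEnergy (h : HalfSol i₀ q M u) (hq : 1 < q) {ζ : Eu n → ℝ}
    (hζ : Continuous ζ) :
    ContinuousOn (fun p : Eu n × ℝ => u p ^ (q + 1) / (q + 1) * ζ p.1) ({x | x i₀ = 0} ×ˢ univ) :=
  ((h.continuousOn_bdry.rpow_const fun _ _ => Or.inr (by linarith)).div_const _).mul
    (hζ.comp continuous_fst).continuousOn

lemma continuous_bdryEnergy (h : HalfSol i₀ q M u) (hq : 1 < q) {r : ℝ} {ζ : Eu n → ℝ}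
    (hζ : Continuous ζ) (hr : ∀ x, r ≤ ‖x‖ → ζ x = 0) : Continuous (bdryEnergy u i₀ q ζ) :=
  continuous_bdryInt_param (R := r) (g := fun p : Eu n × ℝ => u p ^ (q + 1) / (q + 1) * ζ p.1)
    (h.continuousOn_bdryEnergy hq hζ) fun x t hx => by rw [hr x hx, mul_zero]

lemma bdryEnergy_nonneg (h : HalfSol i₀ q M u) (hq : 1 < q) {ζ : Eu n → ℝ}
    (hζ : ∀ x, 0 ≤ ζ x) (t : ℝ) : 0 ≤ bdryEnergy u i₀ q ζ t :=
  bdryInt_nonneg fun x hx => by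
    have := Real.rpow_nonneg (h.pos x hx.ge t).le (q + 1)
    have := hζ x
    positivity

lemma exists_abs_flux_le (h : HalfSol i₀ q M u) (hq : 0 ≤ q) {K r : ℝ} (hK : 0 ≤ K) {ζ : Eu n → ℝ}
    (hζ0 : ∀ x, 0 ≤ ζ x) (hζ1 : ∀ x, ζ x ≤ 1) (hr : ∀ x, r ≤ ‖x‖ → ζ x = 0) :
    ∃ D, ∀ k > 0, ∀ t s, |flux u i₀ K ζ k t s| ≤ D := by
  obtain ⟨L, hL0, hL⟩ := h.normal_lipschitz hq
  have hM := h.M_pos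
  obtain ⟨D, hD⟩ := exists_abs_layerInt_le i₀ (C := K * M ^ 2 + L * M) (R := r) (by positivity)
  refine ⟨D, fun k hk t s => hD k hk _ (fun x hx => ?_) fun x hx => by simp [hr x hx]⟩
  have hδ := h.abs_sub_le_M hx.le hx.le s t
  refine (abs_sub _ _).trans (add_le_add ?_ ?_)
  · rw [abs_mul, abs_neg, abs_of_nonneg hK]
    refine mul_le_mul_of_nonneg_left ?_ hK
    have c0 := cutFun_nonneg (x i₀)
    have c1 := cutFun_le_one (x i₀)
    have h2 : (u (x, s) - u (x, t)) ^ 2 ≤ M ^ 2 := sq_le_sq' (abs_le.1 hδ).1 (abs_le.1 hδ).2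
    have h3 : 0 ≤ ζ x * (u (x, s) - u (x, t)) ^ 2 := mul_nonneg (hζ0 x) (sq_nonneg _)
    have h4 : ζ x * (u (x, s) - u (x, t)) ^ 2 ≤ M ^ 2 :=
      (mul_le_of_le_one_left (sq_nonneg _) (hζ1 x)).trans h2
    rw [abs_of_nonneg (mul_nonneg (by linarith) h3)]
    exact (mul_le_of_le_one_left h3 (by linarith)).trans h4
  · rw [abs_mul, abs_mul, abs_of_nonneg (hζ0 x)]
    refine mul_le_mul (h.abs_fderiv_normal_le hL hx s) ?_ (mul_nonneg (abs_nonneg _) (hζ0 x)) hL0.le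
    exact (mul_le_of_le_one_right (abs_nonneg _) (hζ1 x)).trans hδ

/-- The boundary term of the energy inequality is controlled in the limit by increments of the
potential energy. -/
lemma exists_tendsto_flux_le (h : HalfSol i₀ q M u) (hq : 1 < q) {r : ℝ} {ζ : Eu n → ℝ}
    (hζ : Continuous ζ) (hζ0 : ∀ x, 0 ≤ ζ x) (hζ1 : ∀ x, ζ x ≤ 1) (hr : ∀ x, r ≤ ‖x‖ → ζ x = 0)
    {w : ℝ → ℝ} (hw : Continuous w) (hw0 : ∀ s, 0 ≤ w s) {H : ℝ} (hH : 0 ≤ H) (t : ℝ) :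
    ∃ l ≤ ∫ s in 0..H, w s * (bdryEnergy u i₀ q ζ (t + s) - bdryEnergy u i₀ q ζ t),
      Tendsto (fun m : ℕ => ∫ s in 0..H, w s *
        flux u i₀ (q * M ^ (q - 1)) ζ ((m : ℝ) + 1) t (t + s)) atTop (𝓝 l) := by
  have hM := h.M_pos
  set K := q * M ^ (q - 1) with hK
  have hK0 : 0 ≤ K := by positivity
  have hq0 : 0 ≤ q := by linarith
  have hslice : ContinuousOn (fun p : Eu n × ℝ => u (p.1, t)) ({x | 0 ≤ x i₀} ×ˢ univ) :=
    h.cont.comp (by fun_prop) fun p hp => ⟨hp.1, mem_univ _⟩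
  have hδ := h.cont.sub hslice
  have hz : ContinuousOn (fun p : Eu n × ℝ => ζ p.1) ({x | 0 ≤ x i₀} ×ˢ univ) :=
    (hζ.comp continuous_fst).continuousOn
  have hc : ContinuousOn (fun p : Eu n × ℝ => 1 - cutFun (p.1 i₀)) ({x | 0 ≤ x i₀} ×ˢ univ) :=
    (continuous_const.sub (continuous_cutFun.comp ((continuous_coord i₀).comp
      continuous_fst))).continuousOn
  have hφ := continuousOn_const (c := -K) |>.mul (hc.mul (hz.mul (hδ.pow 2)))
  have hχ := hδ.mul hz
  have hbd : ∀ x : Eu n, 0 < x i₀ → ∀ s, |u (x, s) - u (x, t)| ≤ M := fun x hx s =>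
    h.abs_sub_le_M hx.le hx.le s t
  have lim := h.tendsto_integral_flux hq0 (w := fun s => w (s - t)) (by fun_prop) (R := r)
    (A := K * M ^ 2) (B := M)
    (φ := fun p => -K * ((1 - cutFun (p.1 i₀)) * (ζ p.1 * (u p - u (p.1, t)) ^ 2)))
    (χ := fun p => (u p - u (p.1, t)) * ζ p.1) hφ hχ
    (fun x hx s => by
      simp only
      rw [abs_mul, abs_neg, abs_of_nonneg hK0]
      refine mul_le_mul_of_nonneg_left ?_ hK0
      have c0 := cutFun_nonneg (x i₀)
      have c1 := cutFun_le_one (x i₀)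
      have h2 : (u (x, s) - u (x, t)) ^ 2 ≤ M ^ 2 :=
        sq_le_sq' (abs_le.1 (hbd x hx s)).1 (abs_le.1 (hbd x hx s)).2
      have h3 : 0 ≤ ζ x * (u (x, s) - u (x, t)) ^ 2 := mul_nonneg (hζ0 x) (sq_nonneg _)
      have h4 : ζ x * (u (x, s) - u (x, t)) ^ 2 ≤ M ^ 2 :=
        (mul_le_of_le_one_left (sq_nonneg _) (hζ1 x)).trans h2
      rw [abs_of_nonneg (mul_nonneg (by linarith) h3)]
      exact (mul_le_of_le_one_left h3 (by linarith)).trans h4)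
    (fun x hx s => by
      simp only
      rw [abs_mul, abs_of_nonneg (hζ0 x)]
      exact (mul_le_of_le_one_right (abs_nonneg _) (hζ1 x)).trans (hbd x hx s))
    (fun x s hx => by simp [hr x hx]) (fun x s hx => by simp [hr x hx]) t (t + H)
  have shift : ∀ g : ℝ → ℝ, ∫ s in t..(t + H), w (s - t) * g s = ∫ s in 0..H, w s * g (t + s) := by
    intro g
    have := intervalIntegral.integral_comp_add_left (a := 0) (b := H)
      (fun s => w (s - t) * g s) t
    simp only [add_sub_cancel_left, add_zero] at this
    rw [this]
  refine ⟨_, ?_, lim.congr fun m => shift (fun s => flux u i₀ K ζ ((m : ℝ) + 1) t s)⟩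
  rw [shift]
  have hsub : {x : Eu n | x i₀ = 0} ×ˢ (univ : Set ℝ) ⊆ {x | 0 ≤ x i₀} ×ˢ univ :=
    prod_mono (fun x (hx : x i₀ = 0) => hx.ge) subset_rfl
  have hL := (hφ.mono hsub).add ((h.continuousOn_bdry_rpow hq0).mul (hχ.mono hsub))
  have hLs : ∀ x s, r ≤ ‖x‖ → (-K * ((1 - cutFun (x i₀)) * (ζ x * (u (x, s) - u (x, t)) ^ 2)) +
      u (x, s) ^ q * ((u (x, s) - u (x, t)) * ζ x)) = 0 := fun x s hx => by simp [hr x hx]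
  have hYc := h.continuous_bdryEnergy hq hζ hr
  have hYs : ∀ s, ContinuousOn (fun x => u (x, s) ^ (q + 1) / (q + 1) * ζ x) {x | x i₀ = 0} :=
    fun s => (h.continuousOn_bdryEnergy hq hζ).comp (f := fun x : Eu n => (x, s)) (by fun_prop)
      fun x hx => ⟨hx, mem_univ _⟩
  refine intervalIntegral.integral_mono_on hH (Continuous.intervalIntegrable ?_ _ _)
    (Continuous.intervalIntegrable (by fun_prop) _ _) fun s _ =>
      mul_le_mul_of_nonneg_left ?_ (hw0 s)
  · refine hw.mul ?_
    exact (continuous_bdryInt_param (R := r) hL hLs).comp (continuous_const.add continuous_id)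
  · unfold bdryEnergy
    rw [← bdryInt_sub (R := r) (hYs _) (fun x hx => by rw [hr x hx, mul_zero]) (hYs _)
      (fun x hx => by rw [hr x hx, mul_zero])]
    refine bdryInt_mono (R := r) ?_ (fun x hx => hLs x _ hx) ((hYs _).sub (hYs _))
      (fun x hx => by simp [hr x hx]) fun x hx => ?_
    · exact hL.comp (f := fun x : Eu n => (x, t + s)) (by fun_prop) fun x hx => ⟨hx, mem_univ _⟩
    · rw [hx, cutFun_of_le zero_le_one]
      have := mul_le_mul_of_nonneg_left (rpow_mul_sub_le hq (h.pos x hx.ge (t + s))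
        (h.pos x hx.ge t) (h.le x hx.ge (t + s)) (h.le x hx.ge t)) (hζ0 x)
      rw [← hK] at this
      linarith

end HalfSol

namespace HalfSol

variable {n : ℕ} {i₀ : Fin n} {q M : ℝ} {u : Eu n × ℝ → ℝ}

lemma continuous_integral_flux (h : HalfSol i₀ q M u) {k r K : ℝ} (hk : 0 < k) {ζ : Eu n → ℝ}
    (hζ : Continuous ζ) (hr : ∀ x, r ≤ ‖x‖ → ζ x = 0) {w : ℝ → ℝ} (hw : Continuous w) (H : ℝ) :
    Continuous fun t => ∫ s in 0..H, w s * flux u i₀ K ζ k t (t + s) := by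
  refine intervalIntegral.continuous_parametric_intervalIntegral_of_continuous' ?_ _ _
  unfold Function.uncurry
  refine (hw.comp continuous_snd).mul ?_
  exact (h.continuous_flux (K := K) hk hζ hr).comp (f := fun p : ℝ × ℝ => (p.1, p.1 + p.2))
    (by fun_prop)

lemma eventually_integral_tent_flux_le (h : HalfSol i₀ q M u) (hq : 1 < q) {r : ℝ} {ζ : Eu n → ℝ}
    (hζ : Continuous ζ) (hζ0 : ∀ x, 0 ≤ ζ x) (hζ1 : ∀ x, ζ x ≤ 1) (hr : ∀ x, r ≤ ‖x‖ → ζ x = 0)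
    {w : ℝ → ℝ} (hw : Continuous w) (hw0 : ∀ s, 0 ≤ w s) (hw1 : ∀ s, 0 ≤ s → w s ≤ 1)
    {H T ε : ℝ} (hH : 0 ≤ H) (hH1 : H ≤ 1) (hT : 0 < T) (hε : 0 < ε) :
    ∀ᶠ m : ℕ in atTop, ∫ t in -(T + 1)..(T + 1), tent T t * ∫ s in 0..H, w s *
        flux u i₀ (q * M ^ (q - 1)) ζ ((m : ℝ) + 1) t (t + s) ≤
      1 / T * (∫ t in -(T + 1)..(T + 1), bdryEnergy u i₀ q ζ t) + ε := by
  have hM := h.M_pos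
  set K := q * M ^ (q - 1) with hK
  have hK0 : 0 ≤ K := by positivity
  have hm : ∀ m : ℕ, (0 : ℝ) < (m : ℝ) + 1 := fun m => by positivity
  obtain ⟨D, hD⟩ := h.exists_abs_flux_le (by linarith) hK0 hζ0 hζ1 hr
  set Y := bdryEnergy u i₀ q ζ with hY
  have hYc : Continuous Y := h.continuous_bdryEnergy hq hζ hr
  set v : ℝ → ℝ := fun t => ∫ s in 0..H, w s * (Y (t + s) - Y t) with hv
  have hvc : Continuous v :=
    intervalIntegral.continuous_parametric_intervalIntegral_of_continuous' (by
      unfold Function.uncurry; fun_prop) _ _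
  set ρ : ℕ → ℝ → ℝ := fun m t => ∫ s in 0..H, w s * flux u i₀ K ζ ((m : ℝ) + 1) t (t + s) with hρ
  have hρc : ∀ m, Continuous (ρ m) := fun m => h.continuous_integral_flux (hm m) hζ hr hw H
  have hD0 : 0 ≤ D := (abs_nonneg _).trans (hD 1 one_pos 0 0)
  have hρD : ∀ m t, |ρ m t| ≤ D := by
    intro m t
    refine (intervalIntegral.abs_integral_le_integral_abs hH).trans ?_
    have h1 : ∫ s in 0..H, |w s * flux u i₀ K ζ ((m : ℝ) + 1) t (t + s)| ≤ ∫ s in 0..H, D := by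
      refine intervalIntegral.integral_mono_on hH (Continuous.intervalIntegrable ?_ _ _) (by simp)
        fun s hs => ?_
      · refine (hw.mul ?_).abs
        exact (h.continuous_flux (K := K) (hm m) hζ hr).comp (f := fun s : ℝ => (t, t + s))
          (by fun_prop)
      · rw [abs_mul, abs_of_nonneg (hw0 s)]
        exact (mul_le_of_le_one_left (abs_nonneg _) (hw1 s hs.1)).trans (hD _ (hm m) _ _)
    refine h1.trans ?_
    rw [intervalIntegral.integral_const, smul_eq_mul, sub_zero]
    exact mul_le_of_le_one_left hD0 hH1
  have hθ := continuous_tent T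
  have lim : Tendsto (fun m => ∫ t in -(T + 1)..(T + 1), tent T t * max (ρ m t - v t) 0) atTop
      (𝓝 (∫ t in -(T + 1)..(T + 1), (0 : ℝ))) := by
    refine intervalIntegral.tendsto_integral_filter_of_dominated_convergence
      (fun t => D + |v t|) (Eventually.of_forall fun m => ?_)
      (Eventually.of_forall fun m => Eventually.of_forall fun t _ => ?_)
      (Continuous.intervalIntegrable (by fun_prop) _ _) (Eventually.of_forall fun t _ => ?_)
    · have := hρc m
      exact Continuous.aestronglyMeasurable (by fun_prop)
    · have h0 : 0 ≤ max (ρ m t - v t) 0 := le_max_right _ _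
      rw [Real.norm_of_nonneg (mul_nonneg (tent_nonneg T t) h0)]
      refine (mul_le_of_le_one_left h0 (tent_le_one hT t)).trans (max_le ?_ (by positivity))
      linarith [le_abs_self (ρ m t), hρD m t, neg_abs_le (v t)]
    · obtain ⟨l, hl, hlim⟩ := h.exists_tendsto_flux_le hq hζ hζ0 hζ1 hr hw hw0 hH t
      have h1 := (((hlim.sub_const (v t)).max (tendsto_const_nhds (x := (0 : ℝ)))).const_mul
        (tent T t))
      have h2 : max (l - v t) 0 = 0 := max_eq_right (by linarith)
      rw [h2, mul_zero] at h1
      exact h1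
  simp only [intervalIntegral.integral_zero] at lim
  filter_upwards [lim.eventually_lt_const hε] with m hlt
  have hc := hρc m
  have e1 : ∫ t in -(T + 1)..(T + 1), tent T t * ρ m t ≤
      ∫ t in -(T + 1)..(T + 1), (tent T t * v t + tent T t * max (ρ m t - v t) 0) := by
    refine intervalIntegral.integral_mono_on (by linarith)
      (Continuous.intervalIntegrable (by fun_prop) _ _)
      (Continuous.intervalIntegrable (by fun_prop) _ _) fun t _ => ?_
    rw [← mul_add]
    exact mul_le_mul_of_nonneg_left (by linarith [le_max_left (ρ m t - v t) 0]) (tent_nonneg T t)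
  rw [intervalIntegral.integral_add (Continuous.intervalIntegrable (by fun_prop) _ _)
    (Continuous.intervalIntegrable (by fun_prop) _ _)] at e1
  have e2 := (le_abs_self _).trans (abs_integral_tent_diff_le hT hH hH1 hYc hw
    (fun t => h.bdryEnergy_nonneg hq hζ0 t) hw0 hw1)
  linarith

lemma exp_mul_integral_tent_incr_le (h : HalfSol i₀ q M u) (hq : 0 ≤ q) {k r c A K : ℝ}
    (hk : 0 < k) (hc : 0 ≤ c) (hK : 0 ≤ K) (hA : ∀ s, cutDeriv s ≤ A) {ζ ω : Eu n → ℝ}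
    (hp : TestPair i₀ r c ζ ω) {H κ T : ℝ} (hH : 0 ≤ H) (hH1 : H ≤ 1) (hT : 0 < T) (hκ0 : 0 ≤ κ)
    (hκ : κ = 2 * (1 + K * A + 2 * K ^ 2)) :
    Real.exp (-(κ * H)) * (∫ t in -(T + 1)..(T + 1), tent T t * incr u i₀ ζ k t (t + H)) ≤
      1 / 2 * (1 / T * ∫ t in -(T + 1)..(T + 1), energy u i₀ ζ k t) +
      c / 4 * (∫ t in -(T + 1)..(T + 1), energy u i₀ ω k t) +
      ∫ t in -(T + 1)..(T + 1), tent T t * ∫ s in 0..H, Real.exp (-(κ * s)) *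
        flux u i₀ K ζ k t (t + s) := by
  have hζc := hp.contDiff.continuous
  have cE := h.continuous_energy hk hζc hp.zero
  have cG := h.continuous_energy hk hp.cont hp.weight_zero
  have cF : ∀ t, Continuous fun s : ℝ => flux u i₀ K ζ k t (t + s) := fun t =>
    (h.continuous_flux (K := K) hk hζc hp.zero).comp (f := fun s : ℝ => (t, t + s)) (by fun_prop)
  have cI : Continuous fun t => incr u i₀ ζ k t (t + H) :=
    (h.continuous_incr hk hζc hp.zero).comp (f := fun s : ℝ => (s, s + H)) (by fun_prop)
  have hθ := continuous_tent T
  set w : ℝ → ℝ := fun s => Real.exp (-(κ * s)) with hw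
  have hwc : Continuous w := by fun_prop
  have hw0 : ∀ s, 0 ≤ w s := fun s => (Real.exp_pos _).le
  have hw1 : ∀ s, 0 ≤ s → w s ≤ 1 := fun s hs => Real.exp_le_one_iff.2 (by
    have := mul_nonneg hκ0 hs
    linarith)
  have ci : ∀ {g : ℝ → ℝ} {a b : ℝ}, Continuous g → IntervalIntegrable g volume a b :=
    fun hg => hg.intervalIntegrable _ _
  have cp : ∀ {g : ℝ → ℝ → ℝ}, Continuous (Function.uncurry g) →
      Continuous fun t => ∫ s in 0..H, g t s := fun hg =>
    intervalIntegral.continuous_parametric_intervalIntegral_of_continuous' hg _ _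
  have c1 : Continuous fun t => ∫ s in 0..H, w s * (energy u i₀ ζ k (t + s) - energy u i₀ ζ k t) :=
    cp (by unfold Function.uncurry; fun_prop)
  have c2 : Continuous fun t => ∫ s in 0..H, w s * energy u i₀ ω k (t + s) :=
    cp (by unfold Function.uncurry; fun_prop)
  have c3 := h.continuous_integral_flux (K := K) hk hζc hp.zero hwc H
  have pt : ∀ t, tent T t * (w H * incr u i₀ ζ k t (t + H)) ≤
      -(1 / 2) * (tent T t * ∫ s in 0..H, w s * (energy u i₀ ζ k (t + s) - energy u i₀ ζ k t)) +
      c / 4 * (tent T t * ∫ s in 0..H, w s * energy u i₀ ω k (t + s)) +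
      tent T t * ∫ s in 0..H, w s * flux u i₀ K ζ k t (t + s) := by
    intro t
    have h1 := h.exp_mul_incr_le hq hk hc hK hA hp t hH hκ
    have e1 : ∫ s in 0..H, Real.exp (-(κ * s)) *
        (-(1 / 2) * (energy u i₀ ζ k (t + s) - energy u i₀ ζ k t) +
          c / 4 * energy u i₀ ω k (t + s) + flux u i₀ K ζ k t (t + s)) =
        -(1 / 2) * (∫ s in 0..H, w s * (energy u i₀ ζ k (t + s) - energy u i₀ ζ k t)) +
        c / 4 * (∫ s in 0..H, w s * energy u i₀ ω k (t + s)) +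
        ∫ s in 0..H, w s * flux u i₀ K ζ k t (t + s) := by
      have := cF t
      rw [← intervalIntegral.integral_const_mul, ← intervalIntegral.integral_const_mul,
        ← intervalIntegral.integral_add (ci (by fun_prop)) (ci (by fun_prop)),
        ← intervalIntegral.integral_add (ci (by fun_prop)) (ci (by fun_prop))]
      congr 1
      funext s
      simp only [hw]
      ring
    rw [e1] at h1
    have h2 := mul_le_mul_of_nonneg_left h1 (tent_nonneg T t)
    simp only [hw] at h2 ⊢
    linarith
  have key := intervalIntegral.integral_mono_on (μ := volume) (a := -(T + 1)) (b := T + 1)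
    (by linarith) (ci (by fun_prop)) (ci (by fun_prop)) fun t _ => pt t
  rw [intervalIntegral.integral_add (ci (by fun_prop)) (ci (by fun_prop)),
    intervalIntegral.integral_add (ci (by fun_prop)) (ci (by fun_prop)),
    intervalIntegral.integral_const_mul, intervalIntegral.integral_const_mul] at key
  have e3 : ∫ t in -(T + 1)..(T + 1), tent T t * (w H * incr u i₀ ζ k t (t + H)) =
      w H * ∫ t in -(T + 1)..(T + 1), tent T t * incr u i₀ ζ k t (t + H) := by
    rw [← intervalIntegral.integral_const_mul]
    congr 1
    funext t
    ring
  rw [e3] at key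
  have e4 := (neg_abs_le _).trans' (neg_le_neg (abs_integral_tent_diff_le hT hH hH1 cE hwc
    (fun t => energy_nonneg hk hp.nonneg t) hw0 hw1))
  have e5 := mul_le_mul_of_nonneg_left (integral_tent_shift_le hT hH hH1 cG hwc
    (fun t => energy_nonneg hk hp.weight_nonneg t) hw0 hw1) (by positivity : 0 ≤ c / 4)
  linarith

end HalfSol

/-- A cutoff centred at height two above the boundary, so that it increases in the normal direction
near the boundary. -/
noncomputable def bump {n : ℕ} (i₀ : Fin n) (R : ℝ) (x : Eu n) : ℝ :=
  cap R (x - (2 : ℝ) • ev i₀) ^ 2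

section BumpPair

variable {n : ℕ} {i₀ : Fin n} {R : ℝ}

lemma norm_le_of_cap_ne_zero (hR : 0 < R) {y : Eu n} (h : cap R y ≠ 0) : ‖y‖ < R := by
  by_contra! hy
  exact h (cap_eq_zero hR hy)

lemma fderiv_bump (x : Eu n) (i : Fin n) : fderiv ℝ (bump i₀ R) x (ev i) =
    2 * cap R (x - (2 : ℝ) • ev i₀) * (-(2 * (x - (2 : ℝ) • ev i₀) i) / R ^ 2) := by
  have h1 := fderiv_cap_pow R 0 (x - (2 : ℝ) • ev i₀) i
  have h2 : bump i₀ R = fun x => (fun y : Eu n => cap R y ^ (0 + 2)) (x - (2 : ℝ) • ev i₀) := rfl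
  rw [h2, fderiv_comp_sub (f := fun y : Eu n => cap R y ^ (0 + 2)), h1]
  simp

lemma sum_fderiv_bump_sq_le (hR : 0 < R) (x : Eu n) :
    ∑ i, fderiv ℝ (bump i₀ R) x (ev i) ^ 2 ≤ 16 / R ^ 2 * bump i₀ R x := by
  simp only [fderiv_bump]
  set y := x - (2 : ℝ) • ev i₀ with hy
  have e : ∀ i, (2 * cap R y * (-(2 * y i) / R ^ 2)) ^ 2 = 16 * cap R y ^ 2 / R ^ 4 * y i ^ 2 := by
    intro i
    field_simp
    ring
  simp only [e]
  rw [← Finset.mul_sum, ← EuclideanSpace.real_norm_sq_eq, bump, ← hy]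
  by_cases h : cap R y = 0
  · simp [h]
  · have h1 := norm_le_of_cap_ne_zero hR h
    have h2 : ‖y‖ ^ 2 ≤ R ^ 2 := by gcongr
    calc 16 * cap R y ^ 2 / R ^ 4 * ‖y‖ ^ 2 ≤ 16 * cap R y ^ 2 / R ^ 4 * R ^ 2 := by gcongr
      _ = _ := by field_simp

lemma bump_nonneg (x : Eu n) : 0 ≤ bump i₀ R x := sq_nonneg _

lemma norm_two_smul_ev : ‖(2 : ℝ) • (ev i₀ : Eu n)‖ = 2 := by
  rw [norm_smul]
  simp

lemma norm_lt_of_bump_ne_zero (hR : 0 < R) {x : Eu n} (h : bump i₀ R x ≠ 0) : ‖x‖ < R + 2 := by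
  have h1 : cap R (x - (2 : ℝ) • ev i₀) ≠ 0 := fun h0 => h (by simp [bump, h0])
  have h2 := norm_le_of_cap_ne_zero hR h1
  have h3 := norm_sub_norm_le x ((2 : ℝ) • ev i₀)
  rw [norm_two_smul_ev] at h3
  linarith

lemma bump_le_mul_cap (hR : 4 ≤ R) (x : Eu n) :
    bump i₀ R x ≤ 28 * (bump i₀ R x * cap (2 * R) x ^ 4) := by
  by_cases h : bump i₀ R x = 0
  · simp [h]
  · have h1 := norm_lt_of_bump_ne_zero (by linarith) h
    have h2 : ‖x‖ ^ 2 / (2 * R) ^ 2 ≤ 9 / 16 := by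
      rw [div_le_iff₀ (by positivity)]
      nlinarith [norm_nonneg x]
    have h3 : 7 / 16 ≤ cap (2 * R) x := le_max_of_le_left (by linarith)
    have h4 : (7 / 16 : ℝ) ^ 4 ≤ cap (2 * R) x ^ 4 := by gcongr
    have h5 : 1 ≤ 28 * cap (2 * R) x ^ 4 := by
      refine le_trans ?_ (mul_le_mul_of_nonneg_left h4 (by norm_num))
      norm_num
    nlinarith [bump_nonneg (i₀ := i₀) (R := R) x]

lemma bump_le_one (x : Eu n) : bump i₀ R x ≤ 1 :=
  pow_le_one₀ (cap_nonneg _ _) (cap_le_one _ _)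

lemma testPair_bump (hR : 4 ≤ R) : TestPair i₀ (2 * R) (448 / R ^ 2) (bump i₀ R)
    (fun x => cap (2 * R) x ^ 4) where
  contDiff := (contDiff_cap_pow_two R 0).comp (contDiff_id.sub contDiff_const)
  cont := (continuous_cap _).pow 4
  nonneg := bump_nonneg
  le_one := bump_le_one
  weight_nonneg x := by positivity
  zero x hx := by
    by_contra h
    have := norm_lt_of_bump_ne_zero (by linarith) h
    linarith
  weight_zero x hx := by rw [cap_eq_zero (by linarith) hx]; norm_num
  mono x hx := by
    rw [fderiv_bump]
    refine mul_nonneg (mul_nonneg (by norm_num) (cap_nonneg _ _)) (div_nonneg ?_ (by positivity))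
    simp
    linarith
  grad x := by
    have hR0 : 0 < R := by linarith
    refine (sum_fderiv_bump_sq_le hR0 x).trans ?_
    have := mul_le_mul_of_nonneg_left (bump_le_mul_cap (i₀ := i₀) hR x)
      (by positivity : 0 ≤ 16 / R ^ 2)
    refine this.trans_eq ?_
    ring

lemma cap_mono {R' : ℝ} (hR : 0 < R) (h : R ≤ R') (x : Eu n) : cap R x ≤ cap R' x :=
  max_le_max (sub_le_sub_left (div_le_div_of_nonneg_left (by positivity) (by positivity)
    (by gcongr)) _) le_rfl

lemma bump_mono {R' : ℝ} (hR : 0 < R) (h : R ≤ R') (x : Eu n) : bump i₀ R x ≤ bump i₀ R' x :=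
  pow_le_pow_left₀ (cap_nonneg _ _) (cap_mono hR h _) 2

end BumpPair

namespace HalfSol

variable {n : ℕ} {i₀ : Fin n} {q M : ℝ} {u : Eu n × ℝ → ℝ}

lemma energy_bump_le (h : HalfSol i₀ q M u) {k R : ℝ} (hk : 0 < k) (hR : 4 ≤ R) (t : ℝ) :
    energy u i₀ (bump i₀ R) k t ≤ 28 * energy u i₀ (fun x => cap (2 * R) x ^ 4) k t := by
  have hp := testPair_bump (i₀ := i₀) hR
  unfold energy
  rw [← integral_cut_const_mul]
  have hg := h.continuousOn_gradSq_slice t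
  refine integral_cut_mono (R := 2 * R) hk (hg.mul hp.contDiff.continuous.continuousOn)
    (continuousOn_const.mul (hg.mul hp.cont.continuousOn))
    (fun x hx => by rw [hp.zero x hx, mul_zero])
    (fun x hx => by
      have := hp.weight_zero x hx
      simp only at this ⊢
      rw [this, mul_zero, mul_zero]) fun x _ => ?_
  have h1 := bump_le_mul_cap (i₀ := i₀) hR x
  have h2 : bump i₀ R x * cap (2 * R) x ^ 4 ≤ cap (2 * R) x ^ 4 :=
    mul_le_of_le_one_left (by positivity) (bump_le_one x)
  have h3 := mul_le_mul_of_nonneg_left (by linarith : bump i₀ R x ≤ 28 * cap (2 * R) x ^ 4)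
    (gradSq_nonneg u (x, t))
  linarith

lemma bdryEnergy_le (h : HalfSol i₀ q M u) (hq : 1 < q) {r : ℝ} {ζ : Eu n → ℝ}
    (hζ : Continuous ζ) (hζ0 : ∀ x, 0 ≤ ζ x) (hr : ∀ x, r ≤ ‖x‖ → ζ x = 0) (t : ℝ) :
    bdryEnergy u i₀ q ζ t ≤ M / (q + 1) * bdryInt i₀ fun x => u (x, t) ^ q * ζ x := by
  unfold bdryEnergy
  rw [← bdryInt_const_mul]
  have hsl : ∀ {g : Eu n × ℝ → ℝ}, ContinuousOn g ({x | x i₀ = 0} ×ˢ univ) →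
      ContinuousOn (fun x => g (x, t)) {x | x i₀ = 0} := fun hg =>
    hg.comp (f := fun x : Eu n => (x, t)) (by fun_prop) fun x hx => ⟨hx, mem_univ _⟩
  refine bdryInt_mono (R := r) (hsl (h.continuousOn_bdryEnergy hq hζ))
    (fun x hx => by rw [hr x hx, mul_zero]) (continuousOn_const.mul
      ((hsl (h.continuousOn_bdry_rpow (by linarith))).mul hζ.continuousOn))
    (fun x hx => by rw [hr x hx, mul_zero, mul_zero]) fun x hx => ?_
  have hu := h.pos x hx.ge t
  rw [Real.rpow_add_one hu.ne']
  have h1 : 0 ≤ u (x, t) ^ q * ζ x / (q + 1) :=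
    div_nonneg (mul_nonneg (Real.rpow_nonneg hu.le _) (hζ0 x)) (by linarith)
  have h2 := mul_le_mul_of_nonneg_right (h.le x hx.ge t) h1
  refine (Eq.le ?_).trans (h2.trans_eq ?_) <;> ring

lemma incr_mono_cut (h : HalfSol i₀ q M u) {k k' r : ℝ} (hk : 0 < k) (hkk : k ≤ k') {ζ : Eu n → ℝ}
    (hζ : Continuous ζ) (hζ0 : ∀ x, 0 ≤ ζ x) (hr : ∀ x, r ≤ ‖x‖ → ζ x = 0) (t s : ℝ) :
    incr u i₀ ζ k t s ≤ incr u i₀ ζ k' t s := by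
  have hc : ContinuousOn (fun x => 1 / 2 * (u (x, s) - u (x, t)) ^ 2 * ζ x) {x | 0 < x i₀} :=
    (continuousOn_const.mul (((h.continuousOn_slice s).sub (h.continuousOn_slice t)).pow 2)).mul
      hζ.continuousOn
  have hi : ∀ k, 0 < k → Integrable fun x =>
      cutFun (k * x i₀) * (1 / 2 * (u (x, s) - u (x, t)) ^ 2 * ζ x) := fun k hk =>
    integrable_of_continuous_of_zero (R := r) (continuous_cutFun_mul hk hc)
      fun x hx => by rw [hr x hx]; ring
  refine integral_mono (hi k hk) (hi k' (hk.trans_le hkk)) fun x => ?_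
  simp only
  by_cases hx : 0 < x i₀
  · refine mul_le_mul_of_nonneg_right (cutFun_monotone (by gcongr)) ?_
    have := hζ0 x
    positivity
  · have hx' := not_lt.1 hx
    rw [cutFun_of_le (by nlinarith), cutFun_of_le (by nlinarith)]

/-- The space-time averaged increments of `u` are small on large balls. -/
lemma exists_tent_incr_le (h : HalfSol i₀ q M u) (hq : 1 < q) :
    ∃ C, ∀ R, 4 ≤ R → ∀ k > 0, ∀ H, 0 ≤ H → H ≤ 1 →
      ∫ t in -(R ^ 2 + 1)..(R ^ 2 + 1), tent (R ^ 2) t * incr u i₀ (bump i₀ R) k t (t + H) ≤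
        C * (2 * R) ^ ((n : ℝ) - 1 / (q - 1) - 2) := by
  obtain ⟨A, hA0, hA⟩ := exists_cutDeriv_le
  obtain ⟨C1, hC1, hball⟩ := h.exists_ball_estimate hq
  obtain ⟨C2, hC2, hgrad⟩ := h.exists_grad_estimate hq
  have hM := h.M_pos
  set K := q * M ^ (q - 1) with hK
  have hK0 : 0 ≤ K := by positivity
  set κ := 2 * (1 + K * A + 2 * K ^ 2) with hκ
  have hκ0 : 0 ≤ κ := by positivity
  refine ⟨Real.exp κ * (1008 * C2 + 8 * C1 * (M / (q + 1))), fun R hR k hk H hH hH1 => ?_⟩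
  set X := (2 * R) ^ ((n : ℝ) - 1 / (q - 1) - 2) with hX
  have hR0 : 0 < R := by linarith
  have hX0 : 0 < X := Real.rpow_pos_of_pos (by positivity) _
  have hT : 0 < R ^ 2 := by positivity
  have hp := testPair_bump (i₀ := i₀) hR
  have hζ := hp.contDiff.continuous
  have ci : ∀ {g : ℝ → ℝ} {a b : ℝ}, Continuous g → IntervalIntegrable g volume a b :=
    fun hg => hg.intervalIntegrable _ _
  have hθ := continuous_tent (R ^ 2)
  have cI : ∀ {k}, 0 < k → Continuous fun t => incr u i₀ (bump i₀ R) k t (t + H) := fun hk =>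
    (h.continuous_incr hk hζ hp.zero).comp (f := fun s : ℝ => (s, s + H)) (by fun_prop)
  set I := ∫ t in -(R ^ 2 + 1)..(R ^ 2 + 1), tent (R ^ 2) t * incr u i₀ (bump i₀ R) k t (t + H)
    with hI
  have hI0 : 0 ≤ I := intervalIntegral.integral_nonneg (by linarith) fun t _ =>
    mul_nonneg (tent_nonneg _ _) (incr_nonneg hk hp.nonneg _ _)
  have hlen : (2 * R) ^ 2 + (R ^ 2 + 1 - -(R ^ 2 + 1)) ≤ 8 * R ^ 2 := by nlinarith
  have hY : ∫ t in -(R ^ 2 + 1)..(R ^ 2 + 1), bdryEnergy u i₀ q (bump i₀ R) t ≤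
      M / (q + 1) * (C1 * X * (8 * R ^ 2)) := by
    have cB : Continuous fun t => bdryInt i₀ fun x => u (x, t) ^ q * bump i₀ R x :=
      continuous_bdryInt_param (R := 2 * R) (g := fun p : Eu n × ℝ => u p ^ q * bump i₀ R p.1)
        ((h.continuousOn_bdry_rpow (by linarith)).mul (hζ.comp continuous_fst).continuousOn)
        fun x t hx => by rw [hp.zero x hx, mul_zero]
    have h1 := intervalIntegral.integral_mono_on (μ := volume) (a := -(R ^ 2 + 1))
      (b := R ^ 2 + 1) (by linarith) (ci (h.continuous_bdryEnergy hq hζ hp.zero))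
      (ci (cB.const_mul (M / (q + 1)))) fun t _ => h.bdryEnergy_le hq hζ hp.nonneg hp.zero t
    rw [intervalIntegral.integral_const_mul] at h1
    refine h1.trans (mul_le_mul_of_nonneg_left ?_ (by positivity))
    refine ((hball (2 * R) (by positivity) _ hζ hp.nonneg hp.le_one hp.zero).2 _ _
      (by linarith)).trans ?_
    exact mul_le_mul_of_nonneg_left hlen (by positivity)
  have hκe : Real.exp (-κ) * I ≤ (1008 * C2 + 8 * C1 * (M / (q + 1))) * X := by
    refine le_of_forall_pos_le_add fun ε hε => ?_
    have ev1 := h.eventually_integral_tent_flux_le hq hζ hp.nonneg hp.le_one hp.zero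
      (w := fun s => Real.exp (-(κ * s))) (by fun_prop) (fun s => (Real.exp_pos _).le)
      (fun s hs => Real.exp_le_one_iff.2 (by
        have := mul_nonneg hκ0 hs
        linarith)) hH hH1 hT hε
    have ev2 := hgrad (2 * R) (by positivity) (-(R ^ 2 + 1)) (R ^ 2 + 1) (by linarith)
    have ev3 : ∀ᶠ m : ℕ in atTop, k ≤ (m : ℝ) :=
      tendsto_natCast_atTop_atTop.eventually (eventually_ge_atTop k)
    obtain ⟨m, hm1, hm2, hm3⟩ := (ev1.and (ev2.and ev3)).exists
    have hm0 : (0 : ℝ) < (m : ℝ) + 1 := by positivity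
    have key := h.exp_mul_integral_tent_incr_le (by linarith) hm0 (by positivity) hK0 hA hp hH hH1
      hT hκ0 hκ
    have g1 : ∫ t in -(R ^ 2 + 1)..(R ^ 2 + 1), energy u i₀ (fun x => cap (2 * R) x ^ 4)
        ((m : ℝ) + 1) t ≤ C2 * X * (8 * R ^ 2) :=
      hm2.trans (mul_le_mul_of_nonneg_left hlen (by positivity))
    have cG := h.continuous_energy hm0 hp.cont hp.weight_zero
    have g2 := intervalIntegral.integral_mono_on (μ := volume) (a := -(R ^ 2 + 1))
      (b := R ^ 2 + 1) (by linarith) (ci (h.continuous_energy hm0 hζ hp.zero))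
      (ci (cG.const_mul 28)) fun t _ => h.energy_bump_le hm0 hR t
    rw [intervalIntegral.integral_const_mul] at g2
    have g3 : I ≤ ∫ t in -(R ^ 2 + 1)..(R ^ 2 + 1), tent (R ^ 2) t *
        incr u i₀ (bump i₀ R) ((m : ℝ) + 1) t (t + H) :=
      intervalIntegral.integral_mono_on (by linarith) (ci (hθ.mul (cI hk))) (ci (hθ.mul (cI hm0)))
        fun t _ => mul_le_mul_of_nonneg_left
          (h.incr_mono_cut hk (by linarith) hζ hp.nonneg hp.zero _ _) (tent_nonneg _ _)
    have g4 : Real.exp (-κ) * I ≤ Real.exp (-(κ * H)) * I :=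
      mul_le_mul_of_nonneg_right (Real.exp_le_exp.2
        (neg_le_neg (mul_le_of_le_one_right hκ0 hH1))) hI0
    have g5 := mul_le_mul_of_nonneg_left g3 (Real.exp_pos (-(κ * H))).le
    have g6 : 1 / 2 * (1 / R ^ 2 * ∫ t in -(R ^ 2 + 1)..(R ^ 2 + 1),
        energy u i₀ (bump i₀ R) ((m : ℝ) + 1) t) ≤ 112 * C2 * X := by
      calc _ ≤ 1 / 2 * (1 / R ^ 2 * (28 * (C2 * X * (8 * R ^ 2)))) := by
            gcongr
            linarith
        _ = _ := by field_simp; ring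
    have g7 : 448 / R ^ 2 / 4 * (∫ t in -(R ^ 2 + 1)..(R ^ 2 + 1),
        energy u i₀ (fun x => cap (2 * R) x ^ 4) ((m : ℝ) + 1) t) ≤ 896 * C2 * X := by
      calc _ ≤ 448 / R ^ 2 / 4 * (C2 * X * (8 * R ^ 2)) := by gcongr
        _ = _ := by field_simp; ring
    have g8 : 1 / R ^ 2 * (∫ t in -(R ^ 2 + 1)..(R ^ 2 + 1), bdryEnergy u i₀ q (bump i₀ R) t) ≤
        8 * C1 * (M / (q + 1)) * X := by
      calc _ ≤ 1 / R ^ 2 * (M / (q + 1) * (C1 * X * (8 * R ^ 2))) := by gcongr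
        _ = _ := by field_simp
    linarith
  calc I = Real.exp κ * (Real.exp (-κ) * I) := by
        rw [← mul_assoc, ← Real.exp_add, add_neg_cancel, Real.exp_zero, one_mul]
    _ ≤ Real.exp κ * ((1008 * C2 + 8 * C1 * (M / (q + 1))) * X) := by gcongr
    _ = _ := by ring

end HalfSol

lemma cap_pos {n : ℕ} {R : ℝ} {x : Eu n} (h : ‖x‖ < R) : 0 < cap R x := by
  have hR : 0 < R := (norm_nonneg x).trans_lt h
  refine lt_max_of_lt_left (sub_pos.2 ((div_lt_one (by positivity)).2 ?_))
  exact pow_lt_pow_left₀ h (norm_nonneg x) two_ne_zero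

lemma tent_pos {T t : ℝ} (h : |t| < T) : 0 < tent T t :=
  lt_max_of_lt_left (sub_pos.2 ((div_lt_one ((abs_nonneg t).trans_lt h)).2 h))

lemma eq_zero_of_integral_cut_nonpos {n : ℕ} {i₀ : Fin n} {k R : ℝ} (hk : 0 < k) {f : Eu n → ℝ}
    (hf : ContinuousOn f {x | 0 < x i₀}) (hR : ∀ x, R ≤ ‖x‖ → f x = 0)
    (h0 : ∀ x, 0 ≤ f x) (hI : ∫ x, cutFun (k * x i₀) * f x ≤ 0) {x : Eu n}
    (hx : 2 ≤ k * x i₀) : f x = 0 := by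
  have hc := continuous_cutFun_mul hk hf
  have h1 : ∀ x, 0 ≤ cutFun (k * x i₀) * f x := fun x => mul_nonneg (cutFun_nonneg _) (h0 x)
  have h2 := (integral_eq_zero_iff_of_nonneg h1 (integrable_of_continuous_of_zero (R := R) hc
    fun x hx => by rw [hR x hx, mul_zero])).1 (le_antisymm hI (integral_nonneg h1))
  have h3 := congrFun ((hc.ae_eq_iff_eq volume continuous_zero).1 h2) x
  simpa only [cutFun_of_ge hx, one_mul, Pi.zero_apply] using h3

lemma le_zero_of_le_mul_rpow {a C e r : ℝ} (he : e < 0)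
    (h : ∀ R, r ≤ R → a ≤ C * R ^ e) : a ≤ 0 := by
  have h1 : Tendsto (fun R : ℝ => C * R ^ e) atTop (𝓝 (C * 0)) := by
    have := tendsto_rpow_neg_atTop (neg_pos.2 he)
    rw [neg_neg] at this
    exact this.const_mul C
  rw [mul_zero] at h1
  exact ge_of_tendsto h1 ((eventually_ge_atTop r).mono h)

namespace HalfSol

variable {n : ℕ} {i₀ : Fin n} {q M : ℝ} {u : Eu n × ℝ → ℝ}

lemma tent_incr_integral_nonpos (h : HalfSol i₀ q M u) (hq : 1 < q)
    (he : (n : ℝ) - 1 / (q - 1) - 2 < 0) {r k H : ℝ} (hr : 4 ≤ r) (hk : 0 < k) (hH : 0 ≤ H)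
    (hH1 : H ≤ 1) :
    ∫ t in -(r ^ 2 + 1)..(r ^ 2 + 1), tent (r ^ 2) t * incr u i₀ (bump i₀ r) k t (t + H) ≤ 0 := by
  obtain ⟨C, hC⟩ := h.exists_tent_incr_le hq
  refine le_zero_of_le_mul_rpow (r := 2 * r) (C := C) he fun S hS => ?_
  obtain ⟨R, rfl⟩ : ∃ R, S = 2 * R := ⟨S / 2, by ring⟩
  have hrR : r ≤ R := by linarith
  have hr2 : r ^ 2 ≤ R ^ 2 := by gcongr
  have hp := testPair_bump (i₀ := i₀) hr
  have hP := testPair_bump (i₀ := i₀) (hr.trans hrR)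
  have cont : ∀ {ρ}, 4 ≤ ρ → Continuous fun t =>
      tent (ρ ^ 2) t * incr u i₀ (bump i₀ ρ) k t (t + H) := fun hρ =>
    (continuous_tent _).mul ((h.continuous_incr hk (testPair_bump hρ).contDiff.continuous
      (testPair_bump hρ).zero).comp (f := fun s : ℝ => (s, s + H)) (by fun_prop))
  have hmono : ∀ t, incr u i₀ (bump i₀ r) k t (t + H) ≤ incr u i₀ (bump i₀ R) k t (t + H) := by
    intro t
    have hc : ContinuousOn (fun x => 1 / 2 * (u (x, t + H) - u (x, t)) ^ 2) {x | 0 < x i₀} :=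
      continuousOn_const.mul (((h.continuousOn_slice _).sub (h.continuousOn_slice t)).pow 2)
    exact integral_cut_mono (R := 2 * R) hk (hc.mul hp.contDiff.continuous.continuousOn)
      (hc.mul hP.contDiff.continuous.continuousOn)
      (fun x hx => by rw [hp.zero x (by linarith), mul_zero])
      (fun x hx => by rw [hP.zero x hx, mul_zero])
      fun x _ => mul_le_mul_of_nonneg_left (bump_mono (by linarith) hrR x) (by positivity)
  refine le_trans ?_ (hC R (hr.trans hrR) k hk H hH hH1)
  refine (intervalIntegral.integral_mono_on (by nlinarith) ((cont hr).intervalIntegrable _ _)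
    (g := fun t => tent (R ^ 2) t * incr u i₀ (bump i₀ R) k t (t + H))
    ((cont (hr.trans hrR)).intervalIntegrable _ _) fun t _ => mul_le_mul
      (tent_mono (by positivity) hr2 t) (hmono t) (incr_nonneg hk hp.nonneg _ _)
      (tent_nonneg _ _)).trans ?_
  exact intervalIntegral.integral_mono_interval (by linarith) (by nlinarith) (by linarith)
    (Eventually.of_forall fun t => mul_nonneg (tent_nonneg _ _) (incr_nonneg hk hP.nonneg _ _))
    ((cont (hr.trans hrR)).intervalIntegrable _ _)

lemma eq_add_time (h : HalfSol i₀ q M u) (hq : 1 < q)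
    (he : (n : ℝ) - 1 / (q - 1) - 2 < 0) {x : Eu n} (hx : 0 < x i₀) (t : ℝ) {H : ℝ} (hH : 0 ≤ H)
    (hH1 : H ≤ 1) : u (x, t + H) = u (x, t) := by
  obtain ⟨r, hr4, hrt, hrx⟩ : ∃ r : ℝ, 4 ≤ r ∧ |t| < r ∧ ‖x - (2 : ℝ) • ev i₀‖ < r := by
    refine ⟨4 + |t| + ‖x - (2 : ℝ) • ev i₀‖, ?_, ?_, ?_⟩ <;>
    linarith [abs_nonneg t, norm_nonneg (x - (2 : ℝ) • ev i₀)]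
  have hrt2 : |t| < r ^ 2 := by nlinarith
  have hk : 0 < 2 / x i₀ := by positivity
  have hp := testPair_bump (i₀ := i₀) hr4
  have hζ := hp.contDiff.continuous
  have hI := h.tent_incr_integral_nonpos hq he hr4 hk hH hH1
  have h0 : incr u i₀ (bump i₀ r) (2 / x i₀) t (t + H) ≤ 0 := by
    by_contra! hpos
    refine hI.not_gt (intervalIntegral.integral_pos (by nlinarith) ?_ (fun s _ =>
      mul_nonneg (tent_nonneg _ _) (incr_nonneg hk hp.nonneg _ _)) ⟨t, ?_, ?_⟩)
    · exact ((continuous_tent _).mul ((h.continuous_incr hk hζ hp.zero).comp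
        (f := fun s : ℝ => (s, s + H)) (by fun_prop))).continuousOn
    · have := abs_lt.1 hrt2
      exact ⟨by linarith, by linarith⟩
    · exact mul_pos (tent_pos hrt2) hpos
  have h1 := eq_zero_of_integral_cut_nonpos (R := 2 * r) hk
    (f := fun x => 1 / 2 * (u (x, t + H) - u (x, t)) ^ 2 * bump i₀ r x)
    ((continuousOn_const.mul (((h.continuousOn_slice (t + H)).sub
      (h.continuousOn_slice t)).pow 2)).mul hζ.continuousOn)
    (fun x hx => by rw [hp.zero x hx, mul_zero])
    (fun x => mul_nonneg (mul_nonneg (by norm_num) (sq_nonneg _)) (hp.nonneg x)) h0 (x := x)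
    (by rw [div_mul_cancel₀ _ hx.ne'])
  have h2 : bump i₀ r x ≠ 0 := (pow_pos (cap_pos hrx) 2).ne'
  have h3 : (u (x, t + H) - u (x, t)) ^ 2 = 0 := by
    have := (mul_eq_zero.1 h1).resolve_right h2
    linarith
  exact sub_eq_zero.1 (pow_eq_zero_iff two_ne_zero |>.1 h3)

/-- In the subcritical range every bounded positive solution is stationary. -/
lemma eq_time (h : HalfSol i₀ q M u) (hq : 1 < q)
    (he : (n : ℝ) - 1 / (q - 1) - 2 < 0) {x : Eu n} (hx : 0 < x i₀) (t s : ℝ) :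
    u (x, t) = u (x, s) := by
  have hd : ∀ t, HasDerivAt (fun s => u (x, s)) (lap (fun y => u (y, t)) x) t :=
    fun t => (h.caloric x hx t).2
  refine is_const_of_deriv_eq_zero (fun t => (hd t).differentiableAt) (fun t => ?_) t s
  rw [(hd t).deriv]
  refine ((uniqueDiffWithinAt_Ici t).eq_deriv _ (hd t).hasDerivWithinAt ?_)
  refine (hasDerivWithinAt_const t (Ici t) (u (x, t))).congr_of_eventuallyEq ?_ rfl
  filter_upwards [Icc_mem_nhdsGE (show t < t + 1 by linarith)] with s hs
  have := h.eq_add_time hq he hx t (H := s - t) (by linarith [hs.1]) (by linarith [hs.2])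
  rwa [add_sub_cancel] at this

lemma gradSq_eq_zero (h : HalfSol i₀ q M u) (hq : 1 < q)
    (he : (n : ℝ) - 1 / (q - 1) - 2 < 0) {x : Eu n} (hx : 0 < x i₀) : gradSq u (x, 0) = 0 := by
  have hE : ∀ y : Eu n, 0 < y i₀ → ∀ t, gradSq u (y, t) = gradSq u (y, 0) := by
    intro y hy t
    refine Finset.sum_congr rfl fun i _ => ?_
    have : (fun z => u (z, t)) =ᶠ[𝓝 y] fun z => u (z, 0) :=
      ((isOpen_coord_pos i₀).mem_nhds hy : _ ∈ 𝓝 y) |> fun h' =>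
        mem_of_superset h' fun z hz => h.eq_time hq he hz t 0
    simp only
    rw [this.fderiv_eq]
  obtain ⟨C, hC0, hC⟩ := h.exists_grad_estimate hq
  have hk : 0 < 2 / x i₀ := by positivity
  set r := ‖x‖ + 1 with hr
  have hr0 : 0 < r := by positivity
  have hg := h.continuousOn_gradSq_slice 0
  have cc : ∀ ρ, ContinuousOn (fun x => gradSq u (x, 0) * cap ρ x ^ 4) {x | 0 < x i₀} :=
    fun ρ => hg.mul ((continuous_cap ρ).pow 4).continuousOn
  have cz : ∀ {ρ}, 0 < ρ → ∀ x : Eu n, ρ ≤ ‖x‖ → gradSq u (x, 0) * cap ρ x ^ 4 = 0 :=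
    fun hρ x hx => by rw [cap_eq_zero hρ hx]; ring
  have hI : ∫ y, cutFun (2 / x i₀ * y i₀) * (gradSq u (y, 0) * cap r y ^ 4) ≤ 0 := by
    refine le_zero_of_le_mul_rpow (r := r) (C := 2 * C) he fun R hR => ?_
    have hR0 := hr0.trans_le hR
    obtain ⟨m, hm, hkm⟩ := ((hC R hR0 0 (R ^ 2) (by positivity)).and
      (tendsto_natCast_atTop_atTop.eventually (eventually_ge_atTop (2 / x i₀)))).exists
    have hm0 : (0 : ℝ) < (m : ℝ) + 1 := by positivity
    have h1 : ∀ t, ∫ y, cutFun (((m : ℝ) + 1) * y i₀) * (gradSq u (y, t) * cap R y ^ 4) =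
        ∫ y, cutFun (((m : ℝ) + 1) * y i₀) * (gradSq u (y, 0) * cap R y ^ 4) := by
      intro t
      congr 1
      funext y
      by_cases hy : 0 < y i₀
      · rw [hE y hy t]
      · rw [cutFun_of_le (by nlinarith [not_lt.1 hy]), zero_mul, zero_mul]
    simp only [h1, intervalIntegral.integral_const, smul_eq_mul, sub_zero] at hm
    have h2 : ∫ y, cutFun (((m : ℝ) + 1) * y i₀) * (gradSq u (y, 0) * cap R y ^ 4) ≤
        2 * C * R ^ ((n : ℝ) - 1 / (q - 1) - 2) := by
      have : 0 < R ^ 2 := by positivity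
      refine le_of_mul_le_mul_left (hm.trans_eq ?_) this
      ring
    refine le_trans ?_ h2
    refine le_trans (integral_cut_mono (R := R) hk (cc r) (cc R)
      (fun y hy => cz hr0 y (hR.trans hy)) (cz hR0) fun y _ => mul_le_mul_of_nonneg_left
        (pow_le_pow_left₀ (cap_nonneg _ _) (cap_mono hr0 hR y) 4) (gradSq_nonneg _ _)) ?_
    refine integral_mono
      (integrable_of_continuous_of_zero (R := R) (continuous_cutFun_mul hk (cc R))
        fun y hy => by rw [cz hR0 y hy, mul_zero])
      (integrable_of_continuous_of_zero (R := R) (continuous_cutFun_mul hm0 (cc R))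
        fun y hy => by rw [cz hR0 y hy, mul_zero]) fun y => ?_
    by_cases hy : 0 < y i₀
    · exact mul_le_mul_of_nonneg_right (cutFun_monotone
        (mul_le_mul_of_nonneg_right (by linarith) hy.le))
        (mul_nonneg (gradSq_nonneg _ _) (pow_nonneg (cap_nonneg _ _) 4))
    · simp only
      rw [cutFun_of_le (by nlinarith [not_lt.1 hy]), cutFun_of_le (by nlinarith [not_lt.1 hy])]
  have h1 := eq_zero_of_integral_cut_nonpos (R := r) hk (cc r) (cz hr0)
    (fun y => mul_nonneg (gradSq_nonneg _ _) (pow_nonneg (cap_nonneg _ _) 4)) hI (x := x)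
    (by rw [div_mul_cancel₀ _ hx.ne'])
  exact (mul_eq_zero.1 h1).resolve_right (pow_pos (cap_pos (by linarith)) 4).ne'

theorem false_of_subcritical (h : HalfSol i₀ q M u) (hq : 1 < q)
    (he : (n : ℝ) - 1 / (q - 1) - 2 < 0) : False := by
  have h1 := h.bdry_tendsto 0 rfl 0
  have h2 : Tendsto (fun τ : ℝ => fderiv ℝ (fun y => u (y, 0)) (0 + τ • ev i₀) (ev i₀))
      (𝓝[>] 0) (𝓝 0) := by
    refine tendsto_const_nhds.congr' ?_
    filter_upwards [self_mem_nhdsWithin] with τ hτ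
    have hx : 0 < ((0 : Eu n) + τ • ev i₀) i₀ := by
      rw [coord_add_smul_ev]
      simpa using hτ
    have h3 := (Finset.sum_eq_zero_iff_of_nonneg fun i _ => sq_nonneg _).1
      (h.gradSq_eq_zero hq he hx) i₀ (Finset.mem_univ _)
    exact (pow_eq_zero_iff two_ne_zero |>.1 h3).symm
  have h3 := tendsto_nhds_unique h1 h2
  have h4 := Real.rpow_pos_of_pos (h.pos 0 le_rfl 0) q
  linarith

end HalfSol

lemma exponent_neg {m q : ℝ} (hq : 1 < q) (hm : (m - 2) * q < m - 1) :
    m - 1 / (q - 1) - 2 < 0 := by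
  have h0 : 0 < q - 1 := by linarith
  have : m - 2 < 1 / (q - 1) := (lt_div_iff₀ h0).2 (by linarith)
  linarith

/-- Liouville theorem for the half-space problem with nonlinear boundary
condition: for `n ≥ 1`, `q > 1` with `(n-2)q < n-1`, there is no positive bounded
classical solution. -/
theorem no_positive_bounded_halfspace_solution
    (n : ℕ) (hn : 0 < n) (q : ℝ) (hq : 1 < q)
    (hqn : ((n : ℝ) - 2) * q < (n : ℝ) - 1) :
    ¬ ∃ u : EuclideanSpace ℝ (Fin n) × ℝ → ℝ,
        IsHalfSpaceSol n hn q u ∧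
        ∃ M : ℝ, ∀ x ∈ closedHalf n hn, ∀ t : ℝ, u (x, t) ≤ M := by
  rintro ⟨u, hu, M, hM⟩
  exact (hu.halfSol hM).false_of_subcritical hq (exponent_neg hq hqn)
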